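/- arXiv:2505.12338 — 2 statements merged into one kernel-verified Lean document; each statement's English description precedes it below -/
import Mathlib

section
/- Let G be a strongly balanced connected graph with v(G) ≥ 2 vertices and e(G) edges, and suppose Assumption 1 holds for the subgraph count N_G. Then there exist a constant C > 0 and an n₀ such that for all n ≥ n₀ the normalized subgraph count N̄_G := (N_G − E[N_G])/√Var(N_G) satisfies: sup_{x∈ℝ} |P(N̄_G ≤ x) − Φ(x)| ≤ C / n^{1/(2+4v(G))} when n^{−(v(G)−1)/e(G)} ≪ p_n, and sup_{x∈ℝ} |P(N̄_G ≤ x) − Φ(x)| ≤ C / (n^{v(G)} p_n^{e(G)})^{1/(2+4v(G))} when p_n ≪ n^{−(v(G)−1)/e(G)}, where Φ is the cumulative distribution function of the standard normal distribution. -/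
open MeasureTheory Finset ProbabilityTheory

/-- The joint cumulant, via the moment–cumulant formula. -/
noncomputable def jointCumulant {Ω : Type*} [MeasurableSpace Ω] (P : Measure Ω)
    {j : ℕ} (Z : Fin j → Ω → ℝ) : ℝ :=
  ∑ σ : Finpartition (Finset.univ : Finset (Fin j)),
    (-1 : ℝ) ^ (σ.parts.card - 1) * ((σ.parts.card - 1).factorial : ℝ) *
      ∏ b ∈ σ.parts, ∫ ω, ∏ i ∈ b, Z i ω ∂P

/-- The `j`-th cumulant `κ_j(W)` of a random variable `W`. -/
noncomputable def cum {Ω : Type*} [MeasurableSpace Ω] (P : Measure Ω)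
    (j : ℕ) (W : Ω → ℝ) : ℝ :=
  jointCumulant P (fun _ : Fin j => W)

/-- The size `a(G)` of the automorphism group of `G`. -/
noncomputable def autCard {k : ℕ} (G : SimpleGraph (Fin k)) : ℕ := Nat.card (G ≃g G)

/-- The injective subgraph count `N_G` in the binomial random-connection model:
vertices `X_1,…,X_n`, and `X_i ∼ X_j` iff `Y_{i,j} ≤ p_n H(X_i,X_j)` where the
`Y_{i,j}` are i.i.d. uniform on `[0,1]`. -/
noncomputable def NG {d k n : ℕ} {Ω : Type*} (G : SimpleGraph (Fin k)) [DecidableRel G.Adj]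
    (H : (Fin d → ℝ) → (Fin d → ℝ) → ℝ) (pn : ℝ) (aG : ℕ)
    (X : Fin n → Ω → (Fin d → ℝ)) (Y : Fin n → Fin n → Ω → ℝ) (ω : Ω) : ℝ :=
  (aG : ℝ)⁻¹ * ∑ β ∈ (Finset.univ : Finset (Fin k → Fin n)).filter Function.Injective,
    ∏ q ∈ (Finset.univ : Finset (Fin k × Fin k)).filter (fun q => q.1 < q.2 ∧ G.Adj q.1 q.2),
      if Y (β q.1) (β q.2) ω ≤ pn * H (X (β q.1) ω) (X (β q.2) ω) then (1 : ℝ) else 0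

/-- The projection `f_{(ℓ)}` of the subgraph-count functional:
`f_{(ℓ)}(x) = (p^{e(G)}/a(G)) ∫ ∏_{(ı,ȷ)∈E_G} H(x_ı,x_ȷ) dμ^{⊗(k−1)}` with `x_ℓ = x`
(the unused `ℓ`-th coordinate is also integrated out, which is harmless since `μ` is a
probability measure). -/
noncomputable def fSub {d k : ℕ} (G : SimpleGraph (Fin k)) [DecidableRel G.Adj]
    (H : (Fin d → ℝ) → (Fin d → ℝ) → ℝ) (μ : Measure (Fin d → ℝ)) (pn : ℝ) (aG : ℕ)
    (ℓ : Fin k) (x : Fin d → ℝ) : ℝ :=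
  (pn ^ G.edgeFinset.card / (aG : ℝ)) *
    ∫ z : Fin k → (Fin d → ℝ),
      ∏ q ∈ (Finset.univ : Finset (Fin k × Fin k)).filter
          (fun q => q.1 < q.2 ∧ G.Adj q.1 q.2),
        H (Function.update z ℓ x q.1) (Function.update z ℓ x q.2)
      ∂(Measure.pi fun _ => μ)

/-- A graph `G` is strongly balanced if `e(H)/(v(H)−1) ≤ e(G)/(v(G)−1)` for every
subgraph `H` of `G` with at least two vertices. -/
def StronglyBalanced {k : ℕ} (G : SimpleGraph (Fin k)) [DecidableRel G.Adj] : Prop :=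
  ∀ Hs : G.Subgraph, 2 ≤ Hs.verts.ncard →
    Hs.edgeSet.ncard * (k - 1) ≤ G.edgeFinset.card * (Hs.verts.ncard - 1)

/-- The normalized subgraph count `N̄_G = (N_G − E[N_G])/√Var(N_G)`. -/
noncomputable def NGbar {d k n : ℕ} {Ω : Type*} [MeasurableSpace Ω] (P : Measure Ω)
    (G : SimpleGraph (Fin k)) [DecidableRel G.Adj]
    (H : (Fin d → ℝ) → (Fin d → ℝ) → ℝ) (pn : ℝ) (aG : ℕ)
    (X : Fin n → Ω → (Fin d → ℝ)) (Y : Fin n → Fin n → Ω → ℝ) (ω : Ω) : ℝ :=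
  (NG G H pn aG X Y ω - ∫ ω', NG G H pn aG X Y ω' ∂P) /
    Real.sqrt (variance (NG G H pn aG X Y) P)

/-- The cumulative distribution function `Φ` of the standard normal distribution. -/
noncomputable def gaussCdf (x : ℝ) : ℝ :=
  (Real.sqrt (2 * Real.pi))⁻¹ * ∫ t in Set.Iic x, Real.exp (-(t ^ 2) / 2)

lemma gaussianPDFReal_std (x : ℝ) :
    gaussianPDFReal 0 1 x = (Real.sqrt (2 * Real.pi))⁻¹ * Real.exp (-(x ^ 2) / 2) := by
  simp [gaussianPDFReal_def]

lemma integrable_bounded {α : Type*} [MeasurableSpace α] {ν : Measure α} [IsFiniteMeasure ν]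
    {f : α → ℝ} (hf : Measurable f) {B : ℝ} (hB : ∀ x, |f x| ≤ B) : Integrable f ν :=
  Integrable.of_bound hf.aestronglyMeasurable B (Filter.Eventually.of_forall hB)

/-- Gaussian integration by parts. -/
lemma gaussian_integral_mul_eq (h h' : ℝ → ℝ) (B : ℝ) (hd : ∀ x, HasDerivAt h (h' x) x)
    (hm : Measurable h') (hB : ∀ x, |h x| ≤ B) (hB' : ∀ x, |h' x| ≤ B) :
    ∫ z, z * h z ∂(gaussianReal 0 1) = ∫ z, h' z ∂(gaussianReal 0 1) := by
  have hcont : Continuous h := continuous_iff_continuousAt.2 fun x => (hd x).continuousAt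
  have hpd : ∀ x, HasDerivAt (gaussianPDFReal 0 1) (-x * gaussianPDFReal 0 1 x) x := by
    intro x
    have h1 : HasDerivAt (fun x : ℝ => -(x ^ 2) / 2) (-x) x :=
      ((hasDerivAt_pow 2 x).fun_neg.div_const 2).congr_deriv (by norm_num; ring)
    have h2 := (h1.exp).const_mul (Real.sqrt (2 * Real.pi))⁻¹
    have h3 : gaussianPDFReal 0 1 =
        fun x => (Real.sqrt (2 * Real.pi))⁻¹ * Real.exp (-(x ^ 2) / 2) :=
      funext gaussianPDFReal_std
    rw [h3]
    exact h2.congr_deriv (by ring)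
  have hint0 : Integrable (gaussianPDFReal 0 1) := integrable_gaussianPDFReal 0 1
  have hint1 : Integrable (fun x => x * gaussianPDFReal 0 1 x) := by
    have := (integrable_mul_exp_neg_mul_sq (b := 1 / 2) (by norm_num)).const_mul
      (Real.sqrt (2 * Real.pi))⁻¹
    refine this.congr (Filter.Eventually.of_forall fun x => ?_)
    simp only [gaussianPDFReal_std]
    rw [show -(1 / 2 : ℝ) * x ^ 2 = -(x ^ 2) / 2 by ring]
    ring
  have hbd : ∀ {f u : ℝ → ℝ}, Integrable f → Measurable u → (∀ x, |u x| ≤ B) →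
      Integrable (fun x => f x * u x) := by
    intro f u hf hu hb
    exact hf.mul_bdd hu.aestronglyMeasurable (Filter.Eventually.of_forall hb)
  have key := integral_mul_deriv_eq_deriv_mul_of_integrable (u := gaussianPDFReal 0 1) (v := h)
    (u' := fun x => -x * gaussianPDFReal 0 1 x) (v' := h') (fun x _ => hpd x) (fun x _ => hd x)
    (hbd hint0 hm hB') ?_ (hbd hint0 hcont.measurable hB)
  · rw [integral_gaussianReal_eq_integral_smul one_ne_zero,
      integral_gaussianReal_eq_integral_smul one_ne_zero]
    simp only [smul_eq_mul]
    rw [key, ← integral_neg]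
    congr 1
    ext x
    ring
  · have := (hbd hint1 hcont.measurable hB).neg
    refine this.congr (Filter.Eventually.of_forall fun x => ?_)
    simp

/-- Smooth comparison with the Gaussian, from an approximate integration by parts formula. -/
lemma smooth_comparison {Ω : Type*} [MeasurableSpace Ω] (P : Measure Ω) [IsProbabilityMeasure P]
    (W : Ω → ℝ) (hWm : Measurable W) (B : ℝ) (hWB : ∀ ω, |W ω| ≤ B) (ε : ℝ)
    (hstein : ∀ (g g' : ℝ → ℝ) (M : ℝ), (∀ x, HasDerivAt g (g' x) x) →
      (∀ x y, |g' x - g' y| ≤ M * |x - y|) →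
      |∫ ω, W ω * g (W ω) ∂P - ∫ ω, g' (W ω) ∂P| ≤ M * ε)
    (h h1 h2 : ℝ → ℝ) (D L : ℝ) (hd : ∀ x, HasDerivAt h (h1 x) x)
    (hd1 : ∀ x, HasDerivAt h1 (h2 x) x) (hh : ∀ x, |h x| ≤ D) (hh1 : ∀ x, |h1 x| ≤ D)
    (hh2 : ∀ x, |h2 x| ≤ D) (hL : ∀ x y, |h2 x - h2 y| ≤ L * |x - y|) :
    |∫ ω, h (W ω) ∂P - ∫ z, h z ∂(gaussianReal 0 1)| ≤ L * ε * (Real.pi / 2) := by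
  set γ := gaussianReal 0 1 with hγ
  have hD : 0 ≤ D := (abs_nonneg _).trans (hh 0)
  have hL0 : 0 ≤ L := by
    have := (abs_nonneg _).trans (hL 0 1)
    simpa using this
  have hε : 0 ≤ ε := by
    have := hstein (fun x => x ^ 2 / 2) (fun x => x) 1 (fun x =>
      ((hasDerivAt_pow 2 x).div_const 2).congr_deriv (by norm_num)) (fun x y => by simp)
    have := (abs_nonneg _).trans this
    simpa using this
  have hB0 : 0 ≤ B := by
    obtain ⟨ω⟩ := P.nonempty_of_neZero
    exact (abs_nonneg _).trans (hWB ω)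
  have hc : Continuous h := continuous_iff_continuousAt.2 fun x => (hd x).continuousAt
  have hc1 : Continuous h1 := continuous_iff_continuousAt.2 fun x => (hd1 x).continuousAt
  have hc2 : Continuous h2 := by
    have : LipschitzWith (Real.toNNReal L) h2 := LipschitzWith.of_dist_le_mul fun x y => by
      rw [Real.dist_eq, Real.dist_eq, Real.coe_toNNReal _ hL0]; exact hL x y
    exact this.continuous
  let S : ℝ → Ω × ℝ → ℝ := fun θ q => Real.cos θ * W q.1 + Real.sin θ * q.2
  let S' : ℝ → Ω × ℝ → ℝ := fun θ q => -Real.sin θ * W q.1 + Real.cos θ * q.2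
  have hSm : ∀ θ, Measurable (S θ) := fun θ => by fun_prop
  have hSm' : ∀ θ, Measurable (S' θ) := fun θ => by fun_prop
  have hidint : Integrable (fun z : ℝ => z) γ :=
    (memLp_id_gaussianReal (μ := 0) (v := 1) 1).integrable le_rfl
  have hWint : Integrable (fun q : Ω × ℝ => W q.1) (P.prod γ) :=
    integrable_bounded (by fun_prop) (fun q => hWB q.1)
  have hzint : Integrable (fun q : Ω × ℝ => q.2) (P.prod γ) := hidint.comp_snd P
  have hder : ∀ θ, HasDerivAt (fun θ => ∫ q, h (S θ q) ∂(P.prod γ))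
      (∫ q, S' θ q * h1 (S θ q) ∂(P.prod γ)) θ := by
    intro θ
    refine (hasDerivAt_integral_of_dominated_loc_of_deriv_le (s := Set.univ)
      (bound := fun q : Ω × ℝ => (B + |q.2|) * D) Filter.univ_mem
      (Filter.Eventually.of_forall fun θ => (hc.measurable.comp (hSm θ)).aestronglyMeasurable)
      (integrable_bounded (hc.measurable.comp (hSm θ)) (fun q => hh _))
      (F' := fun θ q => S' θ q * h1 (S θ q))
      ((hSm' θ).mul (hc1.measurable.comp (hSm θ))).aestronglyMeasurable
      (Filter.Eventually.of_forall fun q θ _ => ?_) ?_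
      (Filter.Eventually.of_forall fun q θ _ => ?_)).2
    · rw [Real.norm_eq_abs, abs_mul]
      refine mul_le_mul ?_ (hh1 _) (abs_nonneg _) (by positivity)
      refine (abs_add_le _ _).trans ?_
      rw [abs_mul, abs_mul, abs_neg]
      refine add_le_add ?_ ?_
      · calc _ ≤ 1 * |W q.1| := mul_le_mul_of_nonneg_right (Real.abs_sin_le_one _) (abs_nonneg _)
          _ ≤ B := by rw [one_mul]; exact hWB _
      · calc _ ≤ 1 * |q.2| := mul_le_mul_of_nonneg_right (Real.abs_cos_le_one _) (abs_nonneg _)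
          _ = _ := one_mul _
    · exact ((integrable_const B).add hzint.abs).mul_const D
    · have e : HasDerivAt (fun θ => S θ q) (S' θ q) θ :=
        ((Real.hasDerivAt_cos θ).mul_const (W q.1)).add ((Real.hasDerivAt_sin θ).mul_const q.2)
      exact ((hd (S θ q)).comp θ e).congr_deriv (mul_comm _ _)
  have hbound : ∀ θ ∈ Set.Icc 0 (Real.pi / 2),
      ‖∫ q, S' θ q * h1 (S θ q) ∂(P.prod γ)‖ ≤ L * ε := by
    intro θ hθ
    set c := Real.cos θ
    set s := Real.sin θ
    have hc01 : |c| ≤ 1 := Real.abs_cos_le_one θ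
    have hs01 : |s| ≤ 1 := Real.abs_sin_le_one θ
    have hi1 : Integrable (fun q : Ω × ℝ => W q.1 * h1 (c * W q.1 + s * q.2)) (P.prod γ) :=
      hWint.mul_bdd (hc1.measurable.comp (hSm θ)).aestronglyMeasurable
        (Filter.Eventually.of_forall fun q => hh1 _)
    have hi2 : Integrable (fun q : Ω × ℝ => q.2 * h1 (c * W q.1 + s * q.2)) (P.prod γ) :=
      hzint.mul_bdd (hc1.measurable.comp (hSm θ)).aestronglyMeasurable
        (Filter.Eventually.of_forall fun q => hh1 _)
    have hi3 : Integrable (fun q : Ω × ℝ => h2 (c * W q.1 + s * q.2)) (P.prod γ) :=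
      integrable_bounded (hc2.measurable.comp (hSm θ)) (fun q => hh2 _)
    have e1 : ∫ q, S' θ q * h1 (S θ q) ∂(P.prod γ)
        = -s * ∫ q : Ω × ℝ, W q.1 * h1 (c * W q.1 + s * q.2) ∂(P.prod γ)
          + c * ∫ q : Ω × ℝ, q.2 * h1 (c * W q.1 + s * q.2) ∂(P.prod γ) := by
      rw [← integral_const_mul, ← integral_const_mul,
        ← integral_add (hi1.const_mul _) (hi2.const_mul _)]
      congr 1
      ext q
      simp only [S, S']
      ring
    have e2 : ∫ q : Ω × ℝ, q.2 * h1 (c * W q.1 + s * q.2) ∂(P.prod γ)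
        = s * ∫ q : Ω × ℝ, h2 (c * W q.1 + s * q.2) ∂(P.prod γ) := by
      rw [integral_prod _ hi2, integral_prod _ hi3, ← integral_const_mul]
      congr 1
      ext ω
      simp only
      rw [gaussian_integral_mul_eq (fun z => h1 (c * W ω + s * z))
        (fun z => s * h2 (c * W ω + s * z)) D ?_ (by fun_prop) (fun z => hh1 _) ?_,
        integral_const_mul]
      · intro z
        have e : HasDerivAt (fun z => c * W ω + s * z) s z := by
          simpa using ((hasDerivAt_id z).const_mul s).const_add (c * W ω)
        exact ((hd1 (c * W ω + s * z)).comp z e).congr_deriv (mul_comm _ _)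
      · intro z
        rw [abs_mul]
        calc _ ≤ 1 * |h2 (c * W ω + s * z)| := mul_le_mul_of_nonneg_right hs01 (abs_nonneg _)
          _ ≤ D := by rw [one_mul]; exact hh2 _
    have e3 : |∫ q : Ω × ℝ, W q.1 * h1 (c * W q.1 + s * q.2) ∂(P.prod γ)
        - c * ∫ q : Ω × ℝ, h2 (c * W q.1 + s * q.2) ∂(P.prod γ)| ≤ L * ε := by
      rw [integral_prod_symm _ hi1, integral_prod_symm _ hi3, ← integral_const_mul,
        ← integral_sub hi1.integral_prod_right (hi3.integral_prod_right.const_mul c)]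
      have hz : ∀ z : ℝ, ‖∫ ω, W ω * h1 (c * W ω + s * z) ∂P
          - c * ∫ ω, h2 (c * W ω + s * z) ∂P‖ ≤ L * ε := by
        intro z
        have := hstein (fun w => h1 (c * w + s * z)) (fun w => c * h2 (c * w + s * z)) L ?_ ?_
        · rwa [integral_const_mul] at this
        · intro w
          have e : HasDerivAt (fun w => c * w + s * z) c w := by
            simpa using ((hasDerivAt_id w).const_mul c).add_const (s * z)
          exact ((hd1 (c * w + s * z)).comp w e).congr_deriv (mul_comm _ _)
        · intro x y
          rw [← mul_sub, abs_mul]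
          calc |c| * |h2 (c * x + s * z) - h2 (c * y + s * z)|
              ≤ 1 * (L * |(c * x + s * z) - (c * y + s * z)|) :=
                mul_le_mul hc01 (hL _ _) (abs_nonneg _) zero_le_one
            _ = L * (|c| * |x - y|) := by rw [← abs_mul, one_mul]; ring_nf
            _ ≤ L * (1 * |x - y|) := by gcongr
            _ = L * |x - y| := by ring
      have := norm_integral_le_of_norm_le_const (μ := γ) (Filter.Eventually.of_forall hz)
      simpa using this
    rw [e1, e2, Real.norm_eq_abs]
    set A := ∫ q : Ω × ℝ, W q.1 * h1 (c * W q.1 + s * q.2) ∂(P.prod γ)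
    set E := ∫ q : Ω × ℝ, h2 (c * W q.1 + s * q.2) ∂(P.prod γ)
    calc |-s * A + c * (s * E)| = |s| * |A - c * E| := by
          rw [← abs_mul, ← abs_neg]; ring_nf
      _ ≤ 1 * (L * ε) := mul_le_mul hs01 e3 (abs_nonneg _) zero_le_one
      _ = L * ε := one_mul _
  have hfin := Convex.norm_image_sub_le_of_norm_hasDerivWithin_le
    (f := fun θ => ∫ q, h (S θ q) ∂(P.prod γ)) (x := Real.pi / 2) (y := 0)
    (fun θ _ => (hder θ).hasDerivWithinAt) hbound (convex_Icc _ _)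
    (by constructor <;> linarith [Real.pi_pos]) (by constructor <;> linarith [Real.pi_pos])
  have f0 : ∫ q, h (S 0 q) ∂(P.prod γ) = ∫ ω, h (W ω) ∂P := by
    simp only [S, Real.cos_zero, Real.sin_zero, one_mul, zero_mul, add_zero]
    rw [integral_fun_fst (fun ω => h (W ω))]
    simp
  have f1 : ∫ q, h (S (Real.pi / 2) q) ∂(P.prod γ) = ∫ z, h z ∂γ := by
    simp only [S, Real.cos_pi_div_two, Real.sin_pi_div_two, one_mul, zero_mul, zero_add]
    rw [integral_fun_snd (fun z => h z)]
    simp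
  simp only [f0, f1] at hfin
  rwa [Real.norm_eq_abs, Real.norm_eq_abs, zero_sub, abs_neg,
    abs_of_pos (a := Real.pi / 2) (by positivity)] at hfin

/-- A twice differentiable step from `0` to `1` whose second derivative is Lipschitz. -/
lemma exists_smooth_step : ∃ (s s1 s2 : ℝ → ℝ) (D L : ℝ), 0 < D ∧ 0 < L ∧
    (∀ x, HasDerivAt s (s1 x) x) ∧ (∀ x, HasDerivAt s1 (s2 x) x) ∧
    (∀ x, 0 ≤ s x) ∧ (∀ x, s x ≤ 1) ∧ (∀ x ≤ 0, s x = 0) ∧ (∀ x, 1 ≤ x → s x = 1) ∧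
    (∀ x, |s1 x| ≤ D) ∧ (∀ x, |s2 x| ≤ D) ∧ (∀ x y, |s2 x - s2 y| ≤ L * |x - y|) := by
  set f := Real.smoothTransition with hf
  have hcd : ContDiff ℝ 3 f := Real.smoothTransition.contDiff (n := 3)
  have hcd1 : ContDiff ℝ 2 (deriv f) := hcd.deriv'
  have hcd2 : ContDiff ℝ 1 (deriv (deriv f)) := hcd1.deriv'
  have hcd3 : Continuous (deriv (deriv (deriv f))) := hcd2.continuous_deriv le_rfl
  have hsupp : HasCompactSupport (deriv f) := by
    refine HasCompactSupport.intro (isCompact_Icc (a := (0 : ℝ)) (b := 1)) fun x hx => ?_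
    rw [Set.mem_Icc, not_and_or, not_le, not_le] at hx
    rcases hx with hx | hx
    · have : f =ᶠ[nhds x] fun _ => (0 : ℝ) := by
        filter_upwards [Iio_mem_nhds hx] with y hy
        exact Real.smoothTransition.zero_of_nonpos (le_of_lt hy)
      rw [this.deriv_eq, deriv_const]
    · have : f =ᶠ[nhds x] fun _ => (1 : ℝ) := by
        filter_upwards [Ioi_mem_nhds hx] with y hy
        exact Real.smoothTransition.one_of_one_le (le_of_lt hy)
      rw [this.deriv_eq, deriv_const]
  obtain ⟨C1, hC1⟩ := hcd1.continuous.bounded_above_of_compact_support hsupp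
  obtain ⟨C2, hC2⟩ := hcd2.continuous.bounded_above_of_compact_support hsupp.deriv
  obtain ⟨C3, hC3⟩ := hcd3.bounded_above_of_compact_support hsupp.deriv.deriv
  have hC1' : 0 ≤ C1 := (norm_nonneg _).trans (hC1 0)
  have hC2' : 0 ≤ C2 := (norm_nonneg _).trans (hC2 0)
  have hC3' : 0 ≤ C3 := (norm_nonneg _).trans (hC3 0)
  refine ⟨f, deriv f, deriv (deriv f), C1 + C2 + 1, C3 + 1, by positivity, by positivity,
    fun x => ((hcd.differentiable (by norm_num)) x).hasDerivAt,
    fun x => ((hcd1.differentiable (by norm_num)) x).hasDerivAt,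
    Real.smoothTransition.nonneg, Real.smoothTransition.le_one,
    fun x hx => Real.smoothTransition.zero_of_nonpos hx,
    fun x hx => Real.smoothTransition.one_of_one_le hx,
    fun x => (hC1 x).trans (by linarith), fun x => (hC2 x).trans (by linarith), fun x y => ?_⟩
  have := Convex.norm_image_sub_le_of_norm_hasDerivWithin_le (s := Set.univ) (x := y) (y := x)
    (fun x _ => ((hcd2.differentiable (by norm_num)) x).hasDerivAt.hasDerivWithinAt)
    (fun x _ => hC3 x) convex_univ (Set.mem_univ _) (Set.mem_univ _)
  calc _ ≤ C3 * |x - y| := this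
    _ ≤ _ := by gcongr; linarith

lemma gaussianReal_Iic_add_le (x δ : ℝ) (hδ : 0 ≤ δ) :
    (gaussianReal 0 1).real (Set.Iic (x + δ)) ≤ (gaussianReal 0 1).real (Set.Iic x) + δ := by
  have hU : Set.Iic (x + δ) = Set.Iic x ∪ Set.Ioc x (x + δ) :=
    (Set.Iic_union_Ioc_eq_Iic (by linarith)).symm
  have hle : gaussianReal 0 1 (Set.Ioc x (x + δ)) ≤ ENNReal.ofReal δ := by
    rw [gaussianReal_apply 0 one_ne_zero]
    calc ∫⁻ z in Set.Ioc x (x + δ), gaussianPDF 0 1 z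
        ≤ ∫⁻ z in Set.Ioc x (x + δ), 1 := by
          refine lintegral_mono fun z => ?_
          rw [gaussianPDF, gaussianPDFReal_std, ← ENNReal.ofReal_one]
          refine ENNReal.ofReal_le_ofReal (mul_le_one₀ ?_ (Real.exp_pos _).le ?_)
          · refine inv_le_one_of_one_le₀ (Real.one_le_sqrt.2 ?_)
            linarith [Real.pi_gt_three]
          · exact Real.exp_le_one_iff.2 (by nlinarith [sq_nonneg z])
      _ = ENNReal.ofReal δ := by simp
  rw [hU]
  refine (measureReal_union_le _ _).trans ?_
  gcongr
  exact ENNReal.toReal_le_of_le_ofReal hδ hle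

/-- Smoothing inequality: an approximate Gaussian integration by parts formula bounds the
Kolmogorov distance. -/
lemma exists_smoothing_constant : ∃ K > (0 : ℝ), ∀ (Ω : Type) [MeasurableSpace Ω]
    (P : Measure Ω) [IsProbabilityMeasure P] (W : Ω → ℝ) (_ : Measurable W) (B : ℝ)
    (_ : ∀ ω, |W ω| ≤ B) (ε : ℝ)
    (_ : ∀ (g g' : ℝ → ℝ) (M : ℝ), (∀ x, HasDerivAt g (g' x) x) →
      (∀ x y, |g' x - g' y| ≤ M * |x - y|) →
      |∫ ω, W ω * g (W ω) ∂P - ∫ ω, g' (W ω) ∂P| ≤ M * ε)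
    (δ : ℝ) (_ : 0 < δ) (_ : δ ≤ 1) (x : ℝ),
    |P.real {ω | W ω ≤ x} - (gaussianReal 0 1).real (Set.Iic x)| ≤ δ + K * ε / δ ^ 3 := by
  obtain ⟨s, s1, s2, D, L, hD, hL, hd, hd1, hs0, hs1, hz, ho, hb1, hb2, hlip⟩ :=
    exists_smooth_step
  refine ⟨L * (Real.pi / 2), by positivity, ?_⟩
  intro Ω _ P _ W hWm B hWB ε hstein δ hδ hδ1 x
  set γ := gaussianReal 0 1 with hγ
  have hsc : Continuous s := continuous_iff_continuousAt.2 fun x => (hd x).continuousAt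
  have hinv : 1 ≤ δ⁻¹ := (one_le_inv₀ hδ).2 hδ1
  have key : ∀ a : ℝ, |∫ ω, s ((a - W ω) / δ) ∂P - ∫ z, s ((a - z) / δ) ∂γ|
      ≤ L * (Real.pi / 2) * ε / δ ^ 3 := by
    intro a
    have hlin : ∀ w, HasDerivAt (fun w : ℝ => (a - w) / δ) (-δ⁻¹) w := fun w =>
      (((hasDerivAt_id w).const_sub a).div_const δ).congr_deriv (by simp [neg_div])
    have := smooth_comparison P W hWm B hWB ε hstein (fun w => s ((a - w) / δ))
      (fun w => -δ⁻¹ * s1 ((a - w) / δ)) (fun w => δ⁻¹ ^ 2 * s2 ((a - w) / δ))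
      (1 + δ⁻¹ ^ 2 * D) (L * δ⁻¹ ^ 3)
      (fun w => ((hd _).comp w (hlin w)).congr_deriv (mul_comm _ _))
      (fun w => (((hd1 _).comp w (hlin w)).const_mul (-δ⁻¹)).congr_deriv (by ring))
      ?_ ?_ ?_ ?_
    · refine this.trans (le_of_eq ?_)
      field_simp
    · intro w
      rw [abs_of_nonneg (hs0 _)]
      have : 0 ≤ δ⁻¹ ^ 2 * D := by positivity
      linarith [hs1 ((a - w) / δ)]
    · intro w
      rw [abs_mul, abs_neg, abs_of_pos (by positivity : 0 < δ⁻¹)]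
      have : δ⁻¹ ≤ δ⁻¹ ^ 2 := by nlinarith
      calc δ⁻¹ * |s1 ((a - w) / δ)| ≤ δ⁻¹ ^ 2 * D := by
            gcongr
            exact hb1 _
        _ ≤ _ := by linarith
    · intro w
      rw [abs_mul, abs_of_pos (by positivity : 0 < δ⁻¹ ^ 2)]
      calc δ⁻¹ ^ 2 * |s2 ((a - w) / δ)| ≤ δ⁻¹ ^ 2 * D := by
            gcongr
            exact hb2 _
        _ ≤ _ := by linarith
    · intro u v
      rw [← mul_sub, abs_mul, abs_of_pos (by positivity : 0 < δ⁻¹ ^ 2)]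
      calc δ⁻¹ ^ 2 * |s2 ((a - u) / δ) - s2 ((a - v) / δ)|
          ≤ δ⁻¹ ^ 2 * (L * |(a - u) / δ - (a - v) / δ|) := by
            gcongr
            exact hlip _ _
        _ = L * δ⁻¹ ^ 3 * |u - v| := by
            rw [← sub_div, abs_div, abs_of_pos hδ, ← abs_neg (u - v)]
            ring_nf
  have hup : ∀ (Ω' : Type) [MeasurableSpace Ω'] (P' : Measure Ω') [IsProbabilityMeasure P']
      (V : Ω' → ℝ), Measurable V → ∀ a : ℝ,
      P'.real {ω | V ω ≤ a - δ} ≤ ∫ ω, s ((a - V ω) / δ) ∂P' ∧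
      ∫ ω, s ((a - V ω) / δ) ∂P' ≤ P'.real {ω | V ω ≤ a} := by
    intro Ω' _ P' _ V hV a
    have hs_int : Integrable (fun ω => s ((a - V ω) / δ)) P' :=
      integrable_bounded (by fun_prop) (B := 1) (fun ω => by
        rw [abs_of_nonneg (hs0 _)]; exact hs1 _)
    have hms : ∀ b : ℝ, MeasurableSet {ω | V ω ≤ b} := fun b => hV measurableSet_Iic
    constructor
    · rw [← integral_indicator_one (hms _)]
      refine integral_mono ((integrable_const (1 : ℝ)).indicator (hms _)) hs_int fun ω => ?_
      by_cases hω : V ω ≤ a - δ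
      · rw [Set.indicator_of_mem (by exact hω), Pi.one_apply]
        simp only
        rw [ho _ (by rw [le_div_iff₀ hδ]; linarith)]
      · rw [Set.indicator_of_notMem (by exact hω)]
        exact hs0 _
    · rw [← integral_indicator_one (hms _)]
      refine integral_mono hs_int ((integrable_const (1 : ℝ)).indicator (hms _)) fun ω => ?_
      by_cases hω : V ω ≤ a
      · rw [Set.indicator_of_mem (by exact hω), Pi.one_apply]
        exact hs1 _
      · rw [Set.indicator_of_notMem (by exact hω)]
        simp only
        rw [hz _ (div_nonpos_of_nonpos_of_nonneg (by linarith) hδ.le)]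
  have k1 := abs_le.1 (key (x + δ))
  have k2 := abs_le.1 (key x)
  have u1 := (hup Ω P W hWm (x + δ)).1
  have u2 := (hup Ω P W hWm x).2
  have g1 := (hup ℝ γ id measurable_id (x + δ)).2
  have g2 := (hup ℝ γ id measurable_id x).1
  have i1 := gaussianReal_Iic_add_le x δ hδ.le
  have i2 := gaussianReal_Iic_add_le (x - δ) δ hδ.le
  simp only [id, add_sub_cancel_right] at u1 g1 g2
  rw [sub_add_cancel] at i2
  have e1 : {ω : ℝ | ω ≤ x + δ} = Set.Iic (x + δ) := rfl
  have e2 : {ω : ℝ | ω ≤ x - δ} = Set.Iic (x - δ) := rfl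
  rw [e1] at g1
  rw [e2] at g2
  rw [abs_le]
  constructor <;> linarith [k1.1, k1.2, k2.1, k2.2]

/-- Bounded measurable real functions. -/
def BddMeasurable {Ω : Type*} [MeasurableSpace Ω] (f : Ω → ℝ) : Prop :=
  Measurable f ∧ ∃ B : ℝ, ∀ ω, |f ω| ≤ B

namespace BddMeasurable

variable {Ω : Type*} [MeasurableSpace Ω] {f g : Ω → ℝ}

lemma integrable (hf : BddMeasurable f) (P : Measure Ω) [IsFiniteMeasure P] : Integrable f P := by
  obtain ⟨hm, B, hB⟩ := hf
  exact integrable_bounded hm hB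

lemma const (c : ℝ) : BddMeasurable (fun _ : Ω => c) := ⟨measurable_const, |c|, fun _ => le_rfl⟩

lemma add (hf : BddMeasurable f) (hg : BddMeasurable g) :
    BddMeasurable (fun ω => f ω + g ω) := by
  obtain ⟨hm, B, hB⟩ := hf
  obtain ⟨hm', B', hB'⟩ := hg
  exact ⟨hm.add hm', B + B', fun ω => (abs_add_le _ _).trans (add_le_add (hB ω) (hB' ω))⟩

lemma mul (hf : BddMeasurable f) (hg : BddMeasurable g) :
    BddMeasurable (fun ω => f ω * g ω) := by
  obtain ⟨hm, B, hB⟩ := hf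
  obtain ⟨hm', B', hB'⟩ := hg
  refine ⟨hm.mul hm', B * B', fun ω => ?_⟩
  rw [abs_mul]
  exact mul_le_mul (hB ω) (hB' ω) (abs_nonneg _) ((abs_nonneg _).trans (hB ω))

lemma neg (hf : BddMeasurable f) : BddMeasurable (fun ω => -f ω) := by
  simpa using (const (Ω := Ω) (-1)).mul hf

lemma sub (hf : BddMeasurable f) (hg : BddMeasurable g) :
    BddMeasurable (fun ω => f ω - g ω) := by
  simpa [sub_eq_add_neg] using hf.add hg.neg

lemma abs (hf : BddMeasurable f) : BddMeasurable (fun ω => |f ω|) := by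
  obtain ⟨hm, B, hB⟩ := hf
  exact ⟨hm.abs, B, fun ω => by rw [abs_abs]; exact hB ω⟩

lemma sum {ι : Type*} (s : Finset ι) {F : ι → Ω → ℝ} (hF : ∀ i ∈ s, BddMeasurable (F i)) :
    BddMeasurable (fun ω => ∑ i ∈ s, F i ω) := by
  classical
  induction s using Finset.induction_on with
  | empty => simpa using const (Ω := Ω) 0
  | insert a s ha ih =>
    simp only [Finset.sum_insert ha]
    exact (hF a (by simp)).add (ih fun i hi => hF i (by simp [hi]))

lemma comp_continuous (hf : BddMeasurable f) {φ : ℝ → ℝ} (hφ : Continuous φ) :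
    BddMeasurable (fun ω => φ (f ω)) := by
  obtain ⟨hm, B, hB⟩ := hf
  obtain ⟨C, hC⟩ := (isCompact_Icc (a := -B) (b := B)).exists_bound_of_continuousOn hφ.continuousOn
  exact ⟨hφ.measurable.comp hm, C, fun ω => hC _ (abs_le.1 (hB ω))⟩

lemma comp_measurable {Ω' : Type*} [MeasurableSpace Ω'] (hf : BddMeasurable f) {T : Ω' → Ω}
    (hT : Measurable T) : BddMeasurable (fun ω => f (T ω)) := by
  obtain ⟨hm, B, hB⟩ := hf
  exact ⟨hm.comp hT, B, fun ω => hB _⟩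

end BddMeasurable

lemma abs_taylor_le (g g' : ℝ → ℝ) (M : ℝ) (hg : ∀ x, HasDerivAt g (g' x) x) (hM : 0 ≤ M)
    (hlip : ∀ x y, |g' x - g' y| ≤ M * |x - y|) (w z : ℝ) :
    |g w - g (w - z) - z * g' w| ≤ M * z ^ 2 := by
  have := Convex.norm_image_sub_le_of_norm_hasDerivWithin_le (s := Set.uIcc w (w - z))
    (f := fun t => g t - t * g' w) (f' := fun t => g' t - g' w) (x := w - z) (y := w)
    (C := M * |z|)
    (fun t _ => (((hg t).sub ((hasDerivAt_id t).mul_const (g' w))).congr_deriv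
      (by simp)).hasDerivWithinAt)
    (fun t ht => (hlip t w).trans (mul_le_mul_of_nonneg_left (by
      have := Set.abs_sub_left_of_mem_uIcc ht
      simpa using this) hM)) (convex_uIcc _ _) Set.right_mem_uIcc Set.left_mem_uIcc
  rw [Real.norm_eq_abs, Real.norm_eq_abs] at this
  calc _ = |g w - w * g' w - (g (w - z) - (w - z) * g' w)| := by ring_nf
    _ ≤ M * |z| * |w - (w - z)| := this
    _ = M * (|z| * |z|) := by rw [sub_sub_cancel]; ring
    _ = M * z ^ 2 := by rw [abs_mul_abs_self, sq]

/-- Stein's method for sums of locally dependent random variables. -/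
lemma stein_local_dependence {Ω ι : Type*} [MeasurableSpace Ω] [Fintype ι] (P : Measure Ω)
    [IsProbabilityMeasure P] (ξ : ι → Ω → ℝ) (hξ : ∀ α, BddMeasurable (ξ α))
    (R : ι → ι → Prop) [DecidableRel R]
    (hind : ∀ α (φ : ℝ → ℝ), Continuous φ →
      ∫ ω, ξ α ω * φ (∑ β ∈ univ.filter (fun β => ¬ R α β), ξ β ω) ∂P = 0)
    (hind2 : ∀ α β (φ : ℝ → ℝ), Continuous φ →
      ∫ ω, ξ α ω * ξ β ω * φ (∑ γ ∈ univ.filter (fun γ => ¬ (R α γ ∨ R β γ)), ξ γ ω) ∂P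
        = (∫ ω, ξ α ω * ξ β ω ∂P) *
          ∫ ω, φ (∑ γ ∈ univ.filter (fun γ => ¬ (R α γ ∨ R β γ)), ξ γ ω) ∂P)
    (hvar : ∑ α, ∑ β ∈ univ.filter (fun β => R α β), ∫ ω, ξ α ω * ξ β ω ∂P = 1)
    (m : ι → ι → ι → ℝ) (hm1 : ∀ α β γ, ∫ ω, |ξ α ω * ξ β ω * ξ γ ω| ∂P ≤ m α β γ)
    (hm2 : ∀ α β γ, (∫ ω, |ξ α ω * ξ β ω| ∂P) * ∫ ω, |ξ γ ω| ∂P ≤ m α β γ)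
    (g g' : ℝ → ℝ) (M : ℝ) (hg : ∀ x, HasDerivAt g (g' x) x)
    (hlip : ∀ x y, |g' x - g' y| ≤ M * |x - y|) :
    |∫ ω, (∑ α, ξ α ω) * g (∑ α, ξ α ω) ∂P - ∫ ω, g' (∑ α, ξ α ω) ∂P|
      ≤ M * (3 * ∑ α, ∑ β ∈ univ.filter (fun β => R α β),
          ∑ γ ∈ univ.filter (fun γ => R α γ ∨ R β γ), m α β γ) := by
  have hM : 0 ≤ M := by
    have := (abs_nonneg _).trans (hlip 0 1)
    simpa using this
  have hgc : Continuous g := continuous_iff_continuousAt.2 fun x => (hg x).continuousAt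
  have hgc' : Continuous g' := by
    have : LipschitzWith (Real.toNNReal M) g' := LipschitzWith.of_dist_le_mul fun x y => by
      rw [Real.dist_eq, Real.dist_eq, Real.coe_toNNReal _ hM]; exact hlip x y
    exact this.continuous
  have hm0 : ∀ α β γ, 0 ≤ m α β γ := fun α β γ =>
    (integral_nonneg fun ω => abs_nonneg _).trans (hm1 α β γ)
  set W : Ω → ℝ := fun ω => ∑ α, ξ α ω with hW
  have bW : BddMeasurable W := BddMeasurable.sum _ fun α _ => hξ α
  have bg : BddMeasurable (fun ω => g (W ω)) := bW.comp_continuous hgc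
  have bg' : BddMeasurable (fun ω => g' (W ω)) := bW.comp_continuous hgc'
  set E' := ∫ ω, g' (W ω) ∂P with hE'
  let N : ι → Finset ι := fun α => univ.filter (fun β => R α β)
  let N2 : ι → ι → Finset ι := fun α β => univ.filter (fun γ => R α γ ∨ R β γ)
  let Z : ι → Ω → ℝ := fun α ω => ∑ β ∈ N α, ξ β ω
  let V : ι → ι → Ω → ℝ := fun α β ω => ∑ γ ∈ N2 α β, ξ γ ω
  have bZ : ∀ α, BddMeasurable (Z α) := fun α => BddMeasurable.sum _ fun β _ => hξ β
  have bV : ∀ α β, BddMeasurable (V α β) := fun α β => BddMeasurable.sum _ fun β _ => hξ β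
  have hWZ : ∀ α ω, ∑ β ∈ univ.filter (fun β => ¬ R α β), ξ β ω = W ω - Z α ω := by
    intro α ω
    simp only [W, Z, N]
    rw [← Finset.sum_filter_add_sum_filter_not univ (fun β => R α β) (fun β => ξ β ω)]
    ring
  have hWV : ∀ α β ω, ∑ γ ∈ univ.filter (fun γ => ¬ (R α γ ∨ R β γ)), ξ γ ω
      = W ω - V α β ω := by
    intro α β ω
    simp only [W, V, N2]
    rw [← Finset.sum_filter_add_sum_filter_not univ (fun γ => R α γ ∨ R β γ) (fun β => ξ β ω)]
    ring
  have step1 : ∀ α, |∫ ω, ξ α ω * g (W ω) ∂P - ∑ β ∈ N α, ∫ ω, ξ α ω * ξ β ω * g' (W ω) ∂P|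
      ≤ M * ∑ β ∈ N α, ∑ γ ∈ N2 α β, m α β γ := by
    intro α
    have h0 : ∫ ω, ξ α ω * g (W ω - Z α ω) ∂P = 0 := by
      rw [← hind α g hgc]
      simp only [hWZ]
    have b1 : BddMeasurable (fun ω => ξ α ω * g (W ω)) := (hξ α).mul bg
    have b2 : BddMeasurable (fun ω => ξ α ω * g (W ω - Z α ω)) :=
      (hξ α).mul ((bW.sub (bZ α)).comp_continuous hgc)
    have b3 : ∀ β, BddMeasurable (fun ω => ξ α ω * ξ β ω * g' (W ω)) := fun β =>
      ((hξ α).mul (hξ β)).mul bg'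
    have e : ∫ ω, ξ α ω * g (W ω) ∂P - ∑ β ∈ N α, ∫ ω, ξ α ω * ξ β ω * g' (W ω) ∂P
        = ∫ ω, ξ α ω * (g (W ω) - g (W ω - Z α ω) - Z α ω * g' (W ω)) ∂P := by
      rw [← integral_finsetSum _ fun β _ => (b3 β).integrable P,
        ← sub_zero (∫ ω, ξ α ω * g (W ω) ∂P), ← h0, ← integral_sub (b1.integrable P)
        (b2.integrable P), ← integral_sub ((b1.sub b2).integrable P)
        ((BddMeasurable.sum _ fun β _ => b3 β).integrable P)]
      congr 1
      ext ω
      rw [mul_sub, mul_sub]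
      congr 1
      simp only [Z]
      rw [Finset.sum_mul, Finset.mul_sum]
      exact Finset.sum_congr rfl fun β _ => by ring
    rw [e]
    have b4 : ∀ β γ, BddMeasurable (fun ω => |ξ α ω * ξ β ω * ξ γ ω|) := fun β γ =>
      (((hξ α).mul (hξ β)).mul (hξ γ)).abs
    calc |∫ ω, ξ α ω * (g (W ω) - g (W ω - Z α ω) - Z α ω * g' (W ω)) ∂P|
        ≤ ∫ ω, |ξ α ω * (g (W ω) - g (W ω - Z α ω) - Z α ω * g' (W ω))| ∂P :=
          abs_integral_le_integral_abs
      _ ≤ ∫ ω, M * ∑ β ∈ N α, ∑ γ ∈ N α, |ξ α ω * ξ β ω * ξ γ ω| ∂P := by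
          refine integral_mono ?_ ?_ fun ω => ?_
          · exact (((hξ α).mul ((bg.sub ((bW.sub (bZ α)).comp_continuous hgc)).sub
              ((bZ α).mul bg'))).abs).integrable P
          · exact ((BddMeasurable.const M).mul (BddMeasurable.sum _ fun β _ =>
              BddMeasurable.sum _ fun γ _ => b4 β γ)).integrable P
          · simp only
            rw [abs_mul]
            calc _ ≤ |ξ α ω| * (M * Z α ω ^ 2) := by
                  gcongr
                  exact abs_taylor_le g g' M hg hM hlip _ _
              _ = M * (|ξ α ω| * (|Z α ω| * |Z α ω|)) := by rw [abs_mul_abs_self]; ring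
              _ ≤ M * (|ξ α ω| * ((∑ β ∈ N α, |ξ β ω|) * (∑ γ ∈ N α, |ξ γ ω|))) := by
                  gcongr <;> exact abs_sum_le_sum_abs _ _
              _ = _ := by
                  rw [Finset.sum_mul_sum, Finset.mul_sum]
                  congr 1
                  refine Finset.sum_congr rfl fun β _ => ?_
                  rw [Finset.mul_sum]
                  refine Finset.sum_congr rfl fun γ _ => ?_
                  rw [abs_mul, abs_mul]
                  ring
      _ = M * ∑ β ∈ N α, ∑ γ ∈ N α, ∫ ω, |ξ α ω * ξ β ω * ξ γ ω| ∂P := by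
          rw [integral_const_mul, integral_finsetSum _ fun β _ =>
            (BddMeasurable.sum _ fun γ _ => b4 β γ).integrable P]
          congr 1
          exact Finset.sum_congr rfl fun β _ =>
            integral_finsetSum _ fun γ _ => (b4 β γ).integrable P
      _ ≤ M * ∑ β ∈ N α, ∑ γ ∈ N2 α β, m α β γ := by
          gcongr with β hβ
          calc ∑ γ ∈ N α, ∫ ω, |ξ α ω * ξ β ω * ξ γ ω| ∂P ≤ ∑ γ ∈ N α, m α β γ :=
                Finset.sum_le_sum fun γ _ => hm1 α β γ
            _ ≤ _ := by
                refine Finset.sum_le_sum_of_subset_of_nonneg ?_ fun γ _ _ => hm0 α β γ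
                intro γ hγ
                simp only [N, N2, Finset.mem_filter, Finset.mem_univ, true_and] at hγ ⊢
                exact Or.inl hγ
  have step2 : ∀ α β, |∫ ω, ξ α ω * ξ β ω * g' (W ω) ∂P - (∫ ω, ξ α ω * ξ β ω ∂P) * E'|
      ≤ M * (2 * ∑ γ ∈ N2 α β, m α β γ) := by
    intro α β
    have h0 : ∫ ω, ξ α ω * ξ β ω * g' (W ω - V α β ω) ∂P
        = (∫ ω, ξ α ω * ξ β ω ∂P) * ∫ ω, g' (W ω - V α β ω) ∂P := by
      have := hind2 α β g' hgc'
      simpa only [hWV] using this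
    have b1 : BddMeasurable (fun ω => ξ α ω * ξ β ω) := (hξ α).mul (hξ β)
    have b2 : BddMeasurable (fun ω => g' (W ω - V α β ω)) :=
      (bW.sub (bV α β)).comp_continuous hgc'
    have hdiff : ∀ ω, |g' (W ω) - g' (W ω - V α β ω)| ≤ M * ∑ γ ∈ N2 α β, |ξ γ ω| := by
      intro ω
      refine (hlip _ _).trans ?_
      rw [sub_sub_cancel]
      gcongr
      exact abs_sum_le_sum_abs _ _
    have i1 : |∫ ω, ξ α ω * ξ β ω * (g' (W ω) - g' (W ω - V α β ω)) ∂P|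
        ≤ M * ∑ γ ∈ N2 α β, m α β γ := by
      have b4 : ∀ γ, BddMeasurable (fun ω => |ξ α ω * ξ β ω * ξ γ ω|) := fun γ =>
        (b1.mul (hξ γ)).abs
      calc _ ≤ ∫ ω, |ξ α ω * ξ β ω * (g' (W ω) - g' (W ω - V α β ω))| ∂P :=
            abs_integral_le_integral_abs
        _ ≤ ∫ ω, M * ∑ γ ∈ N2 α β, |ξ α ω * ξ β ω * ξ γ ω| ∂P := by
            refine integral_mono ((b1.mul (bg'.sub b2)).abs.integrable P)
              (((BddMeasurable.const M).mul (BddMeasurable.sum _ fun γ _ => b4 γ)).integrable P)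
              fun ω => ?_
            simp only
            rw [abs_mul]
            calc _ ≤ |ξ α ω * ξ β ω| * (M * ∑ γ ∈ N2 α β, |ξ γ ω|) := by
                  gcongr
                  exact hdiff ω
              _ = _ := by
                  simp only [abs_mul, Finset.mul_sum]
                  exact Finset.sum_congr rfl fun γ _ => by ring
        _ = M * ∑ γ ∈ N2 α β, ∫ ω, |ξ α ω * ξ β ω * ξ γ ω| ∂P := by
            rw [integral_const_mul, integral_finsetSum _ fun γ _ => (b4 γ).integrable P]
        _ ≤ _ := by
            gcongr with γ _
            exact hm1 α β γ
    have i2 : |(∫ ω, ξ α ω * ξ β ω ∂P) * ∫ ω, (g' (W ω) - g' (W ω - V α β ω)) ∂P|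
        ≤ M * ∑ γ ∈ N2 α β, m α β γ := by
      rw [abs_mul]
      have j : |∫ ω, (g' (W ω) - g' (W ω - V α β ω)) ∂P|
          ≤ M * ∑ γ ∈ N2 α β, ∫ ω, |ξ γ ω| ∂P := by
        calc _ ≤ ∫ ω, |g' (W ω) - g' (W ω - V α β ω)| ∂P := abs_integral_le_integral_abs
          _ ≤ ∫ ω, M * ∑ γ ∈ N2 α β, |ξ γ ω| ∂P :=
            integral_mono ((bg'.sub b2).abs.integrable P)
              (((BddMeasurable.const M).mul
                (BddMeasurable.sum _ fun γ _ => (hξ γ).abs)).integrable P) hdiff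
          _ = _ := by
            rw [integral_const_mul, integral_finsetSum _ fun γ _ => (hξ γ).abs.integrable P]
      calc _ ≤ (∫ ω, |ξ α ω * ξ β ω| ∂P) * (M * ∑ γ ∈ N2 α β, ∫ ω, |ξ γ ω| ∂P) :=
            mul_le_mul abs_integral_le_integral_abs j (abs_nonneg _)
              (integral_nonneg fun ω => abs_nonneg _)
        _ = M * ∑ γ ∈ N2 α β, (∫ ω, |ξ α ω * ξ β ω| ∂P) * ∫ ω, |ξ γ ω| ∂P := by
            rw [← Finset.mul_sum]
            ring
        _ ≤ _ := by
            gcongr with γ _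
            exact hm2 α β γ
    have e : ∫ ω, ξ α ω * ξ β ω * g' (W ω) ∂P - (∫ ω, ξ α ω * ξ β ω ∂P) * E'
        = ∫ ω, ξ α ω * ξ β ω * (g' (W ω) - g' (W ω - V α β ω)) ∂P
          - (∫ ω, ξ α ω * ξ β ω ∂P) * ∫ ω, (g' (W ω) - g' (W ω - V α β ω)) ∂P := by
      have e1 : ∫ ω, ξ α ω * ξ β ω * (g' (W ω) - g' (W ω - V α β ω)) ∂P
          = ∫ ω, ξ α ω * ξ β ω * g' (W ω) ∂P
            - ∫ ω, ξ α ω * ξ β ω * g' (W ω - V α β ω) ∂P := by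
        rw [← integral_sub ((b1.mul bg').integrable P) ((b1.mul b2).integrable P)]
        simp only [mul_sub]
      rw [e1, h0, integral_sub (bg'.integrable P) (b2.integrable P)]
      ring
    rw [e]
    calc _ ≤ _ := abs_sub _ _
      _ ≤ _ := add_le_add i1 i2
      _ = _ := by ring
  have e1 : ∫ ω, W ω * g (W ω) ∂P = ∑ α, ∫ ω, ξ α ω * g (W ω) ∂P := by
    rw [← integral_finsetSum _ fun α _ => ((hξ α).mul bg).integrable P]
    simp only [W, Finset.sum_mul]
  have e2 : E' = ∑ α, ∑ β ∈ N α, (∫ ω, ξ α ω * ξ β ω ∂P) * E' := by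
    simp only [← Finset.sum_mul]
    rw [hvar, one_mul]
  have e3 : ∫ ω, W ω * g (W ω) ∂P - E' = ∑ α, ((∫ ω, ξ α ω * g (W ω) ∂P
        - ∑ β ∈ N α, ∫ ω, ξ α ω * ξ β ω * g' (W ω) ∂P)
        + ∑ β ∈ N α, (∫ ω, ξ α ω * ξ β ω * g' (W ω) ∂P - (∫ ω, ξ α ω * ξ β ω ∂P) * E')) := by
    rw [e1]
    conv_lhs => rw [e2]
    rw [← Finset.sum_sub_distrib]
    refine Finset.sum_congr rfl fun α _ => ?_
    rw [Finset.sum_sub_distrib]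
    ring
  rw [e3]
  calc _ ≤ ∑ α, |_| := abs_sum_le_sum_abs _ _
    _ ≤ ∑ α, (M * ∑ β ∈ N α, ∑ γ ∈ N2 α β, m α β γ
        + ∑ β ∈ N α, M * (2 * ∑ γ ∈ N2 α β, m α β γ)) := by
        refine Finset.sum_le_sum fun α _ => (abs_add_le _ _).trans (add_le_add (step1 α) ?_)
        exact (abs_sum_le_sum_abs _ _).trans (Finset.sum_le_sum fun β _ => step2 α β)
    _ = _ := by
        simp only [Finset.mul_sum]
        refine Finset.sum_congr rfl fun α _ => ?_
        rw [← Finset.sum_add_distrib]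
        refine Finset.sum_congr rfl fun β _ => ?_
        rw [← Finset.sum_add_distrib]
        exact Finset.sum_congr rfl fun γ _ => by ring

/-- Unordered pairs of distinct indices, represented by increasing ordered pairs. -/
abbrev IndexPair (n : ℕ) : Type := {q : Fin n × Fin n // q.1 < q.2}

/-- Independence of functions of disjoint sets of coordinates under a product measure. -/
lemma integral_mul_of_dependsOn {J E : Type*} [Fintype J] [MeasurableSpace E]
    (ν : Measure E) [IsProbabilityMeasure ν] (S T : Finset J) (hST : Disjoint S T)
    (f g : (J → E) → ℝ) (hf : Measurable f) (hg : Measurable g)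
    (hfS : ∀ x y, (∀ i ∈ S, x i = y i) → f x = f y)
    (hgT : ∀ x y, (∀ i ∈ T, x i = y i) → g x = g y) :
    ∫ x, f x * g x ∂(Measure.pi fun _ => ν)
      = (∫ x, f x ∂(Measure.pi fun _ => ν)) * ∫ x, g x ∂(Measure.pi fun _ => ν) := by
  classical
  obtain ⟨e0⟩ : Nonempty E := ν.nonempty_of_neZero
  let ext : (S : Finset J) → ((i : S) → E) → J → E := fun S u i =>
    if h : i ∈ S then u ⟨i, h⟩ else e0
  have hext : ∀ S, Measurable (ext S) := by
    intro S
    refine measurable_pi_iff.2 fun i => ?_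
    by_cases h : i ∈ S
    · simp only [ext, h, dite_true]
      exact measurable_pi_apply _
    · simp only [ext, h, dite_false]
      exact measurable_const
  have hI : iIndepFun (fun (i : J) (x : J → E) => x i) (Measure.pi fun _ => ν) :=
    iIndepFun_pi (X := fun _ x => x) (μ := fun _ => ν) fun _ => aemeasurable_id
  have h2 := (hI.indepFun_finset S T hST fun i => measurable_pi_apply i).comp
    (hf.comp (hext S)) (hg.comp (hext T))
  have ef : (f ∘ ext S) ∘ (fun (x : J → E) (i : S) => x i) = f := by
    ext x
    exact hfS _ _ fun i hi => by simp [ext, hi]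
  have eg : (g ∘ ext T) ∘ (fun (x : J → E) (i : T) => x i) = g := by
    ext x
    exact hgT _ _ fun i hi => by simp [ext, hi]
  rw [ef, eg] at h2
  exact h2.integral_fun_mul_eq_mul_integral hf.aestronglyMeasurable hg.aestronglyMeasurable

/-- The law of the vertex positions and of the edge variables. -/
noncomputable def modelMeasure {E : Type*} [MeasurableSpace E] (μ : Measure E) (n : ℕ) :
    Measure ((Fin n → E) × (IndexPair n → ℝ)) :=
  (Measure.pi fun _ => μ).prod (Measure.pi fun _ => volume.restrict (Set.Icc (0 : ℝ) 1))

instance : IsProbabilityMeasure (volume.restrict (Set.Icc (0 : ℝ) 1)) :=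
  ⟨by simp⟩

instance {E : Type*} [MeasurableSpace E] (μ : Measure E) [IsProbabilityMeasure μ] (n : ℕ) :
    IsProbabilityMeasure (modelMeasure μ n) := by
  unfold modelMeasure
  infer_instance

/-- `A` depends only on the vertices in `S` and on the edge variables between them. -/
def LocallyOn {E : Type*} {n : ℕ} (S : Finset (Fin n))
    (A : (Fin n → E) × (IndexPair n → ℝ) → ℝ) : Prop :=
  ∀ x x' y y', (∀ i ∈ S, x i = x' i) → (∀ e : IndexPair n, e.1.1 ∈ S → e.1.2 ∈ S → y e = y' e) →
    A (x, y) = A (x', y')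

section LocallyOn

variable {E : Type*} {n : ℕ} {S T : Finset (Fin n)} {A B : (Fin n → E) × (IndexPair n → ℝ) → ℝ}

lemma LocallyOn.mono (hA : LocallyOn S A) (h : S ⊆ T) : LocallyOn T A :=
  fun x x' y y' hx hy => hA x x' y y' (fun i hi => hx i (h hi)) fun e h1 h2 => hy e (h h1) (h h2)

lemma LocallyOn.mul (hA : LocallyOn S A) (hB : LocallyOn S B) :
    LocallyOn S (fun ω => A ω * B ω) :=
  fun x x' y y' hx hy => by simp only [hA x x' y y' hx hy, hB x x' y y' hx hy]

lemma LocallyOn.comp (hA : LocallyOn S A) (φ : ℝ → ℝ) : LocallyOn S (fun ω => φ (A ω)) :=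
  fun x x' y y' hx hy => by simp only [hA x x' y y' hx hy]

lemma LocallyOn.sum {ι : Type*} (s : Finset ι) {F : ι → (Fin n → E) × (IndexPair n → ℝ) → ℝ}
    (hF : ∀ i ∈ s, LocallyOn S (F i)) : LocallyOn S (fun ω => ∑ i ∈ s, F i ω) :=
  fun x x' y y' hx hy => Finset.sum_congr rfl fun i hi => hF i hi x x' y y' hx hy

lemma LocallyOn.integral_mul [MeasurableSpace E] (μ : Measure E) [IsProbabilityMeasure μ]
    (hST : Disjoint S T) (hA : LocallyOn S A) (hB : LocallyOn T B)
    (bA : BddMeasurable A) (bB : BddMeasurable B) :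
    ∫ ω, A ω * B ω ∂(modelMeasure μ n)
      = (∫ ω, A ω ∂(modelMeasure μ n)) * ∫ ω, B ω ∂(modelMeasure μ n) := by
  classical
  unfold modelMeasure
  have iA := bA.integrable (modelMeasure μ n)
  have iB := bB.integrable (modelMeasure μ n)
  have iAB := (bA.mul bB).integrable (modelMeasure μ n)
  unfold modelMeasure at iA iB iAB
  rw [integral_prod _ iAB, integral_prod _ iA, integral_prod _ iB]
  have inner : ∀ x : Fin n → E,
      ∫ y, A (x, y) * B (x, y) ∂(Measure.pi fun _ => volume.restrict (Set.Icc (0 : ℝ) 1))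
      = (∫ y, A (x, y) ∂(Measure.pi fun _ => volume.restrict (Set.Icc (0 : ℝ) 1)))
        * ∫ y, B (x, y) ∂(Measure.pi fun _ => volume.restrict (Set.Icc (0 : ℝ) 1)) := by
    intro x
    refine integral_mul_of_dependsOn _ (univ.filter fun e : IndexPair n => e.1.1 ∈ S ∧ e.1.2 ∈ S)
      (univ.filter fun e : IndexPair n => e.1.1 ∈ T ∧ e.1.2 ∈ T) ?_ _ _
      (bA.1.comp measurable_prodMk_left) (bB.1.comp measurable_prodMk_left) ?_ ?_
    · rw [Finset.disjoint_left]
      intro e he he'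
      simp only [Finset.mem_filter, Finset.mem_univ, true_and] at he he'
      exact Finset.disjoint_left.1 hST he.1 he'.1
    · intro y y' h
      exact hA _ _ _ _ (fun _ _ => rfl) fun e h1 h2 => h e (by simp [h1, h2])
    · intro y y' h
      exact hB _ _ _ _ (fun _ _ => rfl) fun e h1 h2 => h e (by simp [h1, h2])
  simp only [inner]
  refine integral_mul_of_dependsOn μ S T hST _ _
    bA.1.stronglyMeasurable.integral_prod_right'.measurable
    bB.1.stronglyMeasurable.integral_prod_right'.measurable ?_ ?_
  · intro x x' h
    congr 1
    ext y
    exact hA _ _ _ _ h fun _ _ _ => rfl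
  · intro x x' h
    congr 1
    ext y
    exact hB _ _ _ _ h fun _ _ _ => rfl

end LocallyOn

section EdgeProduct

variable {E : Type*} {n : ℕ}

open Classical in
/-- The indicator that all the pairs in `D` are edges of the random-connection model. -/
noncomputable def edgeProd (H : E → E → ℝ) (p : ℝ) (D : Finset (IndexPair n))
    (ω : (Fin n → E) × (IndexPair n → ℝ)) : ℝ :=
  ∏ e ∈ D, if ω.2 e ≤ p * H (ω.1 e.1.1) (ω.1 e.1.2) then (1 : ℝ) else 0

variable {H : E → E → ℝ} {p : ℝ} {D D' : Finset (IndexPair n)}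

lemma edgeProd_nonneg (ω) : 0 ≤ edgeProd H p D ω :=
  Finset.prod_nonneg fun e _ => by split_ifs <;> norm_num

lemma edgeProd_le_one (ω) : edgeProd H p D ω ≤ 1 :=
  Finset.prod_le_one (fun e _ => by split_ifs <;> norm_num) fun e _ => by split_ifs <;> norm_num

lemma edgeProd_mul (ω) : edgeProd H p D ω * edgeProd H p D' ω = edgeProd H p (D ∪ D') ω := by
  unfold edgeProd
  rw [← Finset.prod_union_inter, ← Finset.prod_sdiff (Finset.inter_subset_union (s := D) (t := D')),
    mul_assoc, ← Finset.prod_mul_distrib]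
  congr 1
  exact Finset.prod_congr rfl fun e _ => by split_ifs <;> norm_num

lemma edgeProd_bddMeasurable [MeasurableSpace E] (hH : Measurable fun z : E × E => H z.1 z.2) :
    BddMeasurable (edgeProd H p D) := by
  refine ⟨?_, 1, fun ω => by rw [abs_of_nonneg (edgeProd_nonneg ω)]; exact edgeProd_le_one ω⟩
  refine Finset.measurable_prod _ fun e _ => Measurable.ite ?_ measurable_const measurable_const
  refine measurableSet_le (by fun_prop) (measurable_const.mul ?_)
  exact hH.comp (f := fun ω : (Fin n → E) × (IndexPair n → ℝ) => (ω.1 e.1.1, ω.1 e.1.2))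
    (by fun_prop)

lemma edgeProd_locallyOn {S : Finset (Fin n)} (hD : ∀ e ∈ D, e.1.1 ∈ S ∧ e.1.2 ∈ S) :
    LocallyOn S (edgeProd H p D) := by
  intro x x' y y' hx hy
  refine Finset.prod_congr rfl fun e he => ?_
  obtain ⟨h1, h2⟩ := hD e he
  simp only [hx _ h1, hx _ h2, hy e h1 h2]

lemma integral_uniform_indicator (t : ℝ) (ht0 : 0 ≤ t) (ht1 : t ≤ 1) :
    ∫ y in Set.Icc (0 : ℝ) 1, (if y ≤ t then (1 : ℝ) else 0) = t := by
  have : (fun y : ℝ => if y ≤ t then (1 : ℝ) else 0) = (Set.Iic t).indicator 1 := by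
    ext y
    simp [Set.indicator_apply]
  rw [this, integral_indicator_one measurableSet_Iic, measureReal_restrict_apply measurableSet_Iic]
  have : Set.Iic t ∩ Set.Icc 0 1 = Set.Icc 0 t := by
    ext y
    simp only [Set.mem_inter_iff, Set.mem_Iic, Set.mem_Icc]
    constructor
    · rintro ⟨h1, h2, h3⟩; exact ⟨h2, h1⟩
    · rintro ⟨h1, h2⟩; exact ⟨h2, h1, h2.trans ht1⟩
  rw [this]
  simp [ht0]

lemma integral_edgeProd_mul [MeasurableSpace E] (μ : Measure E) [IsProbabilityMeasure μ]
    (hH : Measurable fun z : E × E => H z.1 z.2) (hH01 : ∀ x y, H x y ∈ Set.Icc (0 : ℝ) 1)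
    (hp0 : 0 ≤ p) (hp1 : p ≤ 1) (φ : (Fin n → E) → ℝ) (hφ : BddMeasurable φ) :
    ∫ ω, edgeProd H p D ω * φ ω.1 ∂(modelMeasure μ n)
      = p ^ D.card * ∫ x, (∏ e ∈ D, H (x e.1.1) (x e.1.2)) * φ x ∂(Measure.pi fun _ => μ) := by
  classical
  have hb := ((edgeProd_bddMeasurable (p := p) (D := D) hH).mul
    (hφ.comp_measurable measurable_fst)).integrable (modelMeasure μ n)
  unfold modelMeasure at hb ⊢
  rw [integral_prod _ hb, ← integral_const_mul]
  congr 1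
  ext x
  simp only
  rw [integral_mul_const, ← mul_assoc]
  congr 1
  let F : IndexPair n → ℝ → ℝ := fun e t =>
    if e ∈ D then (if t ≤ p * H (x e.1.1) (x e.1.2) then (1 : ℝ) else 0) else 1
  have h1 : ∀ y : IndexPair n → ℝ, edgeProd H p D (x, y) = ∏ e, F e (y e) := by
    intro y
    simp only [edgeProd, F]
    rw [Finset.prod_ite_mem, Finset.univ_inter]
  simp_rw [h1]
  rw [integral_fintype_prod_eq_prod (E := fun _ : IndexPair n => ℝ) F
    (μ := fun _ => volume.restrict (Set.Icc (0 : ℝ) 1)), ← Finset.prod_const, ← Finset.prod_mul_distrib,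
    ← Finset.univ_inter D, ← Finset.prod_ite_mem]
  refine Finset.prod_congr rfl fun e _ => ?_
  by_cases he : e ∈ D
  · simp only [F, he, if_true]
    have h01 := hH01 (x e.1.1) (x e.1.2)
    exact integral_uniform_indicator _ (mul_nonneg hp0 h01.1) (mul_le_one₀ hp1 h01.1 h01.2)
  · simp [F, he]

lemma integral_edgeProd_le [MeasurableSpace E] (μ : Measure E) [IsProbabilityMeasure μ]
    (hH : Measurable fun z : E × E => H z.1 z.2) (hH01 : ∀ x y, H x y ∈ Set.Icc (0 : ℝ) 1)
    (hp0 : 0 ≤ p) (hp1 : p ≤ 1) :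
    ∫ ω, edgeProd H p D ω ∂(modelMeasure μ n) ≤ p ^ D.card := by
  have h := integral_edgeProd_mul (D := D) μ hH hH01 hp0 hp1 (fun _ => 1) (BddMeasurable.const 1)
  simp only [mul_one] at h
  rw [h]
  refine mul_le_of_le_one_right (pow_nonneg hp0 _) ?_
  have hprod0 : ∀ x : Fin n → E, 0 ≤ ∏ e ∈ D, H (x e.1.1) (x e.1.2) := fun x =>
    Finset.prod_nonneg fun e _ => (hH01 _ _).1
  have hle : ∀ x : Fin n → E, ‖∏ e ∈ D, H (x e.1.1) (x e.1.2)‖ ≤ 1 := fun x => by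
    rw [Real.norm_eq_abs, abs_of_nonneg (hprod0 x)]
    exact Finset.prod_le_one (fun e _ => (hH01 _ _).1) fun e _ => (hH01 _ _).2
  have := norm_integral_le_of_norm_le_const (μ := Measure.pi fun _ : Fin n => μ)
    (Filter.Eventually.of_forall hle)
  exact (Real.le_norm_self _).trans (by simpa using this)

end EdgeProduct

/-- Reindexing a product measure along an injection of the coordinates. -/
lemma map_comp_injective_pi {E : Type*} [MeasurableSpace E] (μ : Measure E)
    [IsProbabilityMeasure μ] {J K : Type*} [Fintype J] [Fintype K] (α : K → J)
    (hα : Function.Injective α) :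
    Measure.map (fun (x : J → E) (i : K) => x (α i)) (Measure.pi fun _ => μ)
      = Measure.pi fun _ => μ := by
  have hI : iIndepFun (fun (i : J) (x : J → E) => x i) (Measure.pi fun _ => μ) :=
    iIndepFun_pi (X := fun _ x => x) (μ := fun _ => μ) fun _ => aemeasurable_id
  have h1 := hI.precomp hα
  rw [iIndepFun_iff_map_fun_eq_pi_map (fun i => (measurable_pi_apply _).aemeasurable)] at h1
  rw [h1]
  congr 1
  ext1 i
  exact (measurePreserving_eval (fun _ : J => μ) (α i)).map_eq

/-- Resampling one coordinate preserves a product measure. -/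
lemma map_update_pi {E : Type*} [MeasurableSpace E] (μ : Measure E) [IsProbabilityMeasure μ]
    {K : Type*} [Fintype K] [DecidableEq K] (ℓ : K) :
    Measure.map (fun q : (K → E) × E => Function.update q.1 ℓ q.2)
      ((Measure.pi fun _ => μ).prod μ) = Measure.pi fun _ => μ := by
  symm
  refine Measure.pi_eq fun s hs => ?_
  have hm : Measurable (fun q : (K → E) × E => Function.update q.1 ℓ q.2) := by
    refine measurable_pi_iff.2 fun i => ?_
    by_cases h : i = ℓ
    · subst h
      simpa using measurable_snd
    · simp only [Function.update_of_ne h]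
      fun_prop
  rw [Measure.map_apply hm (MeasurableSet.univ_pi hs)]
  have : (fun q : (K → E) × E => Function.update q.1 ℓ q.2) ⁻¹' (Set.univ.pi s)
      = (Set.univ.pi fun i => if i = ℓ then Set.univ else s i) ×ˢ s ℓ := by
    ext q
    simp only [Set.mem_preimage, Set.mem_pi, Set.mem_univ, true_implies, Set.mem_prod]
    constructor
    · intro h
      refine ⟨fun i => ?_, by simpa using h ℓ⟩
      by_cases hi : i = ℓ
      · simp [hi]
      · simpa [hi] using h i
    · rintro ⟨h1, h2⟩ i
      by_cases hi : i = ℓ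
      · subst hi; simpa using h2
      · simpa [hi] using h1 i
  rw [this, Measure.prod_prod, Measure.pi_pi, ← Finset.mul_prod_erase univ _ (Finset.mem_univ ℓ),
    ← Finset.mul_prod_erase univ (fun i => μ (s i)) (Finset.mem_univ ℓ)]
  simp only [if_true, measure_univ, one_mul]
  rw [mul_comm]
  congr 1
  exact Finset.prod_congr rfl fun i hi => by rw [if_neg (Finset.ne_of_mem_erase hi)]

section Copies

variable {k n : ℕ}

/-- The edges of `G` as increasing ordered pairs. -/
def orderedEdges (G : SimpleGraph (Fin k)) [DecidableRel G.Adj] : Finset (Fin k × Fin k) :=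
  univ.filter fun q => q.1 < q.2 ∧ G.Adj q.1 q.2

/-- The increasing ordered pair with given distinct entries. -/
def sortPair (a b : Fin n) (h : a ≠ b) : IndexPair n :=
  if hab : a < b then ⟨(a, b), hab⟩ else ⟨(b, a), lt_of_le_of_ne (not_lt.1 hab) h.symm⟩

lemma sortPair_cases (a b : Fin n) (h : a ≠ b) :
    ((sortPair a b h).1.1 = a ∧ (sortPair a b h).1.2 = b) ∨
      ((sortPair a b h).1.1 = b ∧ (sortPair a b h).1.2 = a) := by
  unfold sortPair
  split_ifs <;> simp

variable (G : SimpleGraph (Fin k)) [DecidableRel G.Adj]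

lemma apply_ne_of_mem_orderedEdges {G : SimpleGraph (Fin k)} [DecidableRel G.Adj]
    (α : Fin k ↪ Fin n) {q : Fin k × Fin k} (hq : q ∈ orderedEdges G) : α q.1 ≠ α q.2 :=
  fun h => (Finset.mem_filter.1 hq).2.1.ne (α.injective h)

/-- The edges of the copy of `G` placed along `α`. -/
def copyEdges (α : Fin k ↪ Fin n) : Finset (IndexPair n) :=
  (orderedEdges G).attach.image fun q =>
    sortPair (α q.1.1) (α q.1.2) (apply_ne_of_mem_orderedEdges α q.2)

variable {G}

lemma sortPair_apply_injective (α : Fin k ↪ Fin n) {q q' : Fin k × Fin k}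
    (hq : q ∈ orderedEdges G) (hq' : q' ∈ orderedEdges G)
    (h : sortPair (α q.1) (α q.2) (apply_ne_of_mem_orderedEdges α hq)
      = sortPair (α q'.1) (α q'.2) (apply_ne_of_mem_orderedEdges α hq')) : q = q' := by
  have h1 := (Finset.mem_filter.1 hq).2.1
  have h2 := (Finset.mem_filter.1 hq').2.1
  have c1 := sortPair_cases (α q.1) (α q.2) (apply_ne_of_mem_orderedEdges α hq)
  have c2 := sortPair_cases (α q'.1) (α q'.2) (apply_ne_of_mem_orderedEdges α hq')
  rw [h] at c1
  obtain ⟨a, b⟩ := q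
  obtain ⟨a', b'⟩ := q'
  simp only at h1 h2 c1 c2
  rcases c1 with ⟨u, v⟩ | ⟨u, v⟩ <;> rcases c2 with ⟨u', v'⟩ | ⟨u', v'⟩ <;>
    rw [u] at u' <;> rw [v] at v' <;> have := α.injective u' <;> have := α.injective v' <;>
    subst_vars
  · rfl
  · exact absurd h1 h2.asymm
  · exact absurd h1 h2.asymm
  · rfl

lemma prod_orderedEdges (α : Fin k ↪ Fin n) (f : Fin n → Fin n → ℝ)
    (hf : ∀ a b, f a b = f b a) :
    ∏ q ∈ orderedEdges G, f (α q.1) (α q.2) = ∏ e ∈ copyEdges G α, f e.1.1 e.1.2 := by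
  unfold copyEdges
  rw [Finset.prod_image fun q _ q' _ h => Subtype.ext (sortPair_apply_injective α q.2 q'.2 h),
    ← Finset.prod_attach]
  refine Finset.prod_congr rfl fun q _ => ?_
  rcases sortPair_cases (α q.1.1) (α q.1.2) (apply_ne_of_mem_orderedEdges α q.2) with
    ⟨u, v⟩ | ⟨u, v⟩
  · rw [u, v]
  · rw [u, v, hf]

lemma mem_copyEdges {α : Fin k ↪ Fin n} {e : IndexPair n} (he : e ∈ copyEdges G α) :
    ∃ q, ∃ hq : q ∈ orderedEdges G,
      sortPair (α q.1) (α q.2) (apply_ne_of_mem_orderedEdges α hq) = e := by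
  unfold copyEdges at he
  obtain ⟨q, -, hq⟩ := Finset.mem_image.1 he
  exact ⟨q.1, q.2, hq⟩

lemma copyEdges_subset (α : Fin k ↪ Fin n) (e : IndexPair n) (he : e ∈ copyEdges G α) :
    e.1.1 ∈ univ.map α ∧ e.1.2 ∈ univ.map α := by
  obtain ⟨q, hq, rfl⟩ := mem_copyEdges he
  rcases sortPair_cases (α q.1) (α q.2) (apply_ne_of_mem_orderedEdges α hq) with
    ⟨u, v⟩ | ⟨u, v⟩ <;> rw [u, v] <;> simp

lemma image_orderedEdges : (orderedEdges G).image (fun q => s(q.1, q.2)) = G.edgeFinset := by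
  ext z
  induction z using Sym2.ind with
  | h a b =>
    simp only [Finset.mem_image, SimpleGraph.mem_edgeFinset, SimpleGraph.mem_edgeSet, orderedEdges,
      Finset.mem_filter, Finset.mem_univ, true_and, Prod.exists, Sym2.eq_iff]
    constructor
    · rintro ⟨u, v, ⟨-, h⟩, ⟨rfl, rfl⟩ | ⟨rfl, rfl⟩⟩
      · exact h
      · exact h.symm
    · intro h
      rcases lt_or_gt_of_ne h.ne with hab | hab
      · exact ⟨a, b, ⟨hab, h⟩, Or.inl ⟨rfl, rfl⟩⟩
      · exact ⟨b, a, ⟨hab, h.symm⟩, Or.inr ⟨rfl, rfl⟩⟩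

lemma injOn_sym2_orderedEdges :
    Set.InjOn (fun q : Fin k × Fin k => s(q.1, q.2)) (orderedEdges G) := by
  rintro ⟨a, b⟩ h ⟨a', b'⟩ h' hh
  have h1 := (Finset.mem_filter.1 h).2.1
  have h2 := (Finset.mem_filter.1 h').2.1
  simp only [Sym2.eq_iff] at h1 h2 hh
  rcases hh with ⟨rfl, rfl⟩ | ⟨rfl, rfl⟩
  · rfl
  · exact absurd h1 h2.asymm

lemma card_orderedEdges : (orderedEdges G).card = G.edgeFinset.card := by
  rw [← image_orderedEdges, Finset.card_image_of_injOn injOn_sym2_orderedEdges]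

lemma card_copyEdges (α : Fin k ↪ Fin n) : (copyEdges G α).card = G.edgeFinset.card := by
  unfold copyEdges
  rw [Finset.card_image_of_injective _ fun q q' h =>
    Subtype.ext (sortPair_apply_injective α q.2 q'.2 h), Finset.card_attach, card_orderedEdges]

lemma StronglyBalanced.card_induced_le (hbal : StronglyBalanced G) (T : Finset (Fin k))
    (hT : T.Nonempty) :
    ((orderedEdges G).filter fun q => q.1 ∈ T ∧ q.2 ∈ T).card * (k - 1)
      ≤ G.edgeFinset.card * (T.card - 1) := by
  rcases Nat.lt_or_ge T.card 2 with h | h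
  · have h1 : T.card = 1 := by have := hT.card_pos; omega
    obtain ⟨a, rfl⟩ := Finset.card_eq_one.1 h1
    have : ((orderedEdges G).filter fun q => q.1 ∈ ({a} : Finset (Fin k)) ∧ q.2 ∈
        ({a} : Finset (Fin k))) = ∅ := by
      refine Finset.filter_eq_empty_iff.2 fun q hq hqa => ?_
      have h1 := (Finset.mem_filter.1 hq).2.1
      simp only [Finset.mem_singleton] at hqa
      rw [hqa.1, hqa.2] at h1
      exact lt_irrefl _ h1
    rw [this]
    simp
  · have hv : ((⊤ : G.Subgraph).induce (T : Set (Fin k))).verts.ncard = T.card := by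
      simp
    have := hbal ((⊤ : G.Subgraph).induce (T : Set (Fin k))) (by rw [hv]; exact h)
    rw [hv] at this
    refine le_trans (Nat.mul_le_mul_right _ ?_) this
    rw [← Finset.card_image_of_injOn (injOn_sym2_orderedEdges.mono
      (Finset.coe_subset.2 (Finset.filter_subset _ _))), ← Set.ncard_coe_finset]
    refine Set.ncard_le_ncard ?_ (Set.toFinite _)
    intro z hz
    simp only [Finset.coe_image, Set.mem_image, Finset.mem_coe, Finset.mem_filter] at hz
    obtain ⟨q, ⟨hq, h1, h2⟩, rfl⟩ := hz
    have := (Finset.mem_filter.1 hq).2.2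
    simpa [h1, h2] using this

lemma card_copyEdges_inter_le (α : Fin k ↪ Fin n) (S : Finset (Fin n)) (D : Finset (IndexPair n))
    (hD : ∀ e ∈ D, e.1.1 ∈ S ∧ e.1.2 ∈ S) :
    (copyEdges G α ∩ D).card ≤ ((orderedEdges G).filter fun q =>
      q.1 ∈ univ.filter (fun i => α i ∈ S) ∧ q.2 ∈ univ.filter (fun i => α i ∈ S)).card := by
  refine Finset.card_le_card_of_forall_subsingleton
    (fun e q => ∃ hq : q ∈ orderedEdges G,
      sortPair (α q.1) (α q.2) (apply_ne_of_mem_orderedEdges α hq) = e) ?_ ?_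
  · intro e he
    obtain ⟨he1, he2⟩ := Finset.mem_inter.1 he
    obtain ⟨q, hq, h⟩ := mem_copyEdges he1
    refine ⟨q, ?_, hq, h⟩
    have hS := hD e he2
    rw [Finset.mem_filter]
    refine ⟨hq, ?_⟩
    simp only [Finset.mem_filter, Finset.mem_univ, true_and]
    rcases sortPair_cases (α q.1) (α q.2) (apply_ne_of_mem_orderedEdges α hq) with
      ⟨u, v⟩ | ⟨u, v⟩ <;> rw [h] at u v <;> rw [u, v] at hS
    · exact hS
    · exact hS.symm
  · rintro q - e ⟨-, hq, h⟩ e' ⟨-, hq', h'⟩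
    rw [← h, ← h']

/-- The cost of attaching a copy of a strongly balanced graph to a given edge set. -/
lemma pow_card_union_copyEdges_le (hk : 2 ≤ k) (hbal : StronglyBalanced G) {p T : ℝ}
    (hp0 : 0 < p) (hp1 : p ≤ 1) (hT0 : 0 ≤ T)
    (hT : ∀ j < k, 1 ≤ T * ((n : ℝ) * p ^ ((G.edgeFinset.card : ℝ) / ((k : ℝ) - 1))) ^ j)
    (α : Fin k ↪ Fin n) (S : Finset (Fin n)) (D : Finset (IndexPair n))
    (hD : ∀ e ∈ D, e.1.1 ∈ S ∧ e.1.2 ∈ S) (hS : (univ.filter fun i => α i ∈ S).Nonempty) :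
    p ^ (D ∪ copyEdges G α).card ≤ p ^ D.card * (p ^ G.edgeFinset.card * T *
      (n : ℝ) ^ ((univ.filter fun i => α i ∈ S).card - 1)) := by
  set m := (copyEdges G α ∩ D).card with hm
  set v := (univ.filter fun i => α i ∈ S).card with hv
  have hv1 : 1 ≤ v := hS.card_pos
  have hvk : v ≤ k := (Finset.card_le_univ _).trans (by simp)
  have hmv : m * (k - 1) ≤ G.edgeFinset.card * (v - 1) :=
    (Nat.mul_le_mul_right _ (card_copyEdges_inter_le α S D hD)).trans (hbal.card_induced_le _ hS)
  have hk1 : (0 : ℝ) < (k : ℝ) - 1 := by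
    have : (2 : ℝ) ≤ k := by exact_mod_cast hk
    linarith
  have hq : (p ^ ((G.edgeFinset.card : ℝ) / ((k : ℝ) - 1))) ^ (v - 1) ≤ p ^ m := by
    rw [← Real.rpow_natCast, ← Real.rpow_mul hp0.le, ← Real.rpow_natCast p m]
    refine Real.rpow_le_rpow_of_exponent_ge hp0 hp1 ?_
    rw [div_mul_eq_mul_div, le_div_iff₀ hk1]
    have : ((m * (k - 1) : ℕ) : ℝ) ≤ ((G.edgeFinset.card * (v - 1) : ℕ) : ℝ) := by
      exact_mod_cast hmv
    rw [Nat.cast_mul, Nat.cast_mul, Nat.cast_sub (by omega : 1 ≤ k), Nat.cast_one] at this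
    exact this
  have h1 : 1 ≤ T * (n : ℝ) ^ (v - 1) * p ^ m := by
    refine (hT (v - 1) (by omega)).trans ?_
    rw [mul_pow, mul_assoc]
    gcongr
  have hcard : (D ∪ copyEdges G α).card + m = D.card + G.edgeFinset.card := by
    rw [hm, Finset.inter_comm, Finset.card_union_add_card_inter, card_copyEdges]
  calc p ^ (D ∪ copyEdges G α).card = p ^ (D ∪ copyEdges G α).card * 1 := (mul_one _).symm
    _ ≤ p ^ (D ∪ copyEdges G α).card * (T * (n : ℝ) ^ (v - 1) * p ^ m) := by gcongr
    _ = T * (n : ℝ) ^ (v - 1) * p ^ ((D ∪ copyEdges G α).card + m) := by rw [pow_add]; ring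
    _ = _ := by rw [hcard, pow_add]; ring

lemma sum_pow_card_overlap_le (S : Finset (Fin n)) :
    ∑ α ∈ univ.filter (fun α : Fin k ↪ Fin n => (univ.filter fun i => α i ∈ S).Nonempty),
      (n : ℝ) * (n : ℝ) ^ ((univ.filter fun i => α i ∈ S).card - 1)
      ≤ ((n : ℝ) * (S.card + 1)) ^ k := by
  have e1 : ∀ α : Fin k → Fin n, (n : ℝ) ^ (univ.filter fun i => α i ∈ S).card
      = ∏ i, if α i ∈ S then (n : ℝ) else 1 := by
    intro α
    rw [Finset.prod_ite]
    simp
  calc _ = ∑ α ∈ univ.filter (fun α : Fin k ↪ Fin n => (univ.filter fun i => α i ∈ S).Nonempty),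
        ∏ i, (if α i ∈ S then (n : ℝ) else 1) := by
        refine Finset.sum_congr rfl fun α hα => ?_
        rw [← e1, ← pow_succ']
        have := (Finset.mem_filter.1 hα).2.card_pos
        congr 1
        omega
    _ ≤ ∑ α : Fin k ↪ Fin n, ∏ i, (if α i ∈ S then (n : ℝ) else 1) :=
        Finset.sum_le_sum_of_subset_of_nonneg (Finset.filter_subset _ _) fun α _ _ =>
          Finset.prod_nonneg fun i _ => by split_ifs <;> positivity
    _ = ∑ α ∈ univ.map ⟨fun α : Fin k ↪ Fin n => (α : Fin k → Fin n), DFunLike.coe_injective⟩,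
          ∏ i, (if α i ∈ S then (n : ℝ) else 1) := by
        rw [Finset.sum_map]
        rfl
    _ ≤ ∑ α : Fin k → Fin n, ∏ i, (if α i ∈ S then (n : ℝ) else 1) :=
        Finset.sum_le_sum_of_subset_of_nonneg (Finset.subset_univ _) fun α _ _ =>
          Finset.prod_nonneg fun i _ => by split_ifs <;> positivity
    _ = ∏ _i : Fin k, ∑ j : Fin n, (if j ∈ S then (n : ℝ) else 1) := by
        rw [Finset.prod_univ_sum, Fintype.piFinset_univ]
    _ ≤ ((n : ℝ) * (S.card + 1)) ^ k := by
        rw [Finset.prod_const, Finset.card_univ, Fintype.card_fin]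
        refine pow_le_pow_left₀ (Finset.sum_nonneg fun j _ => by split_ifs <;> positivity) ?_ k
        calc ∑ j : Fin n, (if j ∈ S then (n : ℝ) else 1)
            ≤ ∑ j : Fin n, ((if j ∈ S then (n : ℝ) else 0) + 1) := by
              refine Finset.sum_le_sum fun j _ => ?_
              split_ifs <;> linarith
          _ = _ := by
              rw [Finset.sum_add_distrib, Finset.sum_ite_mem, Finset.univ_inter]
              simp
              ring

end Copies

section Overlap

variable {k n : ℕ}

/-- The placement `α` uses an index of `S`. -/
def Overlap (S : Finset (Fin n)) (α : Fin k ↪ Fin n) : Prop :=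
  (univ.filter fun i => α i ∈ S).Nonempty

instance (S : Finset (Fin n)) : DecidablePred (Overlap (k := k) S) := fun α =>
  inferInstanceAs (Decidable (univ.filter fun i => α i ∈ S).Nonempty)

lemma not_overlap_iff {S : Finset (Fin n)} {α : Fin k ↪ Fin n} :
    ¬ Overlap S α ↔ Disjoint S (univ.map α) := by
  unfold Overlap
  rw [Finset.not_nonempty_iff_eq_empty, Finset.filter_eq_empty_iff, Finset.disjoint_right]
  simp

lemma overlap_union {S S' : Finset (Fin n)} {α : Fin k ↪ Fin n} :
    Overlap (S ∪ S') α ↔ Overlap S α ∨ Overlap S' α := by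
  rw [← not_iff_not, not_or, not_overlap_iff, not_overlap_iff, not_overlap_iff,
    Finset.disjoint_union_left]

lemma sum_overlap_le (hk : 1 ≤ k) (hn : 0 < n) (S : Finset (Fin n)) :
    ∑ α ∈ univ.filter (fun α : Fin k ↪ Fin n => Overlap S α),
      (n : ℝ) ^ ((univ.filter fun i => α i ∈ S).card - 1)
      ≤ (n : ℝ) ^ (k - 1) * ((S.card : ℝ) + 1) ^ k := by
  have hn0 : (0 : ℝ) < n := by exact_mod_cast hn
  have h := sum_pow_card_overlap_le (k := k) S
  rw [← Finset.mul_sum, mul_pow] at h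
  refine le_of_mul_le_mul_left (h.trans (le_of_eq ?_)) hn0
  rw [← mul_assoc, mul_pow_sub_one (by omega)]

lemma card_overlap_le (hk : 1 ≤ k) (hn : 0 < n) (S : Finset (Fin n)) :
    ((univ.filter (fun α : Fin k ↪ Fin n => Overlap S α)).card : ℝ)
      ≤ (n : ℝ) ^ (k - 1) * ((S.card : ℝ) + 1) ^ k := by
  refine le_trans ?_ (sum_overlap_le hk hn S)
  rw [Finset.cast_card]
  refine Finset.sum_le_sum fun α _ => one_le_pow₀ ?_
  exact_mod_cast hn

lemma card_placements_le : (Fintype.card (Fin k ↪ Fin n) : ℝ) ≤ (n : ℝ) ^ k := by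
  rw [Fintype.card_embedding_eq, Fintype.card_fin, Fintype.card_fin]
  exact_mod_cast Nat.descFactorial_le_pow n k

lemma card_placements_ge (hn : 2 * k ≤ n) :
    ((n : ℝ) / 2) ^ k ≤ (Fintype.card (Fin k ↪ Fin n) : ℝ) := by
  rw [Fintype.card_embedding_eq, Fintype.card_fin, Fintype.card_fin]
  have h1 : ((n + 1 - k : ℕ) : ℝ) ^ k ≤ (n.descFactorial k : ℝ) := by
    exact_mod_cast Nat.pow_sub_le_descFactorial n k
  refine le_trans (pow_le_pow_left₀ (by positivity) ?_ k) h1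
  rw [Nat.cast_sub (by omega), Nat.cast_add, Nat.cast_one]
  have : (2 : ℝ) * k ≤ n := by exact_mod_cast hn
  linarith

variable {G : SimpleGraph (Fin k)} [DecidableRel G.Adj] {p T : ℝ}

lemma sum_pow_card_union_le (hk : 2 ≤ k) (hbal : StronglyBalanced G)
    (hp0 : 0 < p) (hp1 : p ≤ 1) (hT0 : 0 ≤ T) (hn : 0 < n)
    (hT : ∀ j < k, 1 ≤ T * ((n : ℝ) * p ^ ((G.edgeFinset.card : ℝ) / ((k : ℝ) - 1))) ^ j)
    (S : Finset (Fin n)) (D : Finset (IndexPair n)) (hD : ∀ e ∈ D, e.1.1 ∈ S ∧ e.1.2 ∈ S)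
    (s : ℝ) (hs : (S.card : ℝ) ≤ s) :
    ∑ α ∈ univ.filter (fun α : Fin k ↪ Fin n => Overlap S α), p ^ (D ∪ copyEdges G α).card
      ≤ p ^ D.card * (p ^ G.edgeFinset.card * T * ((n : ℝ) ^ (k - 1) * (s + 1) ^ k)) := by
  calc _ ≤ ∑ α ∈ univ.filter (fun α : Fin k ↪ Fin n => Overlap S α),
        p ^ D.card * (p ^ G.edgeFinset.card * T *
      (n : ℝ) ^ ((univ.filter fun i => α i ∈ S).card - 1)) :=
        Finset.sum_le_sum fun α hα => pow_card_union_copyEdges_le hk hbal hp0 hp1 hT0 hT α S D hD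
          (Finset.mem_filter.1 hα).2
    _ = p ^ D.card * (p ^ G.edgeFinset.card * T *
        ∑ α ∈ univ.filter (fun α : Fin k ↪ Fin n => Overlap S α),
          (n : ℝ) ^ ((univ.filter fun i => α i ∈ S).card - 1)) := by
        rw [Finset.mul_sum, Finset.mul_sum]
    _ ≤ _ := by
        gcongr
        refine (sum_overlap_le (by omega) hn S).trans ?_
        gcongr

lemma card_map_placement (α : Fin k ↪ Fin n) : (univ.map α).card = k := by simp

lemma triple_sum_le (hk : 2 ≤ k) (hbal : StronglyBalanced G)
    (hp0 : 0 < p) (hp1 : p ≤ 1) (hT0 : 0 ≤ T) (hn : 0 < n)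
    (hT : ∀ j < k, 1 ≤ T * ((n : ℝ) * p ^ ((G.edgeFinset.card : ℝ) / ((k : ℝ) - 1))) ^ j) :
    ∑ α : Fin k ↪ Fin n, ∑ β ∈ univ.filter (fun β => Overlap (univ.map α) β),
      ∑ γ ∈ univ.filter (fun γ => Overlap (univ.map α) γ ∨ Overlap (univ.map β) γ),
        p ^ (copyEdges G α ∪ copyEdges G β ∪ copyEdges G γ).card
      ≤ (n : ℝ) ^ k * (n : ℝ) ^ (k - 1) * (n : ℝ) ^ (k - 1) * (p ^ G.edgeFinset.card) ^ 3 * T ^ 2 *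
        (((k : ℝ) + 1) ^ k * (2 * (k : ℝ) + 1) ^ k) := by
  set e := G.edgeFinset.card
  calc _ ≤ ∑ α : Fin k ↪ Fin n, ∑ β ∈ univ.filter (fun β => Overlap (univ.map α) β),
        p ^ (copyEdges G α ∪ copyEdges G β).card *
          (p ^ e * T * ((n : ℝ) ^ (k - 1) * (2 * (k : ℝ) + 1) ^ k)) := by
        refine Finset.sum_le_sum fun α _ => Finset.sum_le_sum fun β _ => ?_
        simp_rw [← overlap_union]
        refine sum_pow_card_union_le hk hbal hp0 hp1 hT0 hn hT _ _ ?_ _ ?_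
        · intro e he
          rcases Finset.mem_union.1 he with he | he
          · have := copyEdges_subset α e he
            exact ⟨Finset.mem_union_left _ this.1, Finset.mem_union_left _ this.2⟩
          · have := copyEdges_subset β e he
            exact ⟨Finset.mem_union_right _ this.1, Finset.mem_union_right _ this.2⟩
        · have := Finset.card_union_le (univ.map α) (univ.map β)
          rw [card_map_placement, card_map_placement, ← two_mul] at this
          exact_mod_cast this
    _ ≤ ∑ α : Fin k ↪ Fin n, p ^ e * (p ^ e * T * ((n : ℝ) ^ (k - 1) * ((k : ℝ) + 1) ^ k)) *
          (p ^ e * T * ((n : ℝ) ^ (k - 1) * (2 * (k : ℝ) + 1) ^ k)) := by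
        refine Finset.sum_le_sum fun α _ => ?_
        rw [← Finset.sum_mul]
        gcongr
        have := sum_pow_card_union_le hk hbal hp0 hp1 hT0 hn hT (univ.map α) (copyEdges G α)
          (copyEdges_subset α) k (by rw [card_map_placement])
        rwa [card_copyEdges] at this
    _ ≤ (n : ℝ) ^ k * (p ^ e * (p ^ e * T * ((n : ℝ) ^ (k - 1) * ((k : ℝ) + 1) ^ k)) *
          (p ^ e * T * ((n : ℝ) ^ (k - 1) * (2 * (k : ℝ) + 1) ^ k))) := by
        rw [Finset.sum_const, nsmul_eq_mul, Finset.card_univ]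
        gcongr
        exact card_placements_le
    _ = _ := by ring

end Overlap

section Centred

variable {E : Type*} [MeasurableSpace E] {n : ℕ}

/-- The centred edge-product indicator. -/
noncomputable def centredEdgeProd (μ : Measure E) (H : E → E → ℝ) (p : ℝ)
    (D : Finset (IndexPair n)) (ω : (Fin n → E) × (IndexPair n → ℝ)) : ℝ :=
  edgeProd H p D ω - ∫ ω', edgeProd H p D ω' ∂(modelMeasure μ n)

variable (μ : Measure E) {H : E → E → ℝ} {p : ℝ}

lemma centredEdgeProd_bddMeasurable (hH : Measurable fun z : E × E => H z.1 z.2)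
    (D : Finset (IndexPair n)) : BddMeasurable (centredEdgeProd μ H p D) :=
  (edgeProd_bddMeasurable hH).sub (BddMeasurable.const _)

lemma centredEdgeProd_locallyOn {D : Finset (IndexPair n)} {S : Finset (Fin n)}
    (hD : ∀ e ∈ D, e.1.1 ∈ S ∧ e.1.2 ∈ S) : LocallyOn S (centredEdgeProd μ H p D) :=
  (edgeProd_locallyOn hD).comp fun t => t - ∫ ω', edgeProd H p D ω' ∂(modelMeasure μ n)

variable [IsProbabilityMeasure μ]

lemma integral_centredEdgeProd (hH : Measurable fun z : E × E => H z.1 z.2)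
    (D : Finset (IndexPair n)) : ∫ ω, centredEdgeProd μ H p D ω ∂(modelMeasure μ n) = 0 := by
  unfold centredEdgeProd
  rw [integral_sub ((edgeProd_bddMeasurable hH).integrable _) (integrable_const _)]
  simp

lemma pow_card_mul_pow_card_le (hp0 : 0 ≤ p) (hp1 : p ≤ 1) (A B : Finset (IndexPair n)) :
    p ^ A.card * p ^ B.card ≤ p ^ (A ∪ B).card := by
  rw [← pow_add]
  exact pow_le_pow_of_le_one hp0 hp1 (Finset.card_union_le A B)

lemma integral_edgeProd_mul_centred_le (hH : Measurable fun z : E × E => H z.1 z.2)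
    (hH01 : ∀ x y, H x y ∈ Set.Icc (0 : ℝ) 1) (hp0 : 0 ≤ p) (hp1 : p ≤ 1)
    {F : (Fin n → E) × (IndexPair n → ℝ) → ℝ} (hF : BddMeasurable F) (hF0 : ∀ ω, 0 ≤ F ω)
    {K : ℝ} (hK : 0 ≤ K) (A B : Finset (IndexPair n))
    (h : ∀ D, ∫ ω, edgeProd H p D ω * F ω ∂(modelMeasure μ n) ≤ K * p ^ (D ∪ A).card)
    (D : Finset (IndexPair n)) :
    ∫ ω, edgeProd H p D ω * (F ω * |centredEdgeProd μ H p B ω|) ∂(modelMeasure μ n)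
      ≤ 2 * K * p ^ (D ∪ (A ∪ B)).card := by
  set c := ∫ ω', edgeProd H p B ω' ∂(modelMeasure μ n) with hc
  have hc0 : 0 ≤ c := integral_nonneg fun ω => edgeProd_nonneg ω
  have hc1 : c ≤ p ^ B.card := integral_edgeProd_le μ hH hH01 hp0 hp1
  have b1 : BddMeasurable (fun ω => edgeProd H p (D ∪ B) ω * F ω) :=
    (edgeProd_bddMeasurable hH).mul hF
  have b2 : BddMeasurable (fun ω => edgeProd H p D ω * F ω) := (edgeProd_bddMeasurable hH).mul hF
  have b3 : BddMeasurable (fun ω => c * (edgeProd H p D ω * F ω)) := (BddMeasurable.const c).mul b2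
  have b4 : BddMeasurable
      (fun ω => edgeProd H p D ω * (F ω * |centredEdgeProd μ H p B ω|)) :=
    (edgeProd_bddMeasurable hH).mul (hF.mul (centredEdgeProd_bddMeasurable μ hH B).abs)
  calc _ ≤ ∫ ω, (edgeProd H p (D ∪ B) ω * F ω + c * (edgeProd H p D ω * F ω))
        ∂(modelMeasure μ n) := by
        refine integral_mono (b4.integrable _) ((b1.add b3).integrable _) fun ω => ?_
        have hJ : |centredEdgeProd μ H p B ω| ≤ edgeProd H p B ω + c := by
          unfold centredEdgeProd
          refine (abs_sub _ _).trans ?_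
          rw [abs_of_nonneg (edgeProd_nonneg ω), abs_of_nonneg hc0]
        simp only
        rw [← edgeProd_mul]
        have := mul_le_mul_of_nonneg_left hJ (mul_nonneg (edgeProd_nonneg (H := H) (p := p) (D := D)
          ω) (hF0 ω))
        linarith
    _ = ∫ ω, edgeProd H p (D ∪ B) ω * F ω ∂(modelMeasure μ n)
          + c * ∫ ω, edgeProd H p D ω * F ω ∂(modelMeasure μ n) := by
        rw [integral_add (b1.integrable _) (b3.integrable _), integral_const_mul]
    _ ≤ K * p ^ (D ∪ (A ∪ B)).card + p ^ B.card * (K * p ^ (D ∪ A).card) := by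
        refine add_le_add ((h _).trans (le_of_eq ?_)) (mul_le_mul hc1 (h _) ?_ (by positivity))
        · rw [Finset.union_assoc, Finset.union_comm B A]
        · exact integral_nonneg fun ω => mul_nonneg (edgeProd_nonneg ω) (hF0 ω)
    _ ≤ _ := by
        have := pow_card_mul_pow_card_le hp0 hp1 (D ∪ A) B
        rw [Finset.union_assoc] at this
        have := mul_le_mul_of_nonneg_left this hK
        linarith

lemma integral_abs_centred_le (hH : Measurable fun z : E × E => H z.1 z.2)
    (hH01 : ∀ x y, H x y ∈ Set.Icc (0 : ℝ) 1) (hp0 : 0 ≤ p) (hp1 : p ≤ 1)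
    (A B C : Finset (IndexPair n)) :
    (∫ ω, |centredEdgeProd μ H p A ω| ∂(modelMeasure μ n) ≤ 2 * p ^ A.card) ∧
    (∫ ω, |centredEdgeProd μ H p A ω * centredEdgeProd μ H p B ω| ∂(modelMeasure μ n)
      ≤ 4 * p ^ (A ∪ B).card) ∧
    ∫ ω, |centredEdgeProd μ H p A ω * centredEdgeProd μ H p B ω * centredEdgeProd μ H p C ω|
      ∂(modelMeasure μ n) ≤ 8 * p ^ (A ∪ B ∪ C).card := by
  have b := fun D => (centredEdgeProd_bddMeasurable (p := p) μ hH (n := n) D).abs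
  have h0 : ∀ D : Finset (IndexPair n), ∫ ω, edgeProd H p D ω * 1 ∂(modelMeasure μ n)
      ≤ 1 * p ^ (D ∪ ∅).card := fun D => by
    simpa using integral_edgeProd_le (D := D) μ hH hH01 hp0 hp1
  have h1 := integral_edgeProd_mul_centred_le μ hH hH01 hp0 hp1 (BddMeasurable.const 1)
    (fun _ => zero_le_one) zero_le_one ∅ A h0
  have h2 := integral_edgeProd_mul_centred_le μ hH hH01 hp0 hp1 ((BddMeasurable.const 1).mul (b A))
    (fun _ => by positivity) (by norm_num) _ B h1
  have h3 := integral_edgeProd_mul_centred_le μ hH hH01 hp0 hp1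
    (((BddMeasurable.const 1).mul (b A)).mul (b B)) (fun _ => by positivity) (by norm_num) _ C h2
  have e : ∀ ω : (Fin n → E) × (IndexPair n → ℝ), edgeProd H p ∅ ω = 1 := fun ω => by
    simp [edgeProd]
  have h1 := h1 ∅
  have h2 := h2 ∅
  have h3 := h3 ∅
  simp only [e, one_mul, Finset.empty_union, ← abs_mul] at h1 h2 h3
  refine ⟨by linarith, by linarith, by linarith⟩

end Centred

section SteinSubgraph

/-- The number of labelled copies of `G` on the canonical space. -/
noncomputable def copyCount {E : Type*} {k : ℕ} (G : SimpleGraph (Fin k)) [DecidableRel G.Adj]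
    (n : ℕ) (H : E → E → ℝ) (p : ℝ) (ω : (Fin n → E) × (IndexPair n → ℝ)) : ℝ :=
  ∑ α : Fin k ↪ Fin n, edgeProd H p (copyEdges G α) ω

variable {E : Type*} [MeasurableSpace E] {k n : ℕ} {G : SimpleGraph (Fin k)} [DecidableRel G.Adj]
  (μ : Measure E) [IsProbabilityMeasure μ] {H : E → E → ℝ} {p : ℝ}

lemma copyCount_bddMeasurable (hH : Measurable fun z : E × E => H z.1 z.2) :
    BddMeasurable (copyCount G n H p) :=
  BddMeasurable.sum _ fun _ _ => edgeProd_bddMeasurable hH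

lemma copyCount_sub_integral (hH : Measurable fun z : E × E => H z.1 z.2) (ω) :
    copyCount G n H p ω - ∫ ω', copyCount G n H p ω' ∂(modelMeasure μ n)
      = ∑ α : Fin k ↪ Fin n, centredEdgeProd μ H p (copyEdges G α) ω := by
  unfold copyCount centredEdgeProd
  rw [integral_finsetSum _ fun α _ => (edgeProd_bddMeasurable hH).integrable _,
    Finset.sum_sub_distrib]

lemma integral_centred_mul_of_not_overlap (hH : Measurable fun z : E × E => H z.1 z.2)
    {α β : Fin k ↪ Fin n} (h : ¬ Overlap (univ.map α) β) :
    ∫ ω, centredEdgeProd μ H p (copyEdges G α) ω * centredEdgeProd μ H p (copyEdges G β) ω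
      ∂(modelMeasure μ n) = 0 := by
  rw [LocallyOn.integral_mul μ (not_overlap_iff.1 h)
    (centredEdgeProd_locallyOn μ (copyEdges_subset α))
    (centredEdgeProd_locallyOn μ (copyEdges_subset β)) (centredEdgeProd_bddMeasurable μ hH _)
    (centredEdgeProd_bddMeasurable μ hH _), integral_centredEdgeProd μ hH, zero_mul]

lemma variance_copyCount (hH : Measurable fun z : E × E => H z.1 z.2) :
    variance (copyCount G n H p) (modelMeasure μ n)
      = ∑ α : Fin k ↪ Fin n, ∑ β ∈ univ.filter (fun β => Overlap (univ.map α) β),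
        ∫ ω, centredEdgeProd μ H p (copyEdges G α) ω * centredEdgeProd μ H p (copyEdges G β) ω
          ∂(modelMeasure μ n) := by
  rw [variance_eq_integral (copyCount_bddMeasurable hH).1.aemeasurable]
  simp_rw [copyCount_sub_integral μ hH, sq, Finset.sum_mul_sum]
  have b : ∀ α β : Fin k ↪ Fin n, BddMeasurable fun ω =>
      centredEdgeProd μ H p (copyEdges G α) ω * centredEdgeProd μ H p (copyEdges G β) ω :=
    fun α β => (centredEdgeProd_bddMeasurable μ hH _).mul (centredEdgeProd_bddMeasurable μ hH _)
  rw [integral_finsetSum _ fun α _ => (BddMeasurable.sum _ fun β _ => b α β).integrable _]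
  refine Finset.sum_congr rfl fun α _ => ?_
  rw [integral_finsetSum _ fun β _ => (b α β).integrable _, Finset.sum_filter]
  refine Finset.sum_congr rfl fun β _ => ?_
  split_ifs with h
  · rfl
  · exact integral_centred_mul_of_not_overlap μ hH h

lemma stein_copyCount (hk : 2 ≤ k) (hbal : StronglyBalanced G)
    (hH : Measurable fun z : E × E => H z.1 z.2)
    (hH01 : ∀ x y, H x y ∈ Set.Icc (0 : ℝ) 1) {T : ℝ}
    (hp0 : 0 < p) (hp1 : p ≤ 1) (hT0 : 0 ≤ T) (hn : 0 < n)
    (hT : ∀ j < k, 1 ≤ T * ((n : ℝ) * p ^ ((G.edgeFinset.card : ℝ) / ((k : ℝ) - 1))) ^ j)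
    (hV : 0 < variance (copyCount G n H p) (modelMeasure μ n))
    (g g' : ℝ → ℝ) (M : ℝ) (hg : ∀ x, HasDerivAt g (g' x) x)
    (hlip : ∀ x y, |g' x - g' y| ≤ M * |x - y|) :
    |∫ ω, ((copyCount G n H p ω - ∫ ω', copyCount G n H p ω' ∂(modelMeasure μ n)) /
          √(variance (copyCount G n H p) (modelMeasure μ n))) *
        g ((copyCount G n H p ω - ∫ ω', copyCount G n H p ω' ∂(modelMeasure μ n)) /
          √(variance (copyCount G n H p) (modelMeasure μ n))) ∂(modelMeasure μ n)
      - ∫ ω, g' ((copyCount G n H p ω - ∫ ω', copyCount G n H p ω' ∂(modelMeasure μ n)) /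
          √(variance (copyCount G n H p) (modelMeasure μ n))) ∂(modelMeasure μ n)|
      ≤ M * (24 * ((k : ℝ) + 1) ^ k * (2 * (k : ℝ) + 1) ^ k *
        ((n : ℝ) ^ k * (n : ℝ) ^ (k - 1) * (n : ℝ) ^ (k - 1) *
          (p ^ G.edgeFinset.card) ^ 3 * T ^ 2
          / √(variance (copyCount G n H p) (modelMeasure μ n)) ^ 3)) := by
  have hvc := variance_copyCount (G := G) (n := n) (p := p) μ hH
  simp_rw [copyCount_sub_integral μ hH]
  set V := variance (copyCount G n H p) (modelMeasure μ n) with hVdef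
  set s := √V with hs
  have hs0 : 0 < s := Real.sqrt_pos.2 hV
  have hss : s * s = V := Real.mul_self_sqrt hV.le
  let J : (Fin k ↪ Fin n) → (Fin n → E) × (IndexPair n → ℝ) → ℝ :=
    fun α => centredEdgeProd μ H p (copyEdges G α)
  have hM : 0 ≤ M := by
    have := (abs_nonneg _).trans (hlip 0 1)
    simpa using this
  let ξ : (Fin k ↪ Fin n) → (Fin n → E) × (IndexPair n → ℝ) → ℝ := fun α ω => J α ω * s⁻¹
  have bξ : ∀ α, BddMeasurable (ξ α) := fun α =>
    (centredEdgeProd_bddMeasurable μ hH _).mul (BddMeasurable.const _)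
  have lξ : ∀ α, LocallyOn (univ.map α) (ξ α) := fun α =>
    (centredEdgeProd_locallyOn μ (copyEdges_subset α)).comp fun t => t * s⁻¹
  have lrest : ∀ (S : Finset (Fin n)) (φ : ℝ → ℝ), LocallyOn Sᶜ (fun ω =>
      φ (∑ β ∈ univ.filter (fun β : Fin k ↪ Fin n => ¬ Overlap S β), ξ β ω)) := by
    intro S φ
    refine LocallyOn.comp (LocallyOn.sum _ fun β hβ => (lξ β).mono ?_) φ
    have := not_overlap_iff.1 (Finset.mem_filter.1 hβ).2
    exact Finset.subset_compl_iff_disjoint_left.2 this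
  have brest : ∀ (S : Finset (Fin n)) (φ : ℝ → ℝ), Continuous φ → BddMeasurable (fun ω =>
      φ (∑ β ∈ univ.filter (fun β : Fin k ↪ Fin n => ¬ Overlap S β), ξ β ω)) := fun S φ hφ =>
    (BddMeasurable.sum _ fun β _ => bξ β).comp_continuous hφ
  have hξ0 : ∀ α, ∫ ω, ξ α ω ∂(modelMeasure μ n) = 0 := fun α => by
    rw [integral_mul_const, integral_centredEdgeProd μ hH, zero_mul]
  have eW : ∀ ω, (∑ α : Fin k ↪ Fin n, centredEdgeProd μ H p (copyEdges G α) ω) / s = ∑ α, ξ α ω := fun ω => by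
    rw [div_eq_mul_inv, Finset.sum_mul]
  simp_rw [eW]
  have key := stein_local_dependence (modelMeasure μ n) ξ bξ
    (fun α β => Overlap (univ.map α) β) ?_ ?_ ?_
    (fun α β γ => 8 * s⁻¹ ^ 3 * p ^ (copyEdges G α ∪ copyEdges G β ∪ copyEdges G γ).card)
    ?_ ?_ g g' M hg hlip
  · refine key.trans (mul_le_mul_of_nonneg_left ?_ hM)
    simp_rw [← Finset.mul_sum]
    have := triple_sum_le hk hbal hp0 hp1 hT0 hn hT
    have h8 : (0 : ℝ) ≤ 24 * s⁻¹ ^ 3 := by positivity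
    have := mul_le_mul_of_nonneg_left this h8
    refine (le_of_eq (by ring)).trans (this.trans (le_of_eq ?_))
    rw [div_eq_mul_inv, ← inv_pow]
    ring
  · intro α φ hφ
    rw [LocallyOn.integral_mul μ disjoint_compl_right (lξ α) (lrest _ φ) (bξ α) (brest _ φ hφ),
      hξ0, zero_mul]
  · intro α β φ hφ
    simp_rw [← overlap_union]
    rw [LocallyOn.integral_mul μ disjoint_compl_right
      (((lξ α).mono Finset.subset_union_left).mul ((lξ β).mono Finset.subset_union_right))
      (lrest _ φ) ((bξ α).mul (bξ β)) (brest _ φ hφ)]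
  · have e : ∀ α β, ∫ ω, ξ α ω * ξ β ω ∂(modelMeasure μ n)
        = (∫ ω, J α ω * J β ω ∂(modelMeasure μ n)) * (s * s)⁻¹ := fun α β => by
      rw [← integral_mul_const]
      congr 1
      ext ω
      simp only [ξ]
      rw [mul_inv]
      ring
    simp_rw [e, ← Finset.sum_mul]
    rw [← hvc, hss, mul_inv_cancel₀ hV.ne']
  · intro α β γ
    have e : ∀ ω, |ξ α ω * ξ β ω * ξ γ ω| = s⁻¹ ^ 3 * |J α ω * J β ω * J γ ω| := fun ω => by
      simp only [ξ]
      rw [← abs_of_nonneg (by positivity : 0 ≤ s⁻¹ ^ 3), ← abs_mul]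
      congr 1
      ring
    simp_rw [e]
    rw [integral_const_mul]
    have := (integral_abs_centred_le μ hH hH01 hp0.le hp1 (copyEdges G α) (copyEdges G β)
      (copyEdges G γ)).2.2
    have := mul_le_mul_of_nonneg_left this (by positivity : 0 ≤ s⁻¹ ^ 3)
    linarith
  · intro α β γ
    have e : ∀ ω, |ξ α ω * ξ β ω| = s⁻¹ ^ 2 * |J α ω * J β ω| := fun ω => by
      simp only [ξ]
      rw [← abs_of_nonneg (by positivity : 0 ≤ s⁻¹ ^ 2), ← abs_mul]
      congr 1
      ring
    have e' : ∀ ω, |ξ γ ω| = s⁻¹ * |J γ ω| := fun ω => by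
      simp only [ξ]
      rw [abs_mul, abs_of_pos (inv_pos.2 hs0), mul_comm]
    simp_rw [e, e']
    rw [integral_const_mul, integral_const_mul]
    have h2 := (integral_abs_centred_le μ hH hH01 hp0.le hp1 (copyEdges G α) (copyEdges G β)
      (copyEdges G γ)).2.1
    have h1 := (integral_abs_centred_le μ hH hH01 hp0.le hp1 (copyEdges G γ) (copyEdges G β)
      (copyEdges G γ)).1
    have h21 := mul_le_mul h2 h1 (integral_nonneg fun ω => abs_nonneg _) (by positivity)
    have hu := pow_card_mul_pow_card_le hp0.le hp1 (copyEdges G α ∪ copyEdges G β) (copyEdges G γ)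
    have := mul_le_mul_of_nonneg_left (h21.trans (by linarith : _ ≤ 8 *
      p ^ (copyEdges G α ∪ copyEdges G β ∪ copyEdges G γ).card)) (by positivity : 0 ≤ s⁻¹ ^ 3)
    refine le_trans (le_of_eq ?_) (this.trans (le_of_eq ?_)) <;> ring

end SteinSubgraph

lemma sq_div_le_variance {Ω : Type*} [MeasurableSpace Ω] (P : Measure Ω) [IsProbabilityMeasure P]
    {S L : Ω → ℝ} (bS : BddMeasurable S) (bL : BddMeasurable L) (hL : ∫ ω, L ω ∂P = 0)
    {b : ℝ} (hb : ∫ ω, L ω * L ω ∂P = b) (hb0 : 0 < b) :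
    (∫ ω, S ω * L ω ∂P) ^ 2 / b ≤ variance S P := by
  set a := ∫ ω, S ω * L ω ∂P with ha
  set c := ∫ ω, S ω ∂P with hc
  set l := a / b with hl
  rw [variance_eq_integral bS.1.aemeasurable, ← hc]
  have b1 : BddMeasurable fun ω => (S ω - c) ^ 2 :=
    (bS.sub (BddMeasurable.const c)).comp_continuous (φ := fun t => t ^ 2) (by fun_prop)
  have b2 : BddMeasurable fun ω => (2 * l) * (S ω * L ω) := (BddMeasurable.const _).mul (bS.mul bL)
  have b3 : BddMeasurable fun ω => (2 * l * c) * L ω := (BddMeasurable.const _).mul bL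
  have b4 : BddMeasurable fun ω => (l ^ 2) * (L ω * L ω) :=
    (BddMeasurable.const _).mul (bL.mul bL)
  have h0 : 0 ≤ ∫ ω, (S ω - c - l * L ω) ^ 2 ∂P := integral_nonneg fun ω => sq_nonneg _
  have e : ∀ ω, (S ω - c - l * L ω) ^ 2 = ((S ω - c) ^ 2 - (2 * l) * (S ω * L ω))
      + ((2 * l * c) * L ω + (l ^ 2) * (L ω * L ω)) := fun ω => by ring
  simp_rw [e] at h0
  rw [integral_add ((b1.sub b2).integrable P) ((b3.add b4).integrable P),
    integral_sub (b1.integrable P) (b2.integrable P), integral_add (b3.integrable P)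
      (b4.integrable P), integral_const_mul, integral_const_mul, integral_const_mul, hL, hb, ← ha]
    at h0
  have : l * b = a := by rw [hl]; field_simp
  have h2 : a ^ 2 / b = l * a := by rw [hl]; field_simp
  rw [h2]
  have h3 : l ^ 2 * b = l * a := by rw [← this]; ring
  linarith

section EdgeFunction

variable {E : Type*} {k n : ℕ}

/-- The product of the connection function over the edges of `G`. -/
noncomputable def edgeFun (G : SimpleGraph (Fin k)) [DecidableRel G.Adj] (H : E → E → ℝ)
    (z : Fin k → E) : ℝ :=
  ∏ q ∈ orderedEdges G, H (z q.1) (z q.2)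

/-- The conditional expectation of `edgeFun` given the position of vertex `ℓ`. -/
noncomputable def edgeProj [MeasurableSpace E] (G : SimpleGraph (Fin k)) [DecidableRel G.Adj]
    (H : E → E → ℝ) (μ : Measure E) (ℓ : Fin k) (t : E) : ℝ :=
  ∫ z, edgeFun G H (Function.update z ℓ t) ∂(Measure.pi fun _ => μ)

variable {G : SimpleGraph (Fin k)} [DecidableRel G.Adj] {H : E → E → ℝ} {p : ℝ}

lemma edgeFun_mem (hH01 : ∀ x y, H x y ∈ Set.Icc (0 : ℝ) 1) (z : Fin k → E) :
    0 ≤ edgeFun G H z ∧ edgeFun G H z ≤ 1 :=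
  ⟨Finset.prod_nonneg fun _ _ => (hH01 _ _).1,
    Finset.prod_le_one (fun _ _ => (hH01 _ _).1) fun _ _ => (hH01 _ _).2⟩

variable [MeasurableSpace E]

lemma edgeFun_bddMeasurable (hH : Measurable fun z : E × E => H z.1 z.2)
    (hH01 : ∀ x y, H x y ∈ Set.Icc (0 : ℝ) 1) : BddMeasurable (edgeFun G H) := by
  refine ⟨Finset.measurable_prod _ fun q _ => ?_, 1, fun z => ?_⟩
  · exact hH.comp (f := fun z : Fin k → E => (z q.1, z q.2)) (by fun_prop)
  · rw [abs_of_nonneg (edgeFun_mem hH01 z).1]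
    exact (edgeFun_mem hH01 z).2

variable (μ : Measure E)

lemma measurable_update_prod (ℓ : Fin k) :
    Measurable (fun q : (Fin k → E) × E => Function.update q.1 ℓ q.2) := by
  refine measurable_pi_iff.2 fun i => ?_
  by_cases h : i = ℓ
  · subst h
    simpa using measurable_snd
  · simp only [Function.update_of_ne h]
    fun_prop

lemma edgeProj_nonneg (hH01 : ∀ x y, H x y ∈ Set.Icc (0 : ℝ) 1) (ℓ : Fin k) (t : E) :
    0 ≤ edgeProj G H μ ℓ t :=
  integral_nonneg fun _ => (edgeFun_mem hH01 _).1

variable [IsProbabilityMeasure μ]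

lemma edgeProj_bddMeasurable (hH : Measurable fun z : E × E => H z.1 z.2)
    (hH01 : ∀ x y, H x y ∈ Set.Icc (0 : ℝ) 1) (ℓ : Fin k) :
    BddMeasurable (edgeProj G H μ ℓ) := by
  refine ⟨?_, 1, fun t => ?_⟩
  · have : StronglyMeasurable fun q : (Fin k → E) × E => edgeFun G H (Function.update q.1 ℓ q.2) :=
      ((edgeFun_bddMeasurable hH hH01).1.comp (measurable_update_prod ℓ)).stronglyMeasurable
    exact this.integral_prod_left'.measurable
  · have := norm_integral_le_of_norm_le_const (μ := Measure.pi fun _ : Fin k => μ)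
      (f := fun z => edgeFun G H (Function.update z ℓ t)) (C := 1)
      (Filter.Eventually.of_forall fun z => by
        rw [Real.norm_eq_abs, abs_of_nonneg (edgeFun_mem hH01 _).1]
        exact (edgeFun_mem hH01 _).2)
    simpa [edgeProj] using this

lemma integral_edgeFun_mul (hH : Measurable fun z : E × E => H z.1 z.2)
    (hH01 : ∀ x y, H x y ∈ Set.Icc (0 : ℝ) 1) (ℓ : Fin k) {u : E → ℝ} (hu : BddMeasurable u) :
    ∫ z, edgeFun G H z * u (z ℓ) ∂(Measure.pi fun _ => μ)
      = ∫ t, edgeProj G H μ ℓ t * u t ∂μ := by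
  have bz : BddMeasurable fun z : Fin k → E => edgeFun G H z * u (z ℓ) :=
    (edgeFun_bddMeasurable hH hH01).mul (hu.comp_measurable (measurable_pi_apply ℓ))
  rw [← map_update_pi μ ℓ, integral_map (measurable_update_prod ℓ).aemeasurable
    bz.1.aestronglyMeasurable, integral_prod_symm _ ((bz.comp_measurable
      (measurable_update_prod ℓ)).integrable _)]
  congr 1
  ext t
  simp only [Function.update_self]
  rw [integral_mul_const]
  rfl

lemma integral_copy_mul (hH : Measurable fun z : E × E => H z.1 z.2)
    (hH01 : ∀ x y, H x y ∈ Set.Icc (0 : ℝ) 1) (hHsym : ∀ x y, H x y = H y x)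
    (hp0 : 0 ≤ p) (hp1 : p ≤ 1)
    (α : Fin k ↪ Fin n) {φ : (Fin k → E) → ℝ} (hφ : BddMeasurable φ) :
    ∫ ω, edgeProd H p (copyEdges G α) ω * φ (fun i => ω.1 (α i)) ∂(modelMeasure μ n)
      = p ^ G.edgeFinset.card * ∫ z, edgeFun G H z * φ z ∂(Measure.pi fun _ => μ) := by
  have hm : Measurable fun (x : Fin n → E) (i : Fin k) => x (α i) := by fun_prop
  have h := integral_edgeProd_mul (D := copyEdges G α) μ hH hH01 hp0 hp1
    (fun x => φ fun i => x (α i)) (hφ.comp_measurable hm)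
  rw [card_copyEdges] at h
  rw [h]
  congr 1
  rw [← map_comp_injective_pi (J := Fin n) μ (α : Fin k → Fin n) α.injective,
    integral_map hm.aemeasurable ((edgeFun_bddMeasurable hH hH01).mul hφ).1.aestronglyMeasurable]
  congr 1
  ext x
  rw [← prod_orderedEdges α (fun a b => H (x a) (x b)) fun a b => hHsym _ _]
  rfl

lemma integral_copy (hH : Measurable fun z : E × E => H z.1 z.2)
    (hH01 : ∀ x y, H x y ∈ Set.Icc (0 : ℝ) 1) (hHsym : ∀ x y, H x y = H y x)
    (hp0 : 0 ≤ p) (hp1 : p ≤ 1) (α : Fin k ↪ Fin n) :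
    ∫ ω, edgeProd H p (copyEdges G α) ω ∂(modelMeasure μ n)
      = p ^ G.edgeFinset.card * ∫ z, edgeFun G H z ∂(Measure.pi fun _ => μ) := by
  have := integral_copy_mul (G := G) μ hH hH01 hHsym hp0 hp1 α (BddMeasurable.const 1)
  simpa using this

lemma integral_fst_modelMeasure (hH : Measurable fun z : E × E => H z.1 z.2)
    (hH01 : ∀ x y, H x y ∈ Set.Icc (0 : ℝ) 1) {φ : (Fin n → E) → ℝ} (hφ : BddMeasurable φ) :
    ∫ ω, φ ω.1 ∂(modelMeasure μ n) = ∫ x, φ x ∂(Measure.pi fun _ => μ) := by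
  have := integral_edgeProd_mul (D := (∅ : Finset (IndexPair n))) (p := 0) μ hH hH01 le_rfl
    zero_le_one φ hφ
  simpa [edgeProd] using this

lemma integral_eval_modelMeasure (hH : Measurable fun z : E × E => H z.1 z.2)
    (hH01 : ∀ x y, H x y ∈ Set.Icc (0 : ℝ) 1) {u : E → ℝ} (hu : BddMeasurable u) (i : Fin n) :
    ∫ ω, u (ω.1 i) ∂(modelMeasure μ n) = ∫ t, u t ∂μ := by
  rw [integral_fst_modelMeasure μ hH hH01 (hu.comp_measurable (measurable_pi_apply i))]
  exact integral_comp_eval (μ := fun _ : Fin n => μ) hu.1.aestronglyMeasurable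

lemma variance_ge_of_proj (hH : Measurable fun z : E × E => H z.1 z.2)
    (hH01 : ∀ x y, H x y ∈ Set.Icc (0 : ℝ) 1) (hHsym : ∀ x y, H x y = H y x)
    (hp0 : 0 ≤ p) (hp1 : p ≤ 1) (hn : 0 < n)
    (hv : 0 < variance (fun t => ∑ ℓ, edgeProj G H μ ℓ t) μ) :
    ((Fintype.card (Fin k ↪ Fin n) : ℝ) * p ^ G.edgeFinset.card) ^ 2 *
        variance (fun t => ∑ ℓ, edgeProj G H μ ℓ t) μ / n
      ≤ variance (copyCount G n H p) (modelMeasure μ n) := by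
  set v := variance (fun t => ∑ ℓ, edgeProj G H μ ℓ t) μ with hvdef
  have bsum : BddMeasurable fun t => ∑ ℓ, edgeProj G H μ ℓ t :=
    BddMeasurable.sum _ fun ℓ _ => edgeProj_bddMeasurable μ hH hH01 ℓ
  set m := ∫ t, ∑ ℓ, edgeProj G H μ ℓ t ∂μ with hm
  let u : E → ℝ := fun t => ∑ ℓ, edgeProj G H μ ℓ t - m
  have bu : BddMeasurable u := bsum.sub (BddMeasurable.const m)
  have hu0 : ∫ t, u t ∂μ = 0 := by
    simp only [u]
    rw [integral_sub (bsum.integrable μ) (integrable_const _)]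
    simp [hm]
  have huu : ∫ t, u t * u t ∂μ = v := by
    rw [hvdef, variance_eq_integral bsum.1.aemeasurable]
    simp only [u, sq, hm]
  have hsu : ∑ ℓ, ∫ t, edgeProj G H μ ℓ t * u t ∂μ = v := by
    rw [← integral_finsetSum _ fun ℓ _ =>
      ((edgeProj_bddMeasurable μ hH hH01 ℓ).mul bu).integrable μ]
    simp_rw [← Finset.sum_mul]
    have e : ∀ t, (∑ ℓ, edgeProj G H μ ℓ t) * u t = u t * u t + m * u t := fun t => by
      simp only [u]; ring
    simp_rw [e]
    rw [integral_add ((bu.mul bu).integrable μ) (((BddMeasurable.const m).mul bu).integrable μ),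
      integral_const_mul, hu0, huu, mul_zero, add_zero]
  have bui : ∀ i, BddMeasurable fun ω : (Fin n → E) × (IndexPair n → ℝ) => u (ω.1 i) := fun i =>
    bu.comp_measurable ((measurable_pi_apply i).comp measurable_fst)
  have lui : ∀ i, LocallyOn {i} fun ω : (Fin n → E) × (IndexPair n → ℝ) => u (ω.1 i) := by
    intro i x x' y y' hx _
    simp only [hx i (Finset.mem_singleton_self i)]
  have bL : BddMeasurable fun ω : (Fin n → E) × (IndexPair n → ℝ) => ∑ i, u (ω.1 i) :=
    BddMeasurable.sum _ fun i _ => bui i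
  have hL0 : ∫ ω, ∑ i, u (ω.1 i) ∂(modelMeasure μ n) = 0 := by
    rw [integral_finsetSum _ fun i _ => (bui i).integrable _]
    simp [integral_eval_modelMeasure μ hH hH01 bu, hu0]
  have hLL : ∫ ω, (∑ i, u (ω.1 i)) * ∑ i, u (ω.1 i) ∂(modelMeasure μ n) = n * v := by
    simp_rw [Finset.sum_mul_sum]
    rw [integral_finsetSum _ fun i _ =>
      (BddMeasurable.sum _ fun j _ => (bui i).mul (bui j)).integrable _]
    have : ∀ i : Fin n, ∫ ω, ∑ j, u (ω.1 i) * u (ω.1 j) ∂(modelMeasure μ n) = v := by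
      intro i
      rw [integral_finsetSum _ fun j _ => ((bui i).mul (bui j)).integrable _,
        Finset.sum_eq_single i]
      · rw [integral_eval_modelMeasure μ hH hH01 (bu.mul bu), huu]
      · intro j _ hj
        rw [LocallyOn.integral_mul μ (by simpa using hj.symm) (lui i) (lui j) (bui i) (bui j),
          integral_eval_modelMeasure μ hH hH01 bu, hu0, zero_mul]
      · simp
    simp [this]
  have hIL : ∀ α : Fin k ↪ Fin n, ∫ ω, edgeProd H p (copyEdges G α) ω * ∑ i, u (ω.1 i)
      ∂(modelMeasure μ n) = p ^ G.edgeFinset.card * v := by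
    intro α
    simp_rw [Finset.mul_sum]
    rw [integral_finsetSum _ fun i _ => ((edgeProd_bddMeasurable hH).mul (bui i)).integrable _,
      ← Finset.sum_subset (Finset.subset_univ (univ.map α)), Finset.sum_map, ← hsu, Finset.mul_sum]
    · refine Finset.sum_congr rfl fun ℓ _ => ?_
      rw [← integral_edgeFun_mul μ hH hH01 ℓ bu]
      exact integral_copy_mul μ hH hH01 hHsym hp0 hp1 α
        (bu.comp_measurable (measurable_pi_apply ℓ))
    · intro i _ hi
      rw [LocallyOn.integral_mul μ (by simpa using hi) (edgeProd_locallyOn (copyEdges_subset α))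
        (lui i) (edgeProd_bddMeasurable hH) (bui i), integral_eval_modelMeasure μ hH hH01 bu, hu0,
        mul_zero]
  have hSL : ∫ ω, copyCount G n H p ω * ∑ i, u (ω.1 i) ∂(modelMeasure μ n)
      = Fintype.card (Fin k ↪ Fin n) * p ^ G.edgeFinset.card * v := by
    unfold copyCount
    simp_rw [Finset.sum_mul]
    rw [integral_finsetSum _ fun α _ => ((edgeProd_bddMeasurable hH).mul bL).integrable _]
    simp_rw [hIL]
    rw [Finset.sum_const, nsmul_eq_mul, Finset.card_univ, mul_assoc]
  have hn0 : (0 : ℝ) < n := by exact_mod_cast hn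
  have := sq_div_le_variance (modelMeasure μ n) (copyCount_bddMeasurable (G := G) (n := n) (p := p)
    hH) bL hL0 hLL (by positivity)
  rw [hSL] at this
  refine le_trans (le_of_eq ?_) this
  field_simp

lemma integral_edgeFun_pos (hH : Measurable fun z : E × E => H z.1 z.2)
    (hH01 : ∀ x y, H x y ∈ Set.Icc (0 : ℝ) 1)
    (hv : 0 < variance (fun t => ∑ ℓ, edgeProj G H μ ℓ t) μ) :
    0 < ∫ z, edgeFun G H z ∂(Measure.pi fun _ => μ) := by
  refine lt_of_le_of_ne (integral_nonneg fun z => (edgeFun_mem hH01 z).1) fun h0 => hv.ne' ?_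
  have hae : ∀ ℓ, edgeProj G H μ ℓ =ᵐ[μ] 0 := by
    intro ℓ
    have h := integral_edgeFun_mul (G := G) μ hH hH01 ℓ (BddMeasurable.const 1)
    simp only [mul_one] at h
    rw [← h0] at h
    exact (integral_eq_zero_iff_of_nonneg (fun t => edgeProj_nonneg μ hH01 ℓ t)
      ((edgeProj_bddMeasurable μ hH hH01 ℓ).integrable μ)).1 h.symm
  have : (fun t => ∑ ℓ, edgeProj G H μ ℓ t) =ᵐ[μ] 0 := by
    filter_upwards [ae_all_iff.2 hae] with t ht
    exact Finset.sum_eq_zero fun ℓ _ => ht ℓ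
  rw [variance_congr this, variance_zero]

lemma variance_ge_of_mean (hk : 1 ≤ k) (hH : Measurable fun z : E × E => H z.1 z.2)
    (hH01 : ∀ x y, H x y ∈ Set.Icc (0 : ℝ) 1) (hHsym : ∀ x y, H x y = H y x)
    (hp0 : 0 ≤ p) (hp1 : p ≤ 1) (hn : 0 < n) :
    (Fintype.card (Fin k ↪ Fin n) : ℝ) *
        (p ^ G.edgeFinset.card * ∫ z, edgeFun G H z ∂(Measure.pi fun _ => μ))
      - (n : ℝ) ^ k * ((n : ℝ) ^ (k - 1) * ((k : ℝ) + 1) ^ k) * (p ^ G.edgeFinset.card) ^ 2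
      ≤ variance (copyCount G n H p) (modelMeasure μ n) := by
  rw [variance_copyCount μ hH]
  set θ := ∫ z, edgeFun G H z ∂(Measure.pi fun _ => μ) with hθ
  set q := p ^ G.edgeFinset.card with hq
  have hq0 : 0 ≤ q := pow_nonneg hp0 _
  have hθ0 : 0 ≤ θ := integral_nonneg fun z => (edgeFun_mem hH01 z).1
  have hθ1 : θ ≤ 1 := by
    have : θ ≤ ∫ _z, (1 : ℝ) ∂(Measure.pi fun _ : Fin k => μ) :=
      integral_mono ((edgeFun_bddMeasurable hH hH01).integrable _) (integrable_const _)
        fun z => (edgeFun_mem hH01 z).2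
    simpa using this
  have hcov : ∀ α β : Fin k ↪ Fin n, (if α = β then q * θ else 0) - q ^ 2 ≤
      ∫ ω, centredEdgeProd μ H p (copyEdges G α) ω * centredEdgeProd μ H p (copyEdges G β) ω
        ∂(modelMeasure μ n) := by
    intro α β
    have e : ∀ ω, centredEdgeProd μ H p (copyEdges G α) ω * centredEdgeProd μ H p (copyEdges G β) ω
        = edgeProd H p (copyEdges G α ∪ copyEdges G β) ω
          - (q * θ) * centredEdgeProd μ H p (copyEdges G β) ω
          - (q * θ) * edgeProd H p (copyEdges G α) ω := by
      intro ω
      rw [← edgeProd_mul]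
      unfold centredEdgeProd
      rw [integral_copy μ hH hH01 hHsym hp0 hp1, integral_copy μ hH hH01 hHsym hp0 hp1]
      ring
    have b1 : BddMeasurable (edgeProd H p (copyEdges G α ∪ copyEdges G β)) :=
      edgeProd_bddMeasurable hH
    have b2 : BddMeasurable fun ω => (q * θ) * centredEdgeProd μ H p (copyEdges G β) ω :=
      (BddMeasurable.const _).mul (centredEdgeProd_bddMeasurable μ hH _)
    have b3 : BddMeasurable fun ω => (q * θ) * edgeProd H p (copyEdges G α) ω :=
      (BddMeasurable.const _).mul (edgeProd_bddMeasurable hH)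
    simp_rw [e]
    rw [integral_sub ((b1.sub b2).integrable _) (b3.integrable _),
      integral_sub (b1.integrable _) (b2.integrable _), integral_const_mul, integral_const_mul,
      integral_centredEdgeProd μ hH, integral_copy μ hH hH01 hHsym hp0 hp1]
    have h2 : q * θ * (q * θ) ≤ q ^ 2 := by
      have : q * θ ≤ q := mul_le_of_le_one_right hq0 hθ1
      nlinarith [mul_nonneg hq0 hθ0]
    have h1 : (if α = β then q * θ else 0) ≤
        ∫ ω, edgeProd H p (copyEdges G α ∪ copyEdges G β) ω ∂(modelMeasure μ n) := by
      split_ifs with h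
      · subst h
        rw [Finset.union_self, integral_copy μ hH hH01 hHsym hp0 hp1]
      · exact integral_nonneg fun ω => edgeProd_nonneg ω
    linarith
  have hrow : ∀ α : Fin k ↪ Fin n, q * θ - (n : ℝ) ^ (k - 1) * ((k : ℝ) + 1) ^ k * q ^ 2 ≤
      ∑ β ∈ univ.filter (fun β => Overlap (univ.map α) β),
        ∫ ω, centredEdgeProd μ H p (copyEdges G α) ω * centredEdgeProd μ H p (copyEdges G β) ω
          ∂(modelMeasure μ n) := by
    intro α
    refine le_trans ?_ (Finset.sum_le_sum fun β _ => hcov α β)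
    rw [Finset.sum_sub_distrib, Finset.sum_const, nsmul_eq_mul, Finset.sum_ite_eq, if_pos]
    · have := card_overlap_le hk hn (univ.map α)
      rw [card_map_placement] at this
      have := mul_le_mul_of_nonneg_right this (sq_nonneg q)
      linarith
    · rw [Finset.mem_filter]
      exact ⟨Finset.mem_univ _, ⟨⟨0, hk⟩, by simp⟩⟩
  have h := Finset.sum_le_sum fun (α : Fin k ↪ Fin n) (_ : α ∈ univ) => hrow α
  refine le_trans ?_ h
  rw [Finset.sum_const, nsmul_eq_mul, Finset.card_univ, mul_sub]
  have := mul_le_mul_of_nonneg_right (card_placements_le (k := k) (n := n))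
    (by positivity : 0 ≤ (n : ℝ) ^ (k - 1) * ((k : ℝ) + 1) ^ k * q ^ 2)
  linarith

end EdgeFunction

/-- The standardized number of labelled copies of `G` on the canonical space. -/
noncomputable def standardizedCopyCount {E : Type*} [MeasurableSpace E] {k : ℕ}
    (G : SimpleGraph (Fin k)) [DecidableRel G.Adj] (n : ℕ) (μ : Measure E) (H : E → E → ℝ) (p : ℝ)
    (ω : (Fin n → E) × (IndexPair n → ℝ)) : ℝ :=
  (copyCount G n H p ω - ∫ ω', copyCount G n H p ω' ∂(modelMeasure μ n)) /
    √(variance (copyCount G n H p) (modelMeasure μ n))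

lemma standardizedCopyCount_bddMeasurable {E : Type*} [MeasurableSpace E] {k : ℕ}
    {G : SimpleGraph (Fin k)} [DecidableRel G.Adj] {n : ℕ} (μ : Measure E) {H : E → E → ℝ} {p : ℝ}
    (hH : Measurable fun z : E × E => H z.1 z.2) :
    BddMeasurable (standardizedCopyCount G n μ H p) := by
  unfold standardizedCopyCount
  simp_rw [div_eq_mul_inv]
  exact ((copyCount_bddMeasurable hH).sub (BddMeasurable.const _)).mul (BddMeasurable.const _)

lemma stein_rate_le {n k : ℕ} (hn : 0 < n) (hk : 1 ≤ k) {q T c V : ℝ} (hq : 0 < q) (hT : 0 < T)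
    (hc : 0 < c) (hV : c * ((n : ℝ) ^ k * (n : ℝ) ^ (k - 1) * q ^ 2 * T) ≤ V) :
    (n : ℝ) ^ k * (n : ℝ) ^ (k - 1) * (n : ℝ) ^ (k - 1) * q ^ 3 * T ^ 2 / √V ^ 3
      ≤ √(T / n) / √c ^ 3 := by
  have hn0 : (0 : ℝ) < n := by exact_mod_cast hn
  set r := √(T / n) with hr
  have hr0 : 0 < r := Real.sqrt_pos.2 (by positivity)
  have hrT : T = r ^ 2 * n := by
    rw [hr, Real.sq_sqrt (by positivity)]
    field_simp
  have hnk : (n : ℝ) ^ (k - 1) * n = (n : ℝ) ^ k := pow_sub_one_mul (by omega) _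
  have hsc : 0 < √c := Real.sqrt_pos.2 hc
  have hs : √c * ((n : ℝ) ^ k * r * q) ≤ √V := by
    refine Real.le_sqrt_of_sq_le (le_trans (le_of_eq ?_) hV)
    rw [mul_pow, Real.sq_sqrt hc.le, hrT]
    calc c * ((n : ℝ) ^ k * r * q) ^ 2 = c * ((n : ℝ) ^ k * (n : ℝ) ^ k * q ^ 2 * r ^ 2) := by ring
      _ = c * ((n : ℝ) ^ k * ((n : ℝ) ^ (k - 1) * n) * q ^ 2 * r ^ 2) := by rw [hnk]
      _ = _ := by ring
  have hnum : (n : ℝ) ^ k * (n : ℝ) ^ (k - 1) * (n : ℝ) ^ (k - 1) * q ^ 3 * T ^ 2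
      = ((n : ℝ) ^ k) ^ 3 * q ^ 3 * r ^ 4 := by
    rw [hrT]
    calc _ = (n : ℝ) ^ k * ((n : ℝ) ^ (k - 1) * n) * ((n : ℝ) ^ (k - 1) * n) * q ^ 3 * r ^ 4 := by
          ring
      _ = _ := by rw [hnk]; ring
  rw [hnum]
  calc _ ≤ ((n : ℝ) ^ k) ^ 3 * q ^ 3 * r ^ 4 / (√c * ((n : ℝ) ^ k * r * q)) ^ 3 := by gcongr
    _ = _ := by field_simp

lemma abs_measureReal_sub_measureReal_le_one {Ω Ω' : Type*} [MeasurableSpace Ω]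
    [MeasurableSpace Ω'] (P : Measure Ω) (Q : Measure Ω') [IsProbabilityMeasure P]
    [IsProbabilityMeasure Q] (s : Set Ω) (t : Set Ω') : |P.real s - Q.real t| ≤ 1 := by
  rw [abs_le]
  constructor <;> linarith [measureReal_nonneg (μ := P) (s := s), measureReal_le_one (μ := P) (s := s),
    measureReal_nonneg (μ := Q) (s := t), measureReal_le_one (μ := Q) (s := t)]

lemma exists_kolmogorov_constant {k : ℕ} (hk : 2 ≤ k) {c : ℝ} (hc : 0 < c) :
    ∃ C > (0 : ℝ), ∀ (E : Type) [MeasurableSpace E] (μ : Measure E) [IsProbabilityMeasure μ]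
      (G : SimpleGraph (Fin k)) [DecidableRel G.Adj] (_ : StronglyBalanced G) (H : E → E → ℝ)
      (_ : Measurable fun z : E × E => H z.1 z.2) (_ : ∀ x y, H x y ∈ Set.Icc (0 : ℝ) 1)
      (n : ℕ) (_ : 0 < n) (p T : ℝ) (_ : 0 < p) (_ : p ≤ 1) (_ : 0 < T)
      (_ : ∀ j < k, 1 ≤ T * ((n : ℝ) * p ^ ((G.edgeFinset.card : ℝ) / ((k : ℝ) - 1))) ^ j)
      (_ : c * ((n : ℝ) ^ k * (n : ℝ) ^ (k - 1) * (p ^ G.edgeFinset.card) ^ 2 * T)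
        ≤ variance (copyCount G n H p) (modelMeasure μ n)) (x : ℝ),
      |(modelMeasure μ n).real {ω | standardizedCopyCount G n μ H p ω ≤ x}
          - (gaussianReal 0 1).real (Set.Iic x)| ≤ C * (T / n) ^ ((1 : ℝ) / (2 + 4 * (k : ℝ))) := by
  obtain ⟨K, hK, hsmooth⟩ := exists_smoothing_constant
  set A : ℝ := 24 * ((k : ℝ) + 1) ^ k * (2 * (k : ℝ) + 1) ^ k with hA
  have hsc : 0 < √c := Real.sqrt_pos.2 hc
  refine ⟨1 + K * (A / √c ^ 3), by positivity, ?_⟩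
  intro E _ μ _ G _ hbal H hH hH01 n hn p T hp0 hp1 hT0 hT hV x
  have hn0 : (0 : ℝ) < n := by exact_mod_cast hn
  have hb0 : 0 < T / n := by positivity
  set δ := (T / n) ^ ((1 : ℝ) / (2 + 4 * (k : ℝ))) with hδ
  have hδ0 : 0 < δ := Real.rpow_pos_of_pos hb0 _
  rcases le_total (T / n) 1 with hb1 | hb1
  · have hδ1 : δ ≤ 1 := Real.rpow_le_one hb0.le hb1 (by positivity)
    have hVpos : 0 < variance (copyCount G n H p) (modelMeasure μ n) :=
      lt_of_lt_of_le (by positivity) hV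
    obtain ⟨hWm, B, hB⟩ := standardizedCopyCount_bddMeasurable (G := G) (n := n) (p := p) μ hH
    have h := hsmooth _ (modelMeasure μ n) _ hWm B hB _ (stein_copyCount μ hk hbal hH hH01 hp0 hp1
      hT0.le hn hT hVpos) δ hδ0 hδ1 x
    rw [← hA] at h
    have hr : √(T / n) ≤ δ ^ 4 := by
      have e : √(T / n) = δ ^ (1 + 2 * k) := by
        rw [hδ, ← Real.rpow_natCast, ← Real.rpow_mul hb0.le, Real.sqrt_eq_rpow]
        congr 1
        push_cast
        field_simp
        ring
      rw [e]
      exact pow_le_pow_of_le_one hδ0.le hδ1 (by omega)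
    have hrate := (stein_rate_le hn (by omega : 1 ≤ k) (by positivity : 0 < p ^ G.edgeFinset.card)
      hT0 hc hV).trans (div_le_div_of_nonneg_right hr (by positivity))
    refine h.trans ?_
    have h1 : K * (A * (δ ^ 4 / √c ^ 3)) / δ ^ 3 = K * (A / √c ^ 3) * δ := by
      field_simp
    have hA0 : 0 ≤ A := by positivity
    calc _ ≤ δ + K * (A * (δ ^ 4 / √c ^ 3)) / δ ^ 3 := by gcongr
      _ = _ := by rw [h1]; ring
  · have hδ1 : 1 ≤ δ := Real.one_le_rpow hb1 (by positivity)
    refine (abs_measureReal_sub_measureReal_le_one _ _ _ _).trans ?_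
    have : 0 ≤ K * (A / √c ^ 3) := by positivity
    nlinarith

lemma gaussCdf_eq (x : ℝ) : gaussCdf x = (gaussianReal 0 1).real (Set.Iic x) := by
  rw [measureReal_def, gaussianReal_apply_eq_integral 0 one_ne_zero,
    ENNReal.toReal_ofReal (integral_nonneg fun t => gaussianPDFReal_nonneg _ _ _)]
  unfold gaussCdf
  rw [← integral_const_mul]
  congr 1
  ext t
  rw [gaussianPDFReal]
  simp

lemma autCard_pos {k : ℕ} (G : SimpleGraph (Fin k)) : 0 < autCard G := by
  have : Finite (G ≃g G) := Finite.of_injective (fun f : G ≃g G => (f : Fin k → Fin k))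
    DFunLike.coe_injective
  have : Nonempty (G ≃g G) := ⟨SimpleGraph.Iso.refl⟩
  exact Nat.card_pos

section Transfer

variable {d k n : ℕ} {Ω : Type*} {G : SimpleGraph (Fin k)} [DecidableRel G.Adj]
  {H : (Fin d → ℝ) → (Fin d → ℝ) → ℝ} {p : ℝ} {aG : ℕ}
  {X : Fin n → Ω → (Fin d → ℝ)} {Y : Fin n → Fin n → Ω → ℝ}

variable (X Y) in
/-- The canonical coordinates of a realization of the random-connection model. -/
def modelMap (ω : Ω) : (Fin n → (Fin d → ℝ)) × (IndexPair n → ℝ) :=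
  (fun i => X i ω, fun q => Y q.1.1 q.1.2 ω)

lemma NG_eq_copyCount (hYsym : ∀ a b, Y a b = Y b a) (hHsym : ∀ x y, H x y = H y x) (ω : Ω) :
    NG G H p aG X Y ω = (aG : ℝ)⁻¹ * copyCount G n H p (modelMap X Y ω) := by
  unfold NG copyCount
  congr 1
  have e : (univ : Finset (Fin k → Fin n)).filter Function.Injective
      = univ.map ⟨fun α : Fin k ↪ Fin n => (α : Fin k → Fin n), DFunLike.coe_injective⟩ := by
    ext β
    simp only [Finset.mem_filter, Finset.mem_univ, true_and, Finset.mem_map,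
      Function.Embedding.coeFn_mk]
    exact ⟨fun h => ⟨⟨β, h⟩, rfl⟩, by rintro ⟨α, rfl⟩; exact α.injective⟩
  rw [e, Finset.sum_map]
  refine Finset.sum_congr rfl fun α _ => ?_
  exact prod_orderedEdges α
    (fun a b => if Y a b ω ≤ p * H (X a ω) (X b ω) then (1 : ℝ) else 0)
    fun a b => by simp only [hYsym a b, hHsym (X a ω) (X b ω)]

lemma variance_edgeProj_pos {μ : Measure (Fin d → ℝ)}
    (hA : 0 < variance (fun x => ∑ ℓ : Fin k, fSub G H μ p aG ℓ x) μ) :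
    0 < variance (fun t => ∑ ℓ, edgeProj G H μ ℓ t) μ := by
  have e : (fun x => ∑ ℓ : Fin k, fSub G H μ p aG ℓ x)
      = fun x => (p ^ G.edgeFinset.card / (aG : ℝ)) * ∑ ℓ, edgeProj G H μ ℓ x := by
    ext x
    rw [Finset.mul_sum]
    rfl
  rw [e, variance_const_mul] at hA
  exact pos_of_mul_pos_right hA (sq_nonneg _)

variable [MeasurableSpace Ω] {P : Measure Ω} {μ : Measure (Fin d → ℝ)} [IsProbabilityMeasure μ]

lemma aemeasurable_modelMap (hlaw : Measure.map (modelMap X Y) P = modelMeasure μ n) :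
    AEMeasurable (modelMap X Y) P := by
  by_contra h
  rw [Measure.map_of_not_aemeasurable h] at hlaw
  exact IsProbabilityMeasure.ne_zero (modelMeasure μ n) hlaw.symm

lemma NGbar_eq_standardizedCopyCount (haG : 0 < aG)
    (hlaw : Measure.map (modelMap X Y) P = modelMeasure μ n)
    (hYsym : ∀ a b, Y a b = Y b a) (hHsym : ∀ x y, H x y = H y x)
    (hH : Measurable fun z : (Fin d → ℝ) × (Fin d → ℝ) => H z.1 z.2) (ω : Ω) :
    NGbar P G H p aG X Y ω = standardizedCopyCount G n μ H p (modelMap X Y ω) := by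
  have hm := aemeasurable_modelMap hlaw
  have hS := (copyCount_bddMeasurable (G := G) (n := n) (p := p) hH).1
  have ha : (0 : ℝ) < (aG : ℝ)⁻¹ := by positivity
  have hfun : NG G H p aG X Y = fun ω => (aG : ℝ)⁻¹ * copyCount G n H p (modelMap X Y ω) :=
    funext (NG_eq_copyCount hYsym hHsym)
  have h1 : ∫ ω', NG G H p aG X Y ω' ∂P
      = (aG : ℝ)⁻¹ * ∫ z, copyCount G n H p z ∂(modelMeasure μ n) := by
    rw [hfun, integral_const_mul, ← hlaw, integral_map hm hS.aestronglyMeasurable]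
  have h2 : variance (NG G H p aG X Y) P
      = ((aG : ℝ)⁻¹) ^ 2 * variance (copyCount G n H p) (modelMeasure μ n) := by
    rw [hfun, variance_const_mul, ← hlaw, variance_map hS.aemeasurable hm]
    rfl
  unfold NGbar standardizedCopyCount
  rw [h1, h2, Real.sqrt_mul (sq_nonneg _), Real.sqrt_sq ha.le, NG_eq_copyCount hYsym hHsym,
    ← mul_sub, mul_div_mul_left _ _ ha.ne']

lemma measure_NGbar_le (haG : 0 < aG)
    (hlaw : Measure.map (modelMap X Y) P = modelMeasure μ n)
    (hYsym : ∀ a b, Y a b = Y b a) (hHsym : ∀ x y, H x y = H y x)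
    (hH : Measurable fun z : (Fin d → ℝ) × (Fin d → ℝ) => H z.1 z.2) (x : ℝ) :
    (P {ω | NGbar P G H p aG X Y ω ≤ x}).toReal
      = (modelMeasure μ n).real {z | standardizedCopyCount G n μ H p z ≤ x} := by
  rw [measureReal_def, ← hlaw, Measure.map_apply_of_aemeasurable (aemeasurable_modelMap hlaw)
    (measurableSet_le (standardizedCopyCount_bddMeasurable μ hH).1 measurable_const)]
  simp_rw [NGbar_eq_standardizedCopyCount haG hlaw hYsym hHsym hH]
  rfl

end Transfer

section Rates

variable {E : Type*} [MeasurableSpace E] {k n : ℕ} {G : SimpleGraph (Fin k)} [DecidableRel G.Adj]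
  {H : E → E → ℝ} {p : ℝ} (μ : Measure E) [IsProbabilityMeasure μ]

lemma variance_ge_dense (hk : 1 ≤ k) (hH : Measurable fun z : E × E => H z.1 z.2)
    (hH01 : ∀ x y, H x y ∈ Set.Icc (0 : ℝ) 1) (hHsym : ∀ x y, H x y = H y x)
    (hp0 : 0 ≤ p) (hp1 : p ≤ 1) (hn : 0 < n) (hnk : 2 * k ≤ n)
    (hv : 0 < variance (fun t => ∑ ℓ, edgeProj G H μ ℓ t) μ) :
    variance (fun t => ∑ ℓ, edgeProj G H μ ℓ t) μ * ((1 / 2 : ℝ) ^ k) ^ 2 *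
        ((n : ℝ) ^ k * (n : ℝ) ^ (k - 1) * (p ^ G.edgeFinset.card) ^ 2 * 1)
      ≤ variance (copyCount G n H p) (modelMeasure μ n) := by
  have hn0 : (0 : ℝ) < n := by exact_mod_cast hn
  refine le_trans ?_ (variance_ge_of_proj μ hH hH01 hHsym hp0 hp1 hn hv)
  set v := variance (fun t => ∑ ℓ, edgeProj G H μ ℓ t) μ
  have hN := card_placements_ge (k := k) hnk
  have h2 : (n : ℝ) ^ (k - 1) = (n : ℝ) ^ k / n := by
    rw [eq_div_iff hn0.ne', pow_sub_one_mul (by omega)]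
  calc _ = (((n : ℝ) / 2) ^ k * p ^ G.edgeFinset.card) ^ 2 * v / n := by
        rw [h2, div_eq_mul_one_div (n : ℝ) 2, mul_pow (n : ℝ)]
        ring
    _ ≤ _ := by gcongr

lemma variance_ge_sparse (hk : 1 ≤ k) (hH : Measurable fun z : E × E => H z.1 z.2)
    (hH01 : ∀ x y, H x y ∈ Set.Icc (0 : ℝ) 1) (hHsym : ∀ x y, H x y = H y x)
    (hp0 : 0 < p) (hp1 : p ≤ 1) (hn : 0 < n) (hnk : 2 * k ≤ n)
    (hsmall : (n : ℝ) ^ (k - 1) * p ^ G.edgeFinset.card * ((k : ℝ) + 1) ^ k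
      ≤ (1 / 2 : ℝ) ^ k * (∫ z, edgeFun G H z ∂(Measure.pi fun _ => μ)) / 2) :
    (1 / 2 : ℝ) ^ k * (∫ z, edgeFun G H z ∂(Measure.pi fun _ => μ)) / 2 *
        ((n : ℝ) ^ k * (n : ℝ) ^ (k - 1) * (p ^ G.edgeFinset.card) ^ 2 *
          ((n : ℝ) ^ (k - 1) * p ^ G.edgeFinset.card)⁻¹)
      ≤ variance (copyCount G n H p) (modelMeasure μ n) := by
  have hn0 : (0 : ℝ) < n := by exact_mod_cast hn
  refine le_trans ?_ (variance_ge_of_mean (G := G) μ hk hH hH01 hHsym hp0.le hp1 hn)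
  have hθ : 0 ≤ ∫ z, edgeFun G H z ∂(Measure.pi fun _ => μ) :=
    integral_nonneg fun z => (edgeFun_mem hH01 z).1
  set θ := ∫ z, edgeFun G H z ∂(Measure.pi fun _ => μ)
  set q := p ^ G.edgeFinset.card with hq
  have hq0 : 0 < q := by positivity
  have hN := mul_le_mul_of_nonneg_right (card_placements_ge (k := k) hnk)
    (mul_nonneg hq0.le hθ)
  have h1 := mul_le_mul_of_nonneg_left hsmall (by positivity : 0 ≤ (n : ℝ) ^ k * q)
  have e1 : (n : ℝ) ^ k * (n : ℝ) ^ (k - 1) * q ^ 2 * ((n : ℝ) ^ (k - 1) * q)⁻¹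
      = (n : ℝ) ^ k * q := by
    field_simp
  rw [e1]
  rw [div_eq_mul_one_div (n : ℝ) 2, mul_pow] at hN
  linarith

lemma pow_rpow_eq (hk : 2 ≤ k) (hp0 : 0 ≤ p) (e : ℕ) :
    ((n : ℝ) * p ^ ((e : ℝ) / ((k : ℝ) - 1))) ^ (k - 1) = (n : ℝ) ^ (k - 1) * p ^ e := by
  have hk1 : (0 : ℝ) < (k : ℝ) - 1 := by
    have : (2 : ℝ) ≤ k := by exact_mod_cast hk
    linarith
  rw [mul_pow, ← Real.rpow_natCast (p ^ _), ← Real.rpow_mul hp0, ← Real.rpow_natCast p e,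
    Nat.cast_sub (by omega : 1 ≤ k), Nat.cast_one, div_mul_cancel₀ _ hk1.ne']

end Rates

/-- Kolmogorov bounds for the normalized count of a strongly balanced connected graph
under Assumption 1: there exist `C > 0` and `n₀` such that for all `n ≥ n₀`,
`sup_x |P(N̄_G ≤ x) − Φ(x)| ≤ C/n^{1/(2+4v(G))}` when `n^{−(v(G)−1)/e(G)} ≪ p_n`, and
`sup_x |P(N̄_G ≤ x) − Φ(x)| ≤ C/(n^{v(G)} p_n^{e(G)})^{1/(2+4v(G))}` when
`p_n ≪ n^{−(v(G)−1)/e(G)}`. -/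
theorem kolmogorov_bound_subgraph_count
    {d k : ℕ} (hk : 2 ≤ k)
    (G : SimpleGraph (Fin k)) [DecidableRel G.Adj] (hGconn : G.Connected)
    (μ : Measure (Fin d → ℝ)) [IsProbabilityMeasure μ] (hμ : ∀ x, μ {x} = 0)
    (H : (Fin d → ℝ) → (Fin d → ℝ) → ℝ)
    (hHm : Measurable fun z : (Fin d → ℝ) × (Fin d → ℝ) => H z.1 z.2)
    (hHsym : ∀ x y, H x y = H y x) (hH01 : ∀ x y, H x y ∈ Set.Icc (0 : ℝ) 1)
    (p : ℕ → ℝ) (hp : ∀ n, p n ∈ Set.Ioo (0 : ℝ) 1)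
    (Ω : ℕ → Type) [∀ n, MeasurableSpace (Ω n)]
    (P : ∀ n, Measure (Ω n)) [∀ n, IsProbabilityMeasure (P n)]
    (X : ∀ n, Fin n → Ω n → (Fin d → ℝ)) (Y : ∀ n, Fin n → Fin n → Ω n → ℝ)
    (hYsym : ∀ n a b, Y n a b = Y n b a)
    (hlaw : ∀ n, Measure.map (fun ω => ((fun i => X n i ω),
        (fun q : {q : Fin n × Fin n // q.1 < q.2} => Y n q.1.1 q.1.2 ω))) (P n)
      = (Measure.pi fun _ => μ).prod
          (Measure.pi fun _ => (volume.restrict (Set.Icc (0 : ℝ) 1))))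
    (hbal : StronglyBalanced G)
    (hA : ∀ n, 0 < variance
      (fun x => ∑ ℓ : Fin k, fSub G H μ (p n) (autCard G) ℓ x) μ) :
    ∃ C > (0 : ℝ), ∃ n₀ : ℕ,
      (Filter.Tendsto
          (fun n : ℕ => (n : ℝ) * p n ^ ((G.edgeFinset.card : ℝ) / ((k : ℝ) - 1)))
          Filter.atTop Filter.atTop →
        ∀ n, n₀ ≤ n → ∀ x : ℝ,
          |((P n) {ω | NGbar (P n) G H (p n) (autCard G) (X n) (Y n) ω ≤ x}).toReal
              - gaussCdf x|
            ≤ C / (n : ℝ) ^ ((1 : ℝ) / (2 + 4 * (k : ℝ))))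
      ∧ (Filter.Tendsto
          (fun n : ℕ => (n : ℝ) * p n ^ ((G.edgeFinset.card : ℝ) / ((k : ℝ) - 1)))
          Filter.atTop (nhds 0) →
        ∀ n, n₀ ≤ n → ∀ x : ℝ,
          |((P n) {ω | NGbar (P n) G H (p n) (autCard G) (X n) (Y n) ω ≤ x}).toReal
              - gaussCdf x|
            ≤ C / ((n : ℝ) ^ k * p n ^ G.edgeFinset.card)
                ^ ((1 : ℝ) / (2 + 4 * (k : ℝ)))) := by
  have hv := variance_edgeProj_pos (hA 0)
  have hθ := integral_edgeFun_pos μ hHm hH01 hv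
  have hC1 : 0 < variance (fun t => ∑ ℓ, edgeProj G H μ ℓ t) μ * ((1 / 2 : ℝ) ^ k) ^ 2 := by
    positivity
  have hC2 : 0 < (1 / 2 : ℝ) ^ k * (∫ z, edgeFun G H z ∂(Measure.pi fun _ => μ)) / 2 := by
    positivity
  obtain ⟨C1, hC1pos, hbound1⟩ := exists_kolmogorov_constant hk hC1
  obtain ⟨C2, hC2pos, hbound2⟩ := exists_kolmogorov_constant hk hC2
  have htr : ∀ n x, ((P n) {ω | NGbar (P n) G H (p n) (autCard G) (X n) (Y n) ω ≤ x}).toReal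
      = (modelMeasure μ n).real {z | standardizedCopyCount G n μ H (p n) z ≤ x} := fun n x =>
    measure_NGbar_le (autCard_pos G) (hlaw n) (hYsym n) hHsym hHm x
  simp_rw [htr, gaussCdf_eq]
  set r : ℕ → ℝ := fun n => (n : ℝ) * p n ^ ((G.edgeFinset.card : ℝ) / ((k : ℝ) - 1)) with hr
  have hdense : ∃ n₁ : ℕ, Filter.Tendsto r Filter.atTop Filter.atTop → ∀ n, n₁ ≤ n → ∀ x : ℝ,
      |(modelMeasure μ n).real {z | standardizedCopyCount G n μ H (p n) z ≤ x}
        - (gaussianReal 0 1).real (Set.Iic x)| ≤ C1 / (n : ℝ) ^ ((1 : ℝ) / (2 + 4 * (k : ℝ))) := by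
    by_cases ht : Filter.Tendsto r Filter.atTop Filter.atTop
    · obtain ⟨n₁, hn₁⟩ := Filter.eventually_atTop.1
        ((ht.eventually_ge_atTop 1).and (Filter.eventually_ge_atTop (2 * k)))
      refine ⟨n₁, fun _ n hn x => ?_⟩
      obtain ⟨h1, h2⟩ := hn₁ n hn
      have h := hbound1 _ μ G hbal H hHm hH01 n (by omega) (p n) 1 (hp n).1 (hp n).2.le one_pos
        (fun j _ => by rw [one_mul]; exact one_le_pow₀ h1)
        (variance_ge_dense μ (by omega) hHm hH01 hHsym (hp n).1.le (hp n).2.le (by omega) h2 hv) x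
      rwa [one_div, Real.inv_rpow (Nat.cast_nonneg n), ← div_eq_mul_inv] at h
    · exact ⟨0, fun h => absurd h ht⟩
  have hsparse : ∃ n₂ : ℕ, Filter.Tendsto r Filter.atTop (nhds 0) → ∀ n, n₂ ≤ n → ∀ x : ℝ,
      |(modelMeasure μ n).real {z | standardizedCopyCount G n μ H (p n) z ≤ x}
        - (gaussianReal 0 1).real (Set.Iic x)| ≤ C2 / ((n : ℝ) ^ k * p n ^ G.edgeFinset.card)
                ^ ((1 : ℝ) / (2 + 4 * (k : ℝ))) := by
    by_cases ht : Filter.Tendsto r Filter.atTop (nhds 0)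
    · have ht' : Filter.Tendsto (fun n => r n ^ (k - 1) * ((k : ℝ) + 1) ^ k) Filter.atTop
          (nhds 0) := by
        have := (ht.pow (k - 1)).mul_const (((k : ℝ) + 1) ^ k)
        rwa [zero_pow (by omega), zero_mul] at this
      obtain ⟨n₂, hn₂⟩ := Filter.eventually_atTop.1
        (((ht.eventually_le_const one_pos).and (ht'.eventually_le_const hC2)).and
          (Filter.eventually_ge_atTop (2 * k)))
      refine ⟨n₂, fun _ n hn x => ?_⟩
      obtain ⟨⟨h1, h3⟩, h2⟩ := hn₂ n hn
      have hn0 : (0 : ℝ) < n := by exact_mod_cast (by omega : 0 < n)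
      have hp0 := (hp n).1
      have hpow : r n ^ (k - 1) = (n : ℝ) ^ (k - 1) * p n ^ G.edgeFinset.card :=
        pow_rpow_eq hk hp0.le _
      have hr0 : 0 < r n := by positivity
      rw [hpow] at h3
      have h := hbound2 _ μ G hbal H hHm hH01 n (by omega) (p n)
        ((n : ℝ) ^ (k - 1) * p n ^ G.edgeFinset.card)⁻¹ hp0 (hp n).2.le (by positivity)
        (fun j hj => by
          rw [← hpow, ← div_eq_inv_mul, one_le_div (by positivity)]
          exact pow_le_pow_of_le_one hr0.le h1 (by omega))
        (variance_ge_sparse μ (by omega) hHm hH01 hHsym hp0 (hp n).2.le (by omega) h2 h3) x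
      have e : ((n : ℝ) ^ (k - 1) * p n ^ G.edgeFinset.card)⁻¹ / n
          = ((n : ℝ) ^ k * p n ^ G.edgeFinset.card)⁻¹ := by
        rw [← pow_sub_one_mul (by omega : k ≠ 0) (n : ℝ), div_eq_mul_inv, ← mul_inv]
        congr 1
        ring
      rwa [e, Real.inv_rpow (by positivity), ← div_eq_mul_inv] at h
    · exact ⟨0, fun h => absurd h ht⟩
  obtain ⟨n₁, hn₁⟩ := hdense
  obtain ⟨n₂, hn₂⟩ := hsparse
  refine ⟨max C1 C2, lt_max_of_lt_left hC1pos, max n₁ n₂, fun ht n hn x => ?_,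
    fun ht n hn x => ?_⟩
  · refine (hn₁ ht n ((le_max_left _ _).trans hn) x).trans ?_
    gcongr
    exact le_max_left _ _
  · have hp0 := (hp n).1.le
    refine (hn₂ ht n ((le_max_right _ _).trans hn) x).trans ?_
    gcongr
    exact le_max_right _ _
end

section
/- Let G be a strongly balanced connected graph with v(G) ≥ 2 vertices and e(G) edges, and suppose Assumption 1 holds for the subgraph count N_G. Then: (a) if p_n ≪ n^{−v(G)/e(G)}, then lim_{n→∞} P(N_G = 0) = 1; (b) if p_n ≫ n^{−v(G)/e(G)}, then lim_{n→∞} P(N_G = 0) = 0. -/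
open MeasureTheory Finset ProbabilityTheory

section GraphWeight

variable {V W E : Type*} {H : E → E → ℝ}

/-- The product of the connection function over the edges of a graph with located vertices. -/
noncomputable def graphWeight (H : E → E → ℝ) (hsym : ∀ x y, H x y = H y x)
    (K : SimpleGraph V) [Fintype K.edgeSet] (x : V → E) : ℝ :=
  ∏ e ∈ K.edgeFinset, Sym2.lift ⟨fun a b => H (x a) (x b), fun _ _ => hsym _ _⟩ e

theorem prod_ordered_edges [Fintype V] [LinearOrder V] (K : SimpleGraph V) [DecidableRel K.Adj]
    [Fintype K.edgeSet] (c : V → V → ℝ) (hc : ∀ a b, c a b = c b a) :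
    ∏ q ∈ (Finset.univ : Finset (V × V)).filter (fun q => q.1 < q.2 ∧ K.Adj q.1 q.2), c q.1 q.2
      = ∏ e ∈ K.edgeFinset, Sym2.lift ⟨c, hc⟩ e := by
  refine Finset.prod_bij (fun q _ => s(q.1, q.2)) ?_ ?_ ?_ ?_
  · intro q hq
    simpa using (Finset.mem_filter.1 hq).2.2
  · rintro ⟨a, b⟩ h₁ ⟨a', b'⟩ h₂ h
    simp only [Finset.mem_filter, Finset.mem_univ, true_and] at h₁ h₂
    rcases Sym2.eq_iff.1 h with ⟨rfl, rfl⟩ | ⟨rfl, rfl⟩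
    · rfl
    · exact absurd h₁.1 h₂.1.not_gt
  · intro e he
    induction e with
    | _ a b =>
      have hab : K.Adj a b := by simpa using he
      rcases lt_or_gt_of_ne hab.ne with h | h
      · exact ⟨(a, b), by simp [h, hab], rfl⟩
      · exact ⟨(b, a), by simp [h, hab.symm], Sym2.eq_swap⟩
  · intro q _
    simp

theorem edgeFinset_map_embedding (K : SimpleGraph V) [Fintype K.edgeSet] (f : V ↪ W)
    [Fintype (K.map f).edgeSet] : (K.map f).edgeFinset = K.edgeFinset.map f.sym2Map := by
  ext e
  simp [SimpleGraph.edgeSet_map]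

theorem card_edgeFinset_map_embedding (K : SimpleGraph V) [Fintype K.edgeSet] (f : V ↪ W)
    [Fintype (K.map f).edgeSet] : (K.map f).edgeFinset.card = K.edgeFinset.card := by
  rw [edgeFinset_map_embedding, Finset.card_map]

theorem graphWeight_map [Fintype V] (hsym : ∀ x y, H x y = H y x) (K : SimpleGraph V)
    [Fintype K.edgeSet] (f : V ↪ W) [Fintype (K.map f).edgeSet] (x : W → E) :
    graphWeight H hsym (K.map f) x = graphWeight H hsym K (x ∘ f) := by
  rw [graphWeight, graphWeight, edgeFinset_map_embedding, Finset.prod_map]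
  refine Finset.prod_congr rfl fun e _ => ?_
  induction e with
  | _ a b => rfl

theorem graphWeight_sup (hsym : ∀ x y, H x y = H y x) {K L : SimpleGraph V}
    [Fintype K.edgeSet] [Fintype L.edgeSet] [Fintype (K ⊔ L).edgeSet] (hKL : Disjoint K L)
    (x : V → E) :
    graphWeight H hsym (K ⊔ L) x = graphWeight H hsym K x * graphWeight H hsym L x := by
  classical
  rw [graphWeight, SimpleGraph.edgeFinset_sup,
    Finset.prod_union (SimpleGraph.disjoint_edgeFinset.2 hKL)]
  rfl

theorem graphWeight_nonneg (hsym : ∀ x y, H x y = H y x) (h01 : ∀ x y, H x y ∈ Set.Icc (0 : ℝ) 1)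
    (K : SimpleGraph V) [Fintype K.edgeSet] (x : V → E) : 0 ≤ graphWeight H hsym K x := by
  refine Finset.prod_nonneg fun e _ => ?_
  induction e with
  | _ a b => exact (h01 _ _).1

theorem graphWeight_le_one (hsym : ∀ x y, H x y = H y x) (h01 : ∀ x y, H x y ∈ Set.Icc (0 : ℝ) 1)
    (K : SimpleGraph V) [Fintype K.edgeSet] (x : V → E) : graphWeight H hsym K x ≤ 1 := by
  refine Finset.prod_le_one (fun e _ => ?_) fun e _ => ?_ <;> induction e with
  | _ a b => first | exact (h01 _ _).1 | exact (h01 _ _).2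

/-- The event that all edges of `K` are present. -/
def edgesPresent [LinearOrder V] (H : E → E → ℝ) (p : ℝ) (K : SimpleGraph V) :
    Set ((V → E) × ({q : V × V // q.1 < q.2} → ℝ)) :=
  {z | ∀ q, K.Adj q.1.1 q.1.2 → z.2 q ≤ p * H (z.1 q.1.1) (z.1 q.1.2)}

theorem edgesPresent_sup [LinearOrder V] (p : ℝ) (K L : SimpleGraph V) :
    edgesPresent H p (K ⊔ L) = edgesPresent H p K ∩ edgesPresent H p L := by
  ext z
  simp only [edgesPresent, SimpleGraph.sup_adj, Set.mem_ofPred_eq, Set.mem_inter_iff]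
  grind

variable [MeasurableSpace E]

theorem measurable_graphWeight (hm : Measurable fun z : E × E => H z.1 z.2)
    (hsym : ∀ x y, H x y = H y x) (K : SimpleGraph V) [Fintype K.edgeSet] :
    Measurable (graphWeight H hsym K) := by
  refine Finset.measurable_prod _ fun e _ => ?_
  induction e with
  | _ a b =>
    have h : Measurable fun x : V → E => (x a, x b) := by fun_prop
    exact hm.comp h

theorem integrable_graphWeight (hm : Measurable fun z : E × E => H z.1 z.2)
    (hsym : ∀ x y, H x y = H y x) (h01 : ∀ x y, H x y ∈ Set.Icc (0 : ℝ) 1)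
    (K : SimpleGraph V) [Fintype K.edgeSet] (ν : Measure (V → E)) [IsFiniteMeasure ν] :
    Integrable (graphWeight H hsym K) ν := by
  refine Integrable.of_bound (measurable_graphWeight hm hsym K).aestronglyMeasurable 1 ?_
  refine Filter.Eventually.of_forall fun x => ?_
  rw [Real.norm_of_nonneg (graphWeight_nonneg hsym h01 K x)]
  exact graphWeight_le_one hsym h01 K x

theorem measurePreserving_precomp [Fintype V] [Fintype W] (μ : Measure E) [IsProbabilityMeasure μ]
    {f : V → W} (hf : Function.Injective f) :
    MeasurePreserving (fun x : W → E => fun v => x (f v))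
      (Measure.pi fun _ => μ) (Measure.pi fun _ => μ) := by
  refine ⟨by fun_prop, ?_⟩
  have h : iIndepFun (fun (w : W) (x : W → E) => x w) (Measure.pi fun _ => μ) :=
    iIndepFun_pi (X := fun _ => id) fun _ => aemeasurable_id
  rw [(iIndepFun_iff_map_fun_eq_pi_map fun v => (measurable_pi_apply (f v)).aemeasurable).1
    (h.precomp hf)]
  congr 1
  ext1 v
  exact (measurePreserving_eval (fun _ : W => μ) (f v)).map_eq

theorem measurePreserving_update [Fintype V] [DecidableEq V] (μ : Measure E)
    [IsProbabilityMeasure μ] (v : V) :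
    MeasurePreserving (fun z : E × (V → E) => Function.update z.2 v z.1)
      (μ.prod (Measure.pi fun _ => μ)) (Measure.pi fun _ => μ) := by
  have hmeas : Measurable fun z : E × (V → E) => Function.update z.2 v z.1 := by
    refine measurable_pi_lambda _ fun w => ?_
    by_cases h : w = v
    · subst h; simpa using measurable_fst
    · simp only [Function.update_of_ne h]
      fun_prop
  refine ⟨hmeas, (Measure.pi_eq fun s hs => ?_).symm⟩
  rw [Measure.map_apply hmeas (MeasurableSet.univ_pi hs)]
  have h : (fun z : E × (V → E) => Function.update z.2 v z.1) ⁻¹' Set.univ.pi s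
      = s v ×ˢ Set.univ.pi (Function.update s v Set.univ) := by
    ext z
    simp only [Set.mem_preimage, Set.mem_pi, Set.mem_univ, true_implies, Set.mem_prod]
    constructor
    · intro hz
      refine ⟨by simpa using hz v, fun w => ?_⟩
      by_cases hw : w = v
      · subst hw; simp
      · simpa [Function.update_of_ne hw] using hz w
    · rintro ⟨h₁, h₂⟩ w
      by_cases hw : w = v
      · subst hw; simpa using h₁
      · simpa [Function.update_of_ne hw] using h₂ w
  rw [h, Measure.prod_prod, Measure.pi_pi, ← Finset.mul_prod_erase _ _ (Finset.mem_univ v),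
    ← Finset.mul_prod_erase _ (fun i => μ (s i)) (Finset.mem_univ v)]
  simp only [Function.update_self, measure_univ, one_mul]
  congr 1
  exact Finset.prod_congr rfl fun w hw => by
    rw [Function.update_of_ne (Finset.ne_of_mem_erase hw)]

theorem integral_graphWeight_map [Fintype V] [Fintype W] (μ : Measure E) [IsProbabilityMeasure μ]
    (hm : Measurable fun z : E × E => H z.1 z.2) (hsym : ∀ x y, H x y = H y x)
    (K : SimpleGraph V) [Fintype K.edgeSet] (f : V ↪ W) [Fintype (K.map f).edgeSet] :
    ∫ x, graphWeight H hsym (K.map f) x ∂(Measure.pi fun _ => μ)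
      = ∫ x, graphWeight H hsym K x ∂(Measure.pi fun _ => μ) := by
  have h := measurePreserving_precomp μ f.injective
  rw [← h.map_eq, integral_map h.measurable.aemeasurable
    (measurable_graphWeight hm hsym K).aestronglyMeasurable]
  simp_rw [graphWeight_map]
  rfl

theorem integral_graphWeight_sup_map [Fintype V] [Fintype W] (μ : Measure E)
    [IsProbabilityMeasure μ] (hm : Measurable fun z : E × E => H z.1 z.2)
    (hsym : ∀ x y, H x y = H y x) (K : SimpleGraph V) [Fintype K.edgeSet] (f g : V ↪ W)
    (hfg : ∀ u v, f u ≠ g v) [Fintype (K.map f ⊔ K.map g).edgeSet] :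
    ∫ x, graphWeight H hsym (K.map f ⊔ K.map g) x ∂(Measure.pi fun _ => μ)
      = (∫ x, graphWeight H hsym K x ∂(Measure.pi fun _ => μ)) ^ 2 := by
  classical
  have hdisj : Disjoint (K.map f) (K.map g) := by
    rw [disjoint_iff]
    ext a b
    simp only [SimpleGraph.inf_adj, SimpleGraph.map_adj, SimpleGraph.bot_adj, iff_false]
    rintro ⟨⟨u, _, _, rfl, _⟩, ⟨u', _, _, h, _⟩⟩
    exact hfg u u' h.symm
  have h := (measurePreserving_sumPiEquivProdPi (fun _ : V ⊕ V => μ)).comp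
    (measurePreserving_precomp μ
    (Function.Injective.sumElim f.injective g.injective hfg))
  have hw := measurable_graphWeight hm hsym K
  rw [sq, ← integral_prod_mul, ← h.map_eq, integral_map h.measurable.aemeasurable
    (by fun_prop)]
  simp_rw [graphWeight_sup hsym hdisj, graphWeight_map]
  rfl

theorem measurableSet_edgesPresent [Fintype V] [LinearOrder V]
    (hm : Measurable fun z : E × E => H z.1 z.2) (p : ℝ) (K : SimpleGraph V) :
    MeasurableSet (edgesPresent H p K) := by
  simp only [edgesPresent, Set.ofPred_forall]
  refine MeasurableSet.iInter fun q => MeasurableSet.iInter fun _ => ?_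
  refine measurableSet_le (by fun_prop) (Measurable.const_mul ?_ p)
  have h : Measurable fun z : (V → E) × ({q : V × V // q.1 < q.2} → ℝ) =>
      (z.1 q.1.1, z.1 q.1.2) := by fun_prop
  exact hm.comp h

instance isProbabilityMeasure_uniform_unitInterval :
    IsProbabilityMeasure ((volume : Measure ℝ).restrict (Set.Icc (0 : ℝ) 1)) :=
  ⟨by simp⟩

/-- The law of the independent locations and of the independent uniform edge marks. -/
noncomputable def modelLaw (V : Type*) [Fintype V] [LinearOrder V] (μ : Measure E) :
    Measure ((V → E) × ({q : V × V // q.1 < q.2} → ℝ)) :=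
  (Measure.pi fun _ => μ).prod
    (Measure.pi fun _ => (volume.restrict (Set.Icc (0 : ℝ) 1)))

instance [Fintype V] [LinearOrder V] (μ : Measure E) [IsProbabilityMeasure μ] :
    IsProbabilityMeasure (modelLaw V μ) := by
  unfold modelLaw; infer_instance

theorem measureReal_edgesPresent [Fintype V] [LinearOrder V] (μ : Measure E)
    [IsProbabilityMeasure μ] (hm : Measurable fun z : E × E => H z.1 z.2)
    (hsym : ∀ x y, H x y = H y x) (h01 : ∀ x y, H x y ∈ Set.Icc (0 : ℝ) 1)
    {p : ℝ} (hp : p ∈ Set.Icc (0 : ℝ) 1) (K : SimpleGraph V) [Fintype K.edgeSet] :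
    (modelLaw V μ).real (edgesPresent H p K)
      = p ^ K.edgeFinset.card * ∫ x, graphWeight H hsym K x ∂(Measure.pi fun _ => μ) := by
  classical
  have hfib (x : V → E) : (Measure.pi fun _ : {q : V × V // q.1 < q.2} =>
      (volume.restrict (Set.Icc (0 : ℝ) 1))) (Prod.mk x ⁻¹' edgesPresent H p K)
      = ENNReal.ofReal (p ^ K.edgeFinset.card * graphWeight H hsym K x) := by
    have hset : Prod.mk x ⁻¹' edgesPresent H p K = Set.univ.pi fun q =>
        if K.Adj q.1.1 q.1.2 then Set.Iic (p * H (x q.1.1) (x q.1.2)) else Set.univ := by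
      ext y
      simp only [edgesPresent, Set.mem_preimage, Set.mem_ofPred_eq, Set.mem_pi, Set.mem_univ,
        true_implies]
      refine forall_congr' fun q => ?_
      split_ifs with h <;> simp [h]
    have hfac (q : {q : V × V // q.1 < q.2}) : (volume.restrict (Set.Icc (0 : ℝ) 1))
        (if K.Adj q.1.1 q.1.2 then Set.Iic (p * H (x q.1.1) (x q.1.2)) else Set.univ)
        = ENNReal.ofReal (if K.Adj q.1.1 q.1.2 then p * H (x q.1.1) (x q.1.2) else 1) := by
      split_ifs with h
      · have h₁ : p * H (x q.1.1) (x q.1.2) ≤ 1 := mul_le_one₀ hp.2 (h01 _ _).1 (h01 _ _).2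
        rw [Measure.restrict_apply measurableSet_Iic]
        have : Set.Iic (p * H (x q.1.1) (x q.1.2)) ∩ Set.Icc 0 1
            = Set.Icc 0 (p * H (x q.1.1) (x q.1.2)) := by
          ext t; simp only [Set.mem_inter_iff, Set.mem_Iic, Set.mem_Icc]; grind
        simp [this]
      · simp
    rw [hset, Measure.pi_pi, Finset.prod_congr rfl fun q _ => hfac q,
      ← ENNReal.ofReal_prod_of_nonneg]
    · congr 1
      have hc (a b : V) : p * H (x a) (x b) = p * H (x b) (x a) := by rw [hsym]
      have hw : p ^ K.edgeFinset.card * graphWeight H hsym K x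
          = ∏ e ∈ K.edgeFinset, Sym2.lift ⟨fun a b => p * H (x a) (x b), hc⟩ e := by
        rw [graphWeight, ← Finset.prod_const, ← Finset.prod_mul_distrib]
        refine Finset.prod_congr rfl fun e _ => ?_
        induction e with
        | _ a b => rfl
      rw [hw, ← prod_ordered_edges K (fun a b => p * H (x a) (x b)), ← Finset.filter_filter,
        Finset.prod_filter]
      exact (Finset.prod_subtype (p := fun q : V × V => q.1 < q.2) _ (by simp) fun q : V × V =>
        if K.Adj q.1 q.2 then p * H (x q.1) (x q.2) else 1).symm
    · intro q _
      split_ifs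
      · exact mul_nonneg hp.1 (h01 _ _).1
      · exact zero_le_one
  rw [Measure.real, modelLaw, Measure.prod_apply (measurableSet_edgesPresent hm p K)]
  simp_rw [hfib]
  rw [← ofReal_integral_eq_lintegral_ofReal, ENNReal.toReal_ofReal, integral_const_mul]
  · exact integral_nonneg fun x =>
      mul_nonneg (pow_nonneg hp.1 _) (graphWeight_nonneg hsym h01 K x)
  · exact (integrable_graphWeight hm hsym h01 K _).const_mul _
  · exact Filter.Eventually.of_forall fun x =>
      mul_nonneg (pow_nonneg hp.1 _) (graphWeight_nonneg hsym h01 K x)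

theorem measureReal_edgesPresent_le [Fintype V] [LinearOrder V] (μ : Measure E)
    [IsProbabilityMeasure μ] (hm : Measurable fun z : E × E => H z.1 z.2)
    (hsym : ∀ x y, H x y = H y x) (h01 : ∀ x y, H x y ∈ Set.Icc (0 : ℝ) 1)
    {p : ℝ} (hp : p ∈ Set.Icc (0 : ℝ) 1) (K : SimpleGraph V) [Fintype K.edgeSet] :
    (modelLaw V μ).real (edgesPresent H p K) ≤ p ^ K.edgeFinset.card := by
  rw [measureReal_edgesPresent μ hm hsym h01 hp]
  refine mul_le_of_le_one_right (pow_nonneg hp.1 _) ?_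
  calc ∫ x, graphWeight H hsym K x ∂(Measure.pi fun _ => μ)
      ≤ ∫ _, 1 ∂(Measure.pi fun _ : V => μ) := integral_mono
        (integrable_graphWeight hm hsym h01 K _) (integrable_const _)
        (graphWeight_le_one hsym h01 K)
    _ = 1 := by simp

end GraphWeight

theorem measureReal_iInter_compl_le {Ω ι : Type*} [MeasurableSpace Ω] (Q : Measure Ω)
    [IsProbabilityMeasure Q] [Fintype ι] [Nonempty ι] {A : ι → Set Ω}
    (hA : ∀ i, MeasurableSet (A i)) {r : ℝ} (hr : 0 < r) (hQ : ∀ i, Q.real (A i) = r)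
    {c : ι → ι → ℝ} (hc : ∀ i j, Q.real (A i ∩ A j) ≤ r ^ 2 + c i j) :
    Q.real (⋂ i, (A i)ᶜ) ≤ (∑ i, ∑ j, c i j) / (Fintype.card ι * r) ^ 2 := by
  classical
  have hL (i : ι) : MemLp ((A i).indicator (1 : Ω → ℝ)) 2 Q :=
    memLp_indicator_const 2 (hA i) 1 (Or.inr (measure_ne_top _ _))
  have hmean : ∫ ω, (∑ i, (A i).indicator (1 : Ω → ℝ)) ω ∂Q = Fintype.card ι * r := by
    simp_rw [Finset.sum_apply]
    rw [integral_finsetSum _ fun i _ => (hL i).integrable (by norm_num)]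
    simp_rw [integral_indicator_one (hA _), hQ]
    simp
  have hvar : Var[∑ i, (A i).indicator (1 : Ω → ℝ); Q] ≤ ∑ i, ∑ j, c i j := by
    rw [variance_sum fun i => hL i]
    refine Finset.sum_le_sum fun i _ => Finset.sum_le_sum fun j _ => ?_
    rw [covariance_eq_sub (hL i) (hL j), ← Set.inter_indicator_one,
      integral_indicator_one ((hA i).inter (hA j)), integral_indicator_one (hA i),
      integral_indicator_one (hA j), hQ, hQ]
    linarith [hc i j]
  have hpos : 0 < Fintype.card ι * r := mul_pos (Nat.cast_pos.2 Fintype.card_pos) hr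
  have hcheb := meas_ge_le_variance_div_sq (memLp_finsetSum' Finset.univ fun i _ => hL i) hpos
  rw [hmean] at hcheb
  have hsub : ⋂ i, (A i)ᶜ ⊆ {ω | Fintype.card ι * r
      ≤ |(∑ i, (A i).indicator (1 : Ω → ℝ)) ω - Fintype.card ι * r|} := by
    intro ω hω
    have h0 : (∑ i, (A i).indicator (1 : Ω → ℝ)) ω = 0 := by
      rw [Finset.sum_apply]
      exact Finset.sum_eq_zero fun i _ => Set.indicator_of_notMem (Set.mem_iInter.1 hω i) _
    simp only [Set.mem_ofPred_eq, h0, zero_sub, abs_neg]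
    exact le_abs_self _
  calc Q.real (⋂ i, (A i)ᶜ) ≤ _ :=
        ENNReal.toReal_mono ENNReal.ofReal_ne_top ((measure_mono hsub).trans hcheb)
    _ = Var[∑ i, (A i).indicator (1 : Ω → ℝ); Q] / (Fintype.card ι * r) ^ 2 :=
        ENNReal.toReal_ofReal (div_nonneg (variance_nonneg _ _) (sq_nonneg _))
    _ ≤ _ := by gcongr

theorem StronglyBalanced.card_common_edges_le {k : ℕ} {W : Type*} [DecidableEq W]
    {G : SimpleGraph (Fin k)} [DecidableRel G.Adj] (hbal : StronglyBalanced G)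
    (f g : Fin k ↪ W) [Fintype (G.map f ⊓ G.map g).edgeSet]
    (hs : 0 < (G.map f ⊓ G.map g).edgeFinset.card) :
    (G.map f ⊓ G.map g).edgeFinset.card * (k - 1)
      ≤ G.edgeFinset.card
        * ((Finset.univ.filter fun v => g v ∈ Finset.univ.map f).card - 1) := by
  let S : G.Subgraph :=
    { verts := {v | g v ∈ Finset.univ.map f}
      Adj := fun a b => G.Adj a b ∧ (G.map f).Adj (g a) (g b)
      adj_sub := And.left
      edge_vert := by
        rintro a b ⟨_, h⟩
        obtain ⟨u, _, _, hu, _⟩ := (SimpleGraph.map_adj _ _ _ _).1 h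
        simp only [Set.mem_ofPred_eq, Finset.mem_map, Finset.mem_univ, true_and]
        exact ⟨u, hu⟩
      symm := ⟨fun a b h => ⟨h.1.symm, h.2.symm⟩⟩ }
  have hverts : S.verts.ncard
      = (Finset.univ.filter fun v => g v ∈ Finset.univ.map f).card := by
    rw [← Set.ncard_coe_finset]
    congr 1
    ext v
    simp [S]
  have himage : g.sym2Map '' S.edgeSet = (G.map f ⊓ G.map g).edgeSet := by
    ext e
    induction e with
    | _ a b =>
      constructor
      · rintro ⟨e, he, heq⟩
        rw [← heq]
        induction e with
        | _ u v =>
          have h : G.Adj u v ∧ (G.map f).Adj (g u) (g v) := he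
          exact ⟨h.2, (SimpleGraph.map_adj_apply).2 h.1⟩
      · rintro ⟨h₁, h₂⟩
        obtain ⟨u, v, huv, rfl, rfl⟩ := (SimpleGraph.map_adj _ _ _ _).1 h₂
        exact ⟨s(u, v), (⟨huv, h₁⟩ : G.Adj u v ∧ (G.map f).Adj (g u) (g v)), rfl⟩
  have hedges : S.edgeSet.ncard = (G.map f ⊓ G.map g).edgeFinset.card := by
    rw [← Set.ncard_coe_finset, SimpleGraph.coe_edgeFinset, ← himage,
      Set.ncard_image_of_injective _ g.sym2Map.injective]
  have htwo : 2 ≤ S.verts.ncard := by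
    have hne : S.edgeSet.Nonempty := by
      rw [← Set.ncard_pos, hedges]
      exact hs
    obtain ⟨e, he⟩ := hne
    induction e with
    | _ u v =>
      have h : S.Adj u v := he
      exact (Set.one_lt_ncard).2 ⟨u, S.edge_vert h, v, S.edge_vert h.symm, h.ne⟩
  have h := hbal S htwo
  rwa [hedges, hverts] at h

theorem one_le_overlap_factor {k e m s : ℕ} (he : 0 < e) (hk : 2 ≤ k) (hm : 1 ≤ m) (hmk : m ≤ k)
    (hs : 0 < s → s * (k - 1) ≤ e * (m - 1)) {n p : ℝ} (hn : 1 ≤ n)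
    (hω : 1 ≤ p * n ^ ((k : ℝ) / e)) :
    1 ≤ p ^ s * n ^ m * (n⁻¹ + (p * n ^ ((k : ℝ) / e))⁻¹) := by
  have hn0 : 0 < n := by linarith
  set N := n ^ ((k : ℝ) / e) with hN
  have hN0 : 0 < N := Real.rpow_pos_of_pos hn0 _
  have hp0 : 0 < p := by
    by_contra! h
    nlinarith
  rcases Nat.eq_zero_or_pos s with rfl | hs0
  · have h₁ : n * n⁻¹ = 1 := mul_inv_cancel₀ hn0.ne'
    have h₂ : n ≤ n ^ m := le_self_pow₀ hn (by omega)
    have h₃ : 0 < n⁻¹ := by positivity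
    have h₄ : 0 < (p * N)⁻¹ := by positivity
    have h₅ : 0 < n ^ m := by positivity
    rw [pow_zero, one_mul]
    nlinarith [mul_pos h₅ h₄]
  · have hbal := hs hs0
    have hexp : (k : ℝ) / e * s ≤ m := by
      have h₀ : (s : ℝ) * (k - 1) ≤ e * (m - 1) := by
        have := (Nat.cast_le (α := ℝ)).2 hbal
        push_cast [Nat.cast_sub (by omega : 1 ≤ k), Nat.cast_sub hm] at this
        exact this
      have hk' : (2 : ℝ) ≤ k := by exact_mod_cast hk
      have hmk' : (m : ℝ) ≤ k := by exact_mod_cast hmk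
      have he' : (0 : ℝ) < e := by exact_mod_cast he
      rw [div_mul_eq_mul_div, div_le_iff₀ he']
      have h₁ : (k : ℝ) * (s * (k - 1)) ≤ k * (e * (m - 1)) := by gcongr
      have h₂ : (k : ℝ) * (e * (m - 1)) ≤ m * e * (k - 1) := by nlinarith
      have h₃ : (k * s : ℝ) * (k - 1) ≤ m * e * (k - 1) := by linarith
      exact le_of_mul_le_mul_right h₃ (by linarith)
    have hNs : N ^ s ≤ n ^ m := by
      rw [hN, ← Real.rpow_natCast, ← Real.rpow_mul hn0.le, ← Real.rpow_natCast n m]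
      exact Real.rpow_le_rpow_of_exponent_le hn hexp
    have h₁ : p * N ≤ p ^ s * n ^ m := calc
      p * N ≤ (p * N) ^ s := le_self_pow₀ hω hs0.ne'
      _ = p ^ s * N ^ s := mul_pow _ _ _
      _ ≤ _ := by gcongr
    have h₂ : p * N * (p * N)⁻¹ = 1 := mul_inv_cancel₀ (by positivity)
    calc 1 = p * N * (p * N)⁻¹ := h₂.symm
      _ ≤ p ^ s * n ^ m * (n⁻¹ + (p * N)⁻¹) := by
        gcongr
        linarith [inv_pos.2 hn0]

theorem sum_pow_overlap_le {k n : ℕ} (f : Fin k ↪ Fin n) :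
    ∑ g : Fin k ↪ Fin n,
        (n : ℝ) ^ (Finset.univ.filter fun v => g v ∈ Finset.univ.map f).card
      ≤ ((k + 1) * n : ℝ) ^ k := by
  classical
  let F (g : Fin k → Fin n) : ℝ := ∏ v, if g v ∈ Finset.univ.map f then (n : ℝ) else 1
  have hF (g : Fin k → Fin n) : 0 ≤ F g :=
    Finset.prod_nonneg fun v _ => by split_ifs <;> positivity
  have h₁ : ∑ w : Fin n, (if w ∈ Finset.univ.map f then (n : ℝ) else 1) ≤ (k + 1) * n := by
    calc ∑ w : Fin n, (if w ∈ Finset.univ.map f then (n : ℝ) else 1)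
        ≤ ∑ w : Fin n, ((if w ∈ Finset.univ.map f then (n : ℝ) else 0) + 1) := by
          refine Finset.sum_le_sum fun w _ => ?_
          split_ifs <;> linarith
      _ = (k + 1) * n := by
          rw [Finset.sum_add_distrib, ← Finset.sum_filter, Finset.filter_mem_eq_inter]
          simp
          ring
  calc ∑ g : Fin k ↪ Fin n,
        (n : ℝ) ^ (Finset.univ.filter fun v => g v ∈ Finset.univ.map f).card
      = ∑ g : Fin k ↪ Fin n, F g := by
        refine Finset.sum_congr rfl fun g _ => ?_
        simp only [F, Finset.prod_ite, Finset.prod_const, one_pow, mul_one]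
    _ = ∑ g ∈ Finset.univ.map ⟨fun g : Fin k ↪ Fin n => (g : Fin k → Fin n),
          DFunLike.coe_injective⟩, F g := by rw [Finset.sum_map]; rfl
    _ ≤ ∑ g : Fin k → Fin n, F g :=
        Finset.sum_le_sum_of_subset_of_nonneg (Finset.subset_univ _) fun g _ _ => hF g
    _ = (∑ w : Fin n, (if w ∈ Finset.univ.map f then (n : ℝ) else 1)) ^ k := by
        have h := Finset.sum_prod_piFinset (ι := Fin k) (Finset.univ : Finset (Fin n))
          fun _ w => if w ∈ Finset.univ.map f then (n : ℝ) else 1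
        rw [Fintype.piFinset_univ] at h
        simpa [F] using h
    _ ≤ _ := by
        gcongr

theorem half_pow_le_card_embedding {k n : ℕ} (hn : 2 * k ≤ n) :
    ((n : ℝ) / 2) ^ k ≤ Fintype.card (Fin k ↪ Fin n) := by
  rw [Fintype.card_embedding_eq, Fintype.card_fin, Fintype.card_fin]
  calc ((n : ℝ) / 2) ^ k ≤ ((n + 1 - k : ℕ) : ℝ) ^ k := by
        have h : (n : ℝ) ≤ 2 * (n + 1 - k : ℕ) := by exact_mod_cast (by omega)
        gcongr
        linarith
    _ ≤ _ := by exact_mod_cast Nat.pow_sub_le_descFactorial n k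

theorem card_embedding_le {k n : ℕ} : Fintype.card (Fin k ↪ Fin n) ≤ n ^ k := by
  rw [Fintype.card_embedding_eq, Fintype.card_fin, Fintype.card_fin]
  exact Nat.descFactorial_le_pow n k

section Model

variable {E : Type*} [MeasurableSpace E] {H : E → E → ℝ} {k n : ℕ}

/-- The event that the model on `n` vertices contains no copy of `G`. -/
def noCopy (n : ℕ) (H : E → E → ℝ) (p : ℝ) (G : SimpleGraph (Fin k)) :
    Set ((Fin n → E) × ({q : Fin n × Fin n // q.1 < q.2} → ℝ)) :=
  ⋂ f : Fin k ↪ Fin n, (edgesPresent H p (G.map f))ᶜ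

theorem measurableSet_noCopy (hm : Measurable fun z : E × E => H z.1 z.2) (p : ℝ)
    (G : SimpleGraph (Fin k)) : MeasurableSet (noCopy n H p G) :=
  MeasurableSet.iInter fun _ => (measurableSet_edgesPresent hm p _).compl

theorem one_sub_le_measureReal_noCopy (μ : Measure E) [IsProbabilityMeasure μ]
    (hm : Measurable fun z : E × E => H z.1 z.2) (hsym : ∀ x y, H x y = H y x)
    (h01 : ∀ x y, H x y ∈ Set.Icc (0 : ℝ) 1) {p : ℝ} (hp : p ∈ Set.Icc (0 : ℝ) 1)
    (G : SimpleGraph (Fin k)) [DecidableRel G.Adj] :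
    1 - (n : ℝ) ^ k * p ^ G.edgeFinset.card
      ≤ (modelLaw (Fin n) μ).real (noCopy n H p G) := by
  classical
  have hcompl : (noCopy n H p G)ᶜ = ⋃ f : Fin k ↪ Fin n, edgesPresent H p (G.map f) := by
    simp [noCopy, Set.compl_iInter]
  have h : (modelLaw (Fin n) μ).real (noCopy n H p G)ᶜ ≤ n ^ k * p ^ G.edgeFinset.card := by
    rw [hcompl]
    calc (modelLaw (Fin n) μ).real (⋃ f : Fin k ↪ Fin n, edgesPresent H p (G.map f))
        ≤ ∑ f : Fin k ↪ Fin n, (modelLaw (Fin n) μ).real (edgesPresent H p (G.map f)) :=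
          measureReal_iUnion_fintype_le _
      _ ≤ ∑ _ : Fin k ↪ Fin n, p ^ G.edgeFinset.card := by
          refine Finset.sum_le_sum fun f _ => ?_
          rw [← card_edgeFinset_map_embedding G f]
          exact measureReal_edgesPresent_le μ hm hsym h01 hp _
      _ ≤ n ^ k * p ^ G.edgeFinset.card := by
          rw [Finset.sum_const, nsmul_eq_mul, Finset.card_univ]
          have := hp.1
          gcongr
          exact_mod_cast card_embedding_le
  rw [probReal_compl_eq_one_sub (measurableSet_noCopy hm p G)] at h
  linarith

theorem measureReal_noCopy_le (μ : Measure E) [IsProbabilityMeasure μ]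
    (hm : Measurable fun z : E × E => H z.1 z.2) (hsym : ∀ x y, H x y = H y x)
    (h01 : ∀ x y, H x y ∈ Set.Icc (0 : ℝ) 1) {p : ℝ} (hp : p ∈ Set.Ioc (0 : ℝ) 1)
    (G : SimpleGraph (Fin k)) [DecidableRel G.Adj] (hbal : StronglyBalanced G) (hk : 2 ≤ k)
    (he : 0 < G.edgeFinset.card)
    (hpos : 0 < ∫ x, graphWeight H hsym G x ∂(Measure.pi fun _ => μ)) (hn : 2 * k ≤ n)
    (hω : 1 ≤ p * (n : ℝ) ^ ((k : ℝ) / G.edgeFinset.card)) :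
    (modelLaw (Fin n) μ).real (noCopy n H p G)
      ≤ ((n : ℝ)⁻¹ + (p * (n : ℝ) ^ ((k : ℝ) / G.edgeFinset.card))⁻¹)
        * ((4 * (k + 1)) ^ k / (∫ x, graphWeight H hsym G x ∂(Measure.pi fun _ => μ)) ^ 2) := by
  classical
  have hp' : p ∈ Set.Icc (0 : ℝ) 1 := ⟨hp.1.le, hp.2⟩
  have hp0 : 0 < p := hp.1
  have hn0 : (0 : ℝ) < n := by exact_mod_cast (by omega)
  have hn1 : (1 : ℝ) ≤ n := by exact_mod_cast (by omega)
  set h := ∫ x, graphWeight H hsym G x ∂(Measure.pi fun _ => μ)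
  set e := G.edgeFinset.card
  set ε := (n : ℝ)⁻¹ + (p * (n : ℝ) ^ ((k : ℝ) / e))⁻¹
  have hε0 : 0 < ε := by positivity
  have : Nonempty (Fin k ↪ Fin n) := ⟨Fin.castLEEmb (by omega)⟩
  have hone (f : Fin k ↪ Fin n) :
      (modelLaw (Fin n) μ).real (edgesPresent H p (G.map f)) = p ^ e * h := by
    rw [measureReal_edgesPresent μ hm hsym h01 hp', card_edgeFinset_map_embedding G f,
      integral_graphWeight_map μ hm hsym]
  have htwo (f g : Fin k ↪ Fin n) :
      (modelLaw (Fin n) μ).real (edgesPresent H p (G.map f) ∩ edgesPresent H p (G.map g))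
        ≤ (p ^ e * h) ^ 2 + p ^ (2 * e) * ε
          * (n : ℝ) ^ (Finset.univ.filter fun v => g v ∈ Finset.univ.map f).card := by
    rw [← edgesPresent_sup]
    have hcard : (G.map f ⊔ G.map g).edgeFinset.card + (G.map f ⊓ G.map g).edgeFinset.card
        = 2 * e := by
      rw [SimpleGraph.edgeFinset_sup, SimpleGraph.edgeFinset_inf,
        Finset.card_union_add_card_inter, card_edgeFinset_map_embedding G f,
        card_edgeFinset_map_embedding G g, two_mul]
    rcases Nat.eq_zero_or_pos (Finset.univ.filter fun v => g v ∈ Finset.univ.map f).card with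
      hm0 | hm0
    · have hfg (u v : Fin k) : f u ≠ g v := by
        intro huv
        rw [Finset.card_eq_zero, Finset.filter_eq_empty_iff] at hm0
        exact hm0 (Finset.mem_univ v) (by simp [← huv])
      have hs : (G.map f ⊓ G.map g).edgeFinset.card = 0 := by
        rw [Finset.card_eq_zero, SimpleGraph.edgeFinset_eq_empty]
        ext a b
        simp only [SimpleGraph.inf_adj, SimpleGraph.map_adj, SimpleGraph.bot_adj, iff_false]
        rintro ⟨⟨u, _, _, rfl, _⟩, ⟨u', _, _, hu, _⟩⟩
        exact hfg u u' hu.symm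
      rw [hs, add_zero] at hcard
      rw [measureReal_edgesPresent μ hm hsym h01 hp', hcard,
        integral_graphWeight_sup_map μ hm hsym G f g hfg, mul_pow, ← pow_mul, mul_comm e 2]
      exact le_add_of_nonneg_right (by positivity)
    · have hmk : (Finset.univ.filter fun v => g v ∈ Finset.univ.map f).card ≤ k := by
        simpa using Finset.card_filter_le (Finset.univ : Finset (Fin k))
          fun v => g v ∈ Finset.univ.map f
      have hfac := one_le_overlap_factor he hk hm0 hmk
        (hbal.card_common_edges_le f g) hn1 hω
      calc (modelLaw (Fin n) μ).real (edgesPresent H p (G.map f ⊔ G.map g))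
          ≤ p ^ (G.map f ⊔ G.map g).edgeFinset.card :=
            measureReal_edgesPresent_le μ hm hsym h01 hp' _
        _ ≤ p ^ (G.map f ⊔ G.map g).edgeFinset.card *
            (p ^ (G.map f ⊓ G.map g).edgeFinset.card
              * (n : ℝ) ^ (Finset.univ.filter fun v => g v ∈ Finset.univ.map f).card * ε) :=
            le_mul_of_one_le_right (by positivity) hfac
        _ = p ^ (2 * e) * ε
            * (n : ℝ) ^ (Finset.univ.filter fun v => g v ∈ Finset.univ.map f).card := by
            rw [← hcard, pow_add]
            ring
        _ ≤ _ := le_add_of_nonneg_left (sq_nonneg _)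
  have hmoment := measureReal_iInter_compl_le (modelLaw (Fin n) μ)
    (fun f : Fin k ↪ Fin n => measurableSet_edgesPresent hm p (G.map f))
    (mul_pos (pow_pos hp0 e) hpos) hone htwo
  have hnum : ∑ f : Fin k ↪ Fin n, ∑ g : Fin k ↪ Fin n, p ^ (2 * e) * ε
        * (n : ℝ) ^ (Finset.univ.filter fun v => g v ∈ Finset.univ.map f).card
      ≤ (n : ℝ) ^ k * (p ^ (2 * e) * ε * ((k + 1) * n : ℝ) ^ k) := by
    calc _ ≤ ∑ _ : Fin k ↪ Fin n, p ^ (2 * e) * ε * ((k + 1) * n : ℝ) ^ k := by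
          refine Finset.sum_le_sum fun f _ => ?_
          rw [← Finset.mul_sum]
          gcongr
          exact sum_pow_overlap_le f
      _ ≤ _ := by
          rw [Finset.sum_const, nsmul_eq_mul, Finset.card_univ]
          gcongr
          exact_mod_cast card_embedding_le
  have hden := half_pow_le_card_embedding hn
  calc (modelLaw (Fin n) μ).real (noCopy n H p G) ≤ _ := hmoment
    _ ≤ (n : ℝ) ^ k * (p ^ (2 * e) * ε * ((k + 1) * n : ℝ) ^ k)
        / (((n : ℝ) / 2) ^ k * (p ^ e * h)) ^ 2 := by gcongr
    _ = ε * ((4 * (k + 1)) ^ k / h ^ 2) := by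
        have h4 : (4 : ℝ) ^ k = (2 ^ k) ^ 2 := by rw [← pow_mul, mul_comm, pow_mul]; norm_num
        rw [mul_pow 4, h4]
        simp only [mul_pow, div_pow]
        rw [mul_comm 2 e, pow_mul]
        field_simp

end Model

theorem NG_eq_zero_iff {d k n : ℕ} {Ω : Type*} (G : SimpleGraph (Fin k)) [DecidableRel G.Adj]
    {H : (Fin d → ℝ) → (Fin d → ℝ) → ℝ} (hsym : ∀ x y, H x y = H y x) (p : ℝ) {a : ℕ} (ha : a ≠ 0)
    (X : Fin n → Ω → (Fin d → ℝ)) (Y : Fin n → Fin n → Ω → ℝ) (hY : ∀ a b, Y a b = Y b a)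
    (ω : Ω) :
    NG G H p a X Y ω = 0 ↔ ((fun i => X i ω),
      (fun q : {q : Fin n × Fin n // q.1 < q.2} => Y q.1.1 q.1.2 ω)) ∈ noCopy n H p G := by
  rw [NG, mul_eq_zero, or_iff_right (inv_ne_zero (Nat.cast_ne_zero.2 ha)),
    Finset.sum_eq_zero_iff_of_nonneg fun β _ =>
      Finset.prod_nonneg fun q _ => by split_ifs <;> norm_num]
  simp only [Finset.mem_filter, Finset.mem_univ, true_and, noCopy, Set.mem_iInter,
    Set.mem_compl_iff]
  have key (f : Fin k ↪ Fin n) : (∏ q ∈ (Finset.univ : Finset (Fin k × Fin k)).filter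
        (fun q => q.1 < q.2 ∧ G.Adj q.1 q.2),
      if Y (f q.1) (f q.2) ω ≤ p * H (X (f q.1) ω) (X (f q.2) ω) then (1 : ℝ) else 0) = 0
      ↔ ((fun i => X i ω), (fun q : {q : Fin n × Fin n // q.1 < q.2} => Y q.1.1 q.1.2 ω))
        ∉ edgesPresent H p (G.map f) := by
    rw [← not_iff_not, not_not, ← ne_eq, Finset.prod_ne_zero_iff]
    simp only [Finset.mem_filter, Finset.mem_univ, true_and, ne_eq, ite_eq_right_iff,
      one_ne_zero, imp_false, not_not, edgesPresent, Set.mem_ofPred_eq]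
    constructor
    · rintro h ⟨⟨a, b⟩, hab⟩ hadj
      obtain ⟨u, v, huv, rfl, rfl⟩ := (SimpleGraph.map_adj _ _ _ _).1 hadj
      rcases lt_or_gt_of_ne huv.ne with hlt | hlt
      · exact h (u, v) ⟨hlt, huv⟩
      · have := h (v, u) ⟨hlt, huv.symm⟩
        rwa [hY, hsym] at this
    · rintro h ⟨u, v⟩ ⟨_, huv⟩
      have hadj : (G.map f).Adj (f u) (f v) := SimpleGraph.map_adj_apply.2 huv
      rcases lt_or_gt_of_ne hadj.ne with hlt | hlt
      · exact h ⟨(f u, f v), hlt⟩ hadj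
      · have := h ⟨(f v, f u), hlt⟩ hadj.symm
        rwa [hY, hsym] at this
  exact ⟨fun h f => (key f).1 (h f f.injective), fun h β hβ => (key ⟨β, hβ⟩).2 (h ⟨β, hβ⟩)⟩

theorem integral_graphWeight_pos_of_variance_pos {d k : ℕ} (G : SimpleGraph (Fin k))
    [DecidableRel G.Adj] (μ : Measure (Fin d → ℝ)) [IsProbabilityMeasure μ]
    {H : (Fin d → ℝ) → (Fin d → ℝ) → ℝ}
    (hm : Measurable fun z : (Fin d → ℝ) × (Fin d → ℝ) => H z.1 z.2)
    (hsym : ∀ x y, H x y = H y x) (h01 : ∀ x y, H x y ∈ Set.Icc (0 : ℝ) 1) {p : ℝ} {a : ℕ}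
    (hvar : 0 < variance (fun x => ∑ ℓ : Fin k, fSub G H μ p a ℓ x) μ) :
    0 < ∫ x, graphWeight H hsym G x ∂(Measure.pi fun _ => μ) := by
  have hnn := graphWeight_nonneg hsym h01 G
  refine lt_of_le_of_ne (integral_nonneg hnn) fun h0 => hvar.ne' ?_
  have hae : ∀ᵐ x ∂(Measure.pi fun _ : Fin k => μ), graphWeight H hsym G x = 0 :=
    (integral_eq_zero_iff_of_nonneg hnn (integrable_graphWeight hm hsym h01 G _)).1 h0.symm
  have hsub (ℓ : Fin k) : ∀ᵐ x ∂μ, fSub G H μ p a ℓ x = 0 := by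
    have h := Measure.ae_ae_of_ae_prod
      ((measurePreserving_update μ ℓ).quasiMeasurePreserving.ae hae)
    filter_upwards [h] with x hx
    rw [fSub, integral_eq_zero_of_ae, mul_zero]
    filter_upwards [hx] with z hz
    rw [Pi.zero_apply, ← hz, graphWeight, ← prod_ordered_edges G (fun u v =>
      H (Function.update z ℓ x u) (Function.update z ℓ x v))]
  have hsum : (fun x => ∑ ℓ : Fin k, fSub G H μ p a ℓ x) =ᵐ[μ] fun _ => 0 := by
    filter_upwards [Filter.eventually_all.2 hsub] with x hx
    simp [hx]
  rw [variance_congr hsum]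
  exact variance_zero μ

/-- Threshold phenomenon for subgraph containment in the binomial random-connection
model, for a strongly balanced connected graph `G` satisfying Assumption 1:
(a) if `p_n ≪ n^{−v(G)/e(G)}` then `P(N_G = 0) → 1`;
(b) if `p_n ≫ n^{−v(G)/e(G)}` then `P(N_G = 0) → 0`. -/
theorem subgraph_containment_threshold
    {d k : ℕ} (hk : 2 ≤ k)
    (G : SimpleGraph (Fin k)) [DecidableRel G.Adj] (hGconn : G.Connected)
    (μ : Measure (Fin d → ℝ)) [IsProbabilityMeasure μ] (hμ : ∀ x, μ {x} = 0)
    (H : (Fin d → ℝ) → (Fin d → ℝ) → ℝ)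
    (hHm : Measurable fun z : (Fin d → ℝ) × (Fin d → ℝ) => H z.1 z.2)
    (hHsym : ∀ x y, H x y = H y x) (hH01 : ∀ x y, H x y ∈ Set.Icc (0 : ℝ) 1)
    (p : ℕ → ℝ) (hp : ∀ n, p n ∈ Set.Ioo (0 : ℝ) 1)
    (Ω : ℕ → Type) [∀ n, MeasurableSpace (Ω n)]
    (P : ∀ n, Measure (Ω n)) [∀ n, IsProbabilityMeasure (P n)]
    (X : ∀ n, Fin n → Ω n → (Fin d → ℝ)) (Y : ∀ n, Fin n → Fin n → Ω n → ℝ)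
    (hYsym : ∀ n a b, Y n a b = Y n b a)
    (hlaw : ∀ n, Measure.map (fun ω => ((fun i => X n i ω),
        (fun q : {q : Fin n × Fin n // q.1 < q.2} => Y n q.1.1 q.1.2 ω))) (P n)
      = (Measure.pi fun _ => μ).prod
          (Measure.pi fun _ => (volume.restrict (Set.Icc (0 : ℝ) 1))))
    (hbal : StronglyBalanced G)
    (hA : ∀ n, 0 < variance
      (fun x => ∑ ℓ : Fin k, fSub G H μ (p n) (autCard G) ℓ x) μ) :
    ((Filter.Tendsto
        (fun n : ℕ => p n * (n : ℝ) ^ ((k : ℝ) / (G.edgeFinset.card : ℝ)))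
        Filter.atTop (nhds 0) →
      Filter.Tendsto
        (fun n : ℕ =>
          ((P n) {ω | NG G H (p n) (autCard G) (X n) (Y n) ω = 0}).toReal)
        Filter.atTop (nhds 1))
    ∧ (Filter.Tendsto
        (fun n : ℕ => p n * (n : ℝ) ^ ((k : ℝ) / (G.edgeFinset.card : ℝ)))
        Filter.atTop Filter.atTop →
      Filter.Tendsto
        (fun n : ℕ =>
          ((P n) {ω | NG G H (p n) (autCard G) (X n) (Y n) ω = 0}).toReal)
        Filter.atTop (nhds 0))) := by
  classical
  have ha : autCard G ≠ 0 := Nat.card_ne_zero.2 ⟨⟨SimpleGraph.Iso.refl⟩,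
    Finite.of_injective (fun φ : G ≃g G => (φ : Fin k → Fin k)) DFunLike.coe_injective⟩
  have he : 0 < G.edgeFinset.card := by
    have : Nontrivial (Fin k) := Fin.nontrivial_iff_two_le.2 hk
    rw [Finset.card_pos, SimpleGraph.edgeFinset_nonempty]
    rintro rfl
    exact SimpleGraph.not_connected_bot hGconn
  have hprob (n : ℕ) : ((P n) {ω | NG G H (p n) (autCard G) (X n) (Y n) ω = 0}).toReal
      = (modelLaw (Fin n) μ).real (noCopy n H (p n) G) := by
    have hmeas : AEMeasurable (fun ω => ((fun i => X n i ω),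
        (fun q : {q : Fin n × Fin n // q.1 < q.2} => Y n q.1.1 q.1.2 ω))) (P n) := by
      by_contra h
      have h0 := hlaw n
      rw [Measure.map_of_not_aemeasurable h] at h0
      exact (IsProbabilityMeasure.ne_zero (modelLaw (Fin n) μ)) h0.symm
    rw [modelLaw, ← hlaw n, Measure.real,
      Measure.map_apply_of_aemeasurable hmeas (measurableSet_noCopy hHm _ G)]
    simp_rw [NG_eq_zero_iff G hHsym (p n) ha (X n) (Y n) (hYsym n)]
    rfl
  have hp' (n : ℕ) : p n ∈ Set.Icc (0 : ℝ) 1 := Set.Ioo_subset_Icc_self (hp n)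
  simp_rw [hprob]
  refine ⟨fun hlim => ?_, fun hlim => ?_⟩
  · have hpow : Filter.Tendsto (fun n : ℕ => (n : ℝ) ^ k * p n ^ G.edgeFinset.card)
        Filter.atTop (nhds 0) := by
      have h := hlim.pow G.edgeFinset.card
      rw [zero_pow he.ne'] at h
      refine h.congr fun n => ?_
      rw [mul_pow, mul_comm, ← Real.rpow_natCast ((n : ℝ) ^ _), ← Real.rpow_mul n.cast_nonneg,
        div_mul_cancel₀ _ (Nat.cast_ne_zero.2 he.ne'), Real.rpow_natCast]
    refine tendsto_of_tendsto_of_tendsto_of_le_of_le (by simpa using hpow.const_sub 1)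
      tendsto_const_nhds
      (fun n => one_sub_le_measureReal_noCopy μ hHm hHsym hH01 (hp' n) G)
      fun n => measureReal_le_one
  · have hpos := integral_graphWeight_pos_of_variance_pos G μ hHm hHsym hH01 (hA 0)
    have hbound := ((tendsto_inv_atTop_zero.comp tendsto_natCast_atTop_atTop).add
      (tendsto_inv_atTop_zero.comp hlim)).mul_const ((4 * ((k : ℝ) + 1)) ^ k
        / (∫ x, graphWeight H hHsym G x ∂(Measure.pi fun _ => μ)) ^ 2)
    rw [add_zero, zero_mul] at hbound
    refine squeeze_zero' (Filter.Eventually.of_forall fun n => measureReal_nonneg) ?_ hbound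
    filter_upwards [hlim.eventually_ge_atTop 1, Filter.eventually_ge_atTop (2 * k)] with n hω hn
    exact measureReal_noCopy_le μ hHm hHsym hH01 ⟨(hp n).1, (hp n).2.le⟩ G hbal hk he hpos hn hω
end
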